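/- arXiv:1703.08108 — 2 statements merged into one kernel-verified Lean document; each statement's English description precedes it below -/
import Mathlib

section
/- Any two C² immersions of the 2-sphere S² into ℝ³ are regularly homotopic; equivalently, the space of immersions Imm(S², ℝ³) with the C¹ topology is path-connected. -/
open Metric Function
open scoped Manifold

noncomputable section

abbrev E3 := EuclideanSpace ℝ (Fin 3)
abbrev S2 := Metric.sphere (0 : E3) 1

instance : Fact (Module.finrank ℝ E3 = 2 + 1) := ⟨by simp⟩

/-- A `C¹` immersion of the sphere `S²` into `ℝ³`: a `C¹` map whose differential is
injective at every point. -/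
def IsImmersionS2 (f : S2 → E3) : Prop :=
  ContMDiff (𝓡 2) 𝓘(ℝ, E3) 1 f ∧
    ∀ x : S2, Injective (mfderiv (𝓡 2) 𝓘(ℝ, E3) f x)

/-- Two immersions `S² → ℝ³` are regularly homotopic: they are joined by a family
`F t`, `t ∈ [0,1]`, of immersions such that values and differentials (encoded by the
tangent maps) depend continuously on `(t, x)`. -/
def RegularlyHomotopic (f₀ f₁ : S2 → E3) : Prop :=
  ∃ F : ℝ → S2 → E3,
    (∀ t ∈ Set.Icc (0 : ℝ) 1, IsImmersionS2 (F t)) ∧ F 0 = f₀ ∧ F 1 = f₁ ∧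
    Continuous (fun q : ℝ × TangentBundle (𝓡 2) S2 =>
      tangentMap (𝓡 2) 𝓘(ℝ, E3) (F q.1) q.2)

section

open Set Filter Topology
open scoped ContDiff Matrix Quaternion

/-- The value space `ℝ³` in coordinates, used for maps defined on the plane. -/
abbrev V3 := Fin 3 → ℝ

/-- Space-time `ℝ × ℝ²`. -/
abbrev TP := ℝ × (ℝ × ℝ)

theorem ContDiff.cross {E : Type*} [NormedAddCommGroup E] [NormedSpace ℝ E] {n : ℕ∞ω}
    {f g : E → V3} (hf : ContDiff ℝ n f) (hg : ContDiff ℝ n g) :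
    ContDiff ℝ n (fun x => f x ⨯₃ g x) := by
  have hf' := contDiff_pi.1 hf
  have hg' := contDiff_pi.1 hg
  rw [contDiff_pi]
  intro i
  fin_cases i <;> simp only [cross_apply] <;> simp <;>
    exact ((hf' _).mul (hg' _)).sub ((hf' _).mul (hg' _))

theorem ContDiff.dotProduct' {E : Type*} [NormedAddCommGroup E] [NormedSpace ℝ E] {n : ℕ∞ω}
    {f g : E → V3} (hf : ContDiff ℝ n f) (hg : ContDiff ℝ n g) :
    ContDiff ℝ n (fun x => f x ⬝ᵥ g x) := by
  have hf' := contDiff_pi.1 hf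
  have hg' := contDiff_pi.1 hg
  simp only [dotProduct, Fin.sum_univ_three]
  fun_prop

theorem Continuous.cross {X : Type*} [TopologicalSpace X] {f g : X → V3}
    (hf : Continuous f) (hg : Continuous g) : Continuous (fun x => f x ⨯₃ g x) := by
  have h : ContDiff ℝ 0 (fun p : V3 × V3 => p.1 ⨯₃ p.2) :=
    ContDiff.cross contDiff_fst contDiff_snd
  exact h.continuous.comp (hf.prodMk hg)

/-- A pair of continuous vector fields independent on a compact set stays independent after a
uniformly small perturbation. -/
theorem IsCompact.exists_cross_ne_zero_of_near {Z : Type*} [TopologicalSpace Z] {K : Set Z}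
    (hK : IsCompact K) {A W : Z → V3} (hA : ContinuousOn A K) (hW : ContinuousOn W K)
    (h : ∀ z ∈ K, A z ⨯₃ W z ≠ 0) :
    ∃ ε > 0, ∀ z ∈ K, ∀ A' W' : V3, ‖A' - A z‖ < ε → ‖W' - W z‖ < ε → A' ⨯₃ W' ≠ 0 := by
  have hU : IsOpen {p : V3 × V3 | p.1 ⨯₃ p.2 ≠ 0} :=
    isOpen_ne_fun (Continuous.cross continuous_fst continuous_snd) continuous_const
  have hsub : (fun z => (A z, W z)) '' K ⊆ {p : V3 × V3 | p.1 ⨯₃ p.2 ≠ 0} := by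
    rintro _ ⟨z, hz, rfl⟩
    exact h z hz
  obtain ⟨ε, hε, hth⟩ :=
    (hK.image_of_continuousOn (hA.prodMk hW)).exists_thickening_subset_open hU hsub
  refine ⟨ε, hε, fun z hz A' W' h1 h2 => ?_⟩
  have : (A', W') ∈ thickening ε ((fun z => (A z, W z)) '' K) := by
    rw [mem_thickening_iff]
    refine ⟨_, ⟨z, hz, rfl⟩, ?_⟩
    rw [Prod.dist_eq, max_lt_iff]
    exact ⟨by simpa [dist_eq_norm] using h1, by simpa [dist_eq_norm] using h2⟩
  exact hth this

/-- The corrugation of `f` of frequency `N` in the direction of the linear form `l`, with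
amplitude fields `a` and `n`. -/
def corrugate (l : ℝ × ℝ →L[ℝ] ℝ) (N : ℝ) (f a n : TP → V3) (z : TP) : V3 :=
  f z + N⁻¹ • ((2⁻¹ * Real.sin (2 * (N * l z.2))) • a z - Real.cos (N * l z.2) • n z)

theorem contDiff_corrugate {l : ℝ × ℝ →L[ℝ] ℝ} {N : ℝ} {f a n : TP → V3} (hf : ContDiff ℝ ∞ f)
    (ha : ContDiff ℝ ∞ a) (hn : ContDiff ℝ ∞ n) : ContDiff ℝ ∞ (corrugate l N f a n) := by
  unfold corrugate
  fun_prop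

theorem fderiv_corrugate {l : ℝ × ℝ →L[ℝ] ℝ} {N : ℝ} (hN : N ≠ 0) {f a n : TP → V3}
    (hf : ContDiff ℝ ∞ f) (ha : ContDiff ℝ ∞ a) (hn : ContDiff ℝ ∞ n) (z : TP) (v : ℝ × ℝ) :
    fderiv ℝ (corrugate l N f a n) z (0, v) = fderiv ℝ f z (0, v) +
      l v • (Real.cos (2 * (N * l z.2)) • a z + Real.sin (N * l z.2) • n z) +
      N⁻¹ • ((2⁻¹ * Real.sin (2 * (N * l z.2))) • fderiv ℝ a z (0, v)
        - Real.cos (N * l z.2) • fderiv ℝ n z (0, v)) := by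
  have hf' := (hf.differentiable (by simp) z).hasFDerivAt
  have ha' := (ha.differentiable (by simp) z).hasFDerivAt
  have hn' := (hn.differentiable (by simp) z).hasFDerivAt
  have hl : HasFDerivAt (fun z : TP => N * l z.2)
      (N • (l.comp (ContinuousLinearMap.snd ℝ ℝ (ℝ × ℝ)))) z :=
    (l.comp (ContinuousLinearMap.snd ℝ ℝ (ℝ × ℝ))).hasFDerivAt.const_mul N
  have h1 := ((hl.const_mul 2).sin.const_mul 2⁻¹).smul ha'
  have h2 := hl.cos.smul hn'
  have h := hf'.add ((h1.sub h2).const_smul N⁻¹)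
  have := h.fderiv
  rw [show corrugate l N f a n = _ from rfl]
  erw [this]
  ext i
  simp
  field_simp
  ring

theorem exists_corrugate_near {l : ℝ × ℝ →L[ℝ] ℝ} {f a n : TP → V3}
    (hf : ContDiff ℝ ∞ f) (ha : ContDiff ℝ ∞ a) (hn : ContDiff ℝ ∞ n) {K : Set TP}
    (hK : IsCompact K) (v : ℝ × ℝ) {ε : ℝ} (hε : 0 < ε) :
    ∃ N₀ > 0, ∀ N ≥ N₀, ∀ z ∈ K, ‖fderiv ℝ (corrugate l N f a n) z (0, v) -
      (fderiv ℝ f z (0, v) +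
      l v • (Real.cos (2 * (N * l z.2)) • a z + Real.sin (N * l z.2) • n z))‖ < ε := by
  have hca : Continuous fun z => fderiv ℝ a z (0, v) :=
    (ha.continuous_fderiv (by simp)).clm_apply continuous_const
  have hcn : Continuous fun z => fderiv ℝ n z (0, v) :=
    (hn.continuous_fderiv (by simp)).clm_apply continuous_const
  obtain ⟨Ca, hCa⟩ := hK.exists_bound_of_continuousOn hca.continuousOn
  obtain ⟨Cn, hCn⟩ := hK.exists_bound_of_continuousOn hcn.continuousOn
  have hpos : 0 < |Ca| + |Cn| + 1 := by positivity
  refine ⟨(|Ca| + |Cn| + 1) / ε, by positivity, fun N hN z hz => ?_⟩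
  have hN0 : 0 < N := lt_of_lt_of_le (by positivity) hN
  rw [fderiv_corrugate hN0.ne' hf ha hn, add_sub_cancel_left, norm_smul, norm_inv,
    Real.norm_of_nonneg hN0.le]
  have h1 : ‖(2⁻¹ * Real.sin (2 * (N * l z.2))) • fderiv ℝ a z (0, v)
        - Real.cos (N * l z.2) • fderiv ℝ n z (0, v)‖ ≤ |Ca| + |Cn| := by
    refine (norm_sub_le _ _).trans (add_le_add ?_ ?_)
    · rw [norm_smul]
      have h3 : ‖(2⁻¹ * Real.sin (2 * (N * l z.2)))‖ ≤ 1 := by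
        rw [Real.norm_eq_abs, abs_mul]
        have := Real.abs_sin_le_one (2 * (N * l z.2))
        rw [abs_of_pos (by norm_num : (0:ℝ) < 2⁻¹)]
        linarith
      calc _ ≤ 1 * ‖fderiv ℝ a z (0, v)‖ := by gcongr
        _ ≤ |Ca| := by rw [one_mul]; exact (hCa z hz).trans (le_abs_self _)
    · rw [norm_smul]
      have h3 : ‖Real.cos (N * l z.2)‖ ≤ 1 := Real.abs_cos_le_one _
      calc _ ≤ 1 * ‖fderiv ℝ n z (0, v)‖ := by gcongr
        _ ≤ |Cn| := by rw [one_mul]; exact (hCn z hz).trans (le_abs_self _)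
  rw [inv_mul_lt_iff₀ hN0]
  have : (|Ca| + |Cn| + 1) ≤ N * ε := by
    rwa [ge_iff_le, div_le_iff₀ hε] at hN
  linarith

/-- The parabola swept by the derivative of a corrugation. -/
def parabola : Set (ℝ × ℝ) := (fun y : ℝ => (1 - 2 * y ^ 2, y)) '' Icc (-1) 1

theorem isCompact_parabola : IsCompact parabola :=
  isCompact_Icc.image (by fun_prop)

theorem cos_sin_mem_parabola (φ : ℝ) : (Real.cos (2 * φ), Real.sin φ) ∈ parabola := by
  refine ⟨Real.sin φ, ⟨Real.neg_one_le_sin φ, Real.sin_le_one φ⟩, ?_⟩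
  simp only [Prod.mk.injEq, and_true]
  rw [Real.cos_two_mul, Real.cos_sq']
  ring

/-- If all the vectors swept by the derivative of a corrugation are independent of `w`, then a
corrugation of high frequency makes the derivative in the direction `u` independent of `w`. -/
theorem exists_corrugate_cross_ne_zero {l : ℝ × ℝ →L[ℝ] ℝ} {u u' : ℝ × ℝ} (hu : l u = 1)
    (hu' : l u' = 0) {f a n w : TP → V3}
    (hf : ContDiff ℝ ∞ f) (ha : ContDiff ℝ ∞ a) (hn : ContDiff ℝ ∞ n) (hw : ContDiff ℝ ∞ w)
    {K : Set TP} (hK : IsCompact K)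
    (h : ∀ z ∈ K, ∀ y ∈ parabola,
      (fderiv ℝ f z (0, u) + (y.1 • a z + y.2 • n z)) ⨯₃ w z ≠ 0) :
    ∃ N : ℝ, ∀ z ∈ K, fderiv ℝ (corrugate l N f a n) z (0, u) ⨯₃ w z ≠ 0 ∧
      (w z = fderiv ℝ f z (0, u') → fderiv ℝ (corrugate l N f a n) z (0, u) ⨯₃
        fderiv ℝ (corrugate l N f a n) z (0, u') ≠ 0) := by
  have hc : Continuous fun z => fderiv ℝ f z (0, u) :=
    (hf.continuous_fderiv (by simp)).clm_apply continuous_const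
  have hca := ha.continuous
  have hcn := hn.continuous
  have hcw := hw.continuous
  obtain ⟨ε, hε, hnear⟩ := (hK.prod isCompact_parabola).exists_cross_ne_zero_of_near
    (A := fun q : TP × (ℝ × ℝ) =>
      fderiv ℝ f q.1 (0, u) + (q.2.1 • a q.1 + q.2.2 • n q.1)) (W := fun q => w q.1)
    (Continuous.continuousOn (by fun_prop)) (Continuous.continuousOn (by fun_prop))
    (fun q hq => h q.1 hq.1 q.2 hq.2)
  obtain ⟨N₁, hN₁, h₁⟩ := exists_corrugate_near (l := l) hf ha hn hK u hε
  obtain ⟨N₂, hN₂, h₂⟩ := exists_corrugate_near (l := l) hf ha hn hK u' hε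
  refine ⟨max N₁ N₂, fun z hz => ?_⟩
  have e₁ := h₁ _ (le_max_left N₁ N₂) z hz
  have e₂ := h₂ _ (le_max_right N₁ N₂) z hz
  rw [hu, one_smul] at e₁
  rw [hu', zero_smul, add_zero] at e₂
  have key := hnear (z, _) ⟨hz, cos_sin_mem_parabola (max N₁ N₂ * l z.2)⟩
  refine ⟨key _ _ e₁ (by simpa using hε), fun hwz => key _ _ e₁ ?_⟩
  simpa [hwz] using e₂

theorem cross_ne_zero_of_holonomic {a n w c : V3} (hT : a ⬝ᵥ n ⨯₃ w ≠ 0) {lam mu : ℝ}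
    (hlam : 0 < lam) (hc : c = lam • a + mu • w) {R : ℝ} (hR : 0 ≤ R) {y : ℝ × ℝ}
    (hy : y ∈ parabola) : (c + (y.1 • (R • a) + y.2 • (R • n))) ⨯₃ w ≠ 0 := by
  obtain ⟨s, -, rfl⟩ := hy
  intro h
  have h1 : n ⬝ᵥ (c + ((1 - 2 * s ^ 2) • (R • a) + s • (R • n))) ⨯₃ w = 0 := by
    simp only at h
    rw [h]; simp
  have h2 : a ⬝ᵥ (c + ((1 - 2 * s ^ 2) • (R • a) + s • (R • n))) ⨯₃ w = 0 := by
    simp only at h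
    rw [h]; simp
  have e1 : n ⬝ᵥ (c + ((1 - 2 * s ^ 2) • (R • a) + s • (R • n))) ⨯₃ w =
      -(lam + R * (1 - 2 * s ^ 2)) * (a ⬝ᵥ n ⨯₃ w) := by
    subst hc
    simp [cross_apply, dotProduct, Fin.sum_univ_three]
    ring
  have e2 : a ⬝ᵥ (c + ((1 - 2 * s ^ 2) • (R • a) + s • (R • n))) ⨯₃ w =
      (R * s) * (a ⬝ᵥ n ⨯₃ w) := by
    subst hc
    simp [cross_apply, dotProduct, Fin.sum_univ_three]
    ring
  rw [h1] at e1
  rw [h2] at e2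
  have e3 := (mul_eq_zero.1 e2.symm).resolve_right hT
  have e4 := (mul_eq_zero.1 e1.symm).resolve_right hT
  rcases mul_eq_zero.1 e3 with h0 | h0 <;> subst h0
  · linarith
  · nlinarith

theorem cross_ne_zero_of_mem_parabola {a n w : V3} (hT : a ⬝ᵥ n ⨯₃ w ≠ 0) {y : ℝ × ℝ}
    (hy : y ∈ parabola) : (y.1 • a + y.2 • n) ⨯₃ w ≠ 0 := by
  obtain ⟨s, -, rfl⟩ := hy
  intro h
  have h1 : n ⬝ᵥ ((1 - 2 * s ^ 2) • a + s • n) ⨯₃ w = 0 := by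
    simp only at h
    rw [h]; simp
  have h2 : a ⬝ᵥ ((1 - 2 * s ^ 2) • a + s • n) ⨯₃ w = 0 := by
    simp only at h
    rw [h]; simp
  have e1 : n ⬝ᵥ ((1 - 2 * s ^ 2) • a + s • n) ⨯₃ w =
      -(1 - 2 * s ^ 2) * (a ⬝ᵥ n ⨯₃ w) := by
    simp [cross_apply, dotProduct, Fin.sum_univ_three]
    ring
  have e2 : a ⬝ᵥ ((1 - 2 * s ^ 2) • a + s • n) ⨯₃ w = s * (a ⬝ᵥ n ⨯₃ w) := by
    simp [cross_apply, dotProduct, Fin.sum_univ_three]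
    ring
  rw [h1] at e1
  rw [h2] at e2
  have e3 := (mul_eq_zero.1 e2.symm).resolve_right hT
  have e4 := (mul_eq_zero.1 e1.symm).resolve_right hT
  subst e3
  norm_num at e4

/-- A large enough amplitude makes every vector swept by a corrugation independent of `w`. -/
theorem exists_amplitude {K : Set TP} (hK : IsCompact K) {c a n w : TP → V3}
    (hc : Continuous c) (ha : Continuous a) (hn : Continuous n) (hw : Continuous w)
    (hT : ∀ z ∈ K, a z ⬝ᵥ n z ⨯₃ w z ≠ 0) :
    ∃ R : ℝ, 0 < R ∧ ∀ z ∈ K, ∀ y ∈ parabola,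
      (c z + (y.1 • (R • a z) + y.2 • (R • n z))) ⨯₃ w z ≠ 0 := by
  obtain ⟨ε, hε, hnear⟩ := (hK.prod isCompact_parabola).exists_cross_ne_zero_of_near
    (A := fun q : TP × (ℝ × ℝ) => q.2.1 • a q.1 + q.2.2 • n q.1) (W := fun q => w q.1)
    (Continuous.continuousOn (by fun_prop)) (Continuous.continuousOn (by fun_prop))
    (fun q hq => cross_ne_zero_of_mem_parabola (hT q.1 hq.1) hq.2)
  obtain ⟨C, hC⟩ := hK.exists_bound_of_continuousOn hc.continuousOn
  have hR : 0 < (|C| + 1) / ε := by positivity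
  refine ⟨(|C| + 1) / ε, hR, fun z hz y hy => ?_⟩
  set R := (|C| + 1) / ε
  have key := hnear (z, y) ⟨hz, hy⟩ (R⁻¹ • c z + (y.1 • a z + y.2 • n z)) (w z)
    (by
      simp only [add_sub_cancel_right]
      rw [norm_smul, norm_inv, Real.norm_of_nonneg hR.le, inv_mul_lt_iff₀ hR]
      have : R * ε = |C| + 1 := by simp only [R]; field_simp
      rw [this]
      have := (hC z hz).trans (le_abs_self C)
      linarith) (by simpa using hε)
  intro h0
  apply key
  have : c z + (y.1 • (R • a z) + y.2 • (R • n z)) =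
      R • (R⁻¹ • c z + (y.1 • a z + y.2 • n z)) := by
    ext i
    simp
    field_simp
  rw [this, map_smul, LinearMap.smul_apply] at h0
  exact (smul_eq_zero.1 h0).resolve_left (ne_of_gt hR)

/-- One step of convex integration: `f` is corrugated where `ρ ≠ 0`, so that its derivative in
the direction `u` becomes independent of `w`, provided `(a, n, w)` is a frame which is compatible
with `f` wherever `ρ` is not equal to one. -/
theorem exists_corrugation_step {l : ℝ × ℝ →L[ℝ] ℝ} {u u' : ℝ × ℝ} (hu : l u = 1)
    (hu' : l u' = 0) {f a n w : TP → V3} {ρ : TP → ℝ}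
    (hf : ContDiff ℝ ∞ f) (ha : ContDiff ℝ ∞ a) (hn : ContDiff ℝ ∞ n) (hw : ContDiff ℝ ∞ w)
    (hρ : ContDiff ℝ ∞ ρ) (hρ0 : ∀ z, 0 ≤ ρ z) {K : Set TP} (hK : IsCompact K)
    (hT : ∀ z ∈ K, a z ⬝ᵥ n z ⨯₃ w z ≠ 0)
    (h : ∀ z ∈ K, ρ z = 1 ∨ ∃ lam mu : ℝ, 0 < lam ∧
      fderiv ℝ f z (0, u) = lam • a z + mu • w z) :
    ∃ F : TP → V3, ContDiff ℝ ∞ F ∧ (∀ z, ρ z = 0 → F z = f z) ∧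
      ∀ z ∈ K, fderiv ℝ F z (0, u) ⨯₃ w z ≠ 0 ∧
      (w z = fderiv ℝ f z (0, u') → fderiv ℝ F z (0, u) ⨯₃ fderiv ℝ F z (0, u') ≠ 0) := by
  have hc : Continuous fun z => fderiv ℝ f z (0, u) :=
    (hf.continuous_fderiv (by simp)).clm_apply continuous_const
  obtain ⟨R, hR, hlarge⟩ := exists_amplitude hK hc ha.continuous hn.continuous hw.continuous hT
  have ha' : ContDiff ℝ ∞ fun z => (R * ρ z) • a z := by fun_prop
  have hn' : ContDiff ℝ ∞ fun z => (R * ρ z) • n z := by fun_prop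
  obtain ⟨N, hN⟩ := exists_corrugate_cross_ne_zero hu hu' hf ha' hn' hw hK (by
    intro z hz y hy
    rcases h z hz with h1 | ⟨lam, mu, hlam, hc⟩
    · simpa [h1] using hlarge z hz y hy
    · exact cross_ne_zero_of_holonomic (hT z hz) hlam hc (mul_nonneg hR.le (hρ0 z)) hy)
  refine ⟨_, contDiff_corrugate hf ha' hn', fun z hz => ?_, hN⟩
  simp [corrugate, hz]

/-- The partial derivatives of `g : ℝ² → ℝ³` are independent everywhere. -/
def PlaneImmersion (g : ℝ × ℝ → V3) : Prop :=
  ∀ p, fderiv ℝ g p (1, 0) ⨯₃ fderiv ℝ g p (0, 1) ≠ 0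

/-- At `p`, the pair `(a, b)` agrees with the partial derivatives of `g` up to positive rescaling
and adding to the first vector a multiple of the second one. -/
def FrameAdapted (g : ℝ × ℝ → V3) (p : ℝ × ℝ) (a b : V3) : Prop :=
  (∃ lam mu : ℝ, 0 < lam ∧ fderiv ℝ g p (1, 0) = lam • a + mu • b) ∧
    ∃ kappa : ℝ, 0 < kappa ∧ fderiv ℝ g p (0, 1) = kappa • b

theorem fderiv_slice {F : TP → V3} (hF : ContDiff ℝ ∞ F) (t : ℝ) (p v : ℝ × ℝ) :
    fderiv ℝ (fun q => F (t, q)) p v = fderiv ℝ F (t, p) (0, v) := by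
  have h : HasFDerivAt (fun q : ℝ × ℝ => (t, q)) (ContinuousLinearMap.inr ℝ ℝ (ℝ × ℝ)) p :=
    hasFDerivAt_prodMk_right t p
  have := ((hF.differentiable (by simp) (t, p)).hasFDerivAt.comp p h).fderiv
  rw [show (fun q => F (t, q)) = F ∘ fun q => (t, q) from rfl, this]
  simp

theorem fderiv_of_slice_eventuallyEq {F : TP → V3} (hF : ContDiff ℝ ∞ F) {t : ℝ} {p : ℝ × ℝ}
    {g : ℝ × ℝ → V3} (h : (fun q => F (t, q)) =ᶠ[𝓝 p] g) (v : ℝ × ℝ) :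
    fderiv ℝ F (t, p) (0, v) = fderiv ℝ g p v := by
  rw [← fderiv_slice hF, h.fderiv_eq]

theorem eventually_lt_norm {r : ℝ} {p : ℝ × ℝ} (hp : r < ‖p‖) : ∀ᶠ q in 𝓝 p, r < ‖q‖ :=
  continuous_norm.continuousAt.eventually_const_lt hp

/-- The relative `h`-principle on the plane: a homotopy of frames between two immersions which
agree outside a ball yields a homotopy through immersions. -/
theorem exists_plane_homotopy_of_frames {g₀ g₁ : ℝ × ℝ → V3} (hg₀ : ContDiff ℝ ∞ g₀)
    (hg₁ : ContDiff ℝ ∞ g₁) (hi₀ : PlaneImmersion g₀) {r : ℝ}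
    (hr : 0 < r) (hEq : ∀ p, r < ‖p‖ → g₀ p = g₁ p) {a n b : TP → V3}
    (ha : ContDiff ℝ ∞ a) (hn : ContDiff ℝ ∞ n) (hb : ContDiff ℝ ∞ b)
    (hT : ∀ z, a z ⬝ᵥ n z ⨯₃ b z ≠ 0)
    (h₀ : ∀ t p, t ≤ 0 ∨ r < ‖p‖ → FrameAdapted g₀ p (a (t, p)) (b (t, p)))
    (h₁ : ∀ t p, 1 ≤ t → FrameAdapted g₁ p (a (t, p)) (b (t, p))) :
    ∃ G : TP → V3, ContDiff ℝ ∞ G ∧ (∀ p, G (0, p) = g₀ p) ∧ (∀ p, G (1, p) = g₁ p) ∧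
      (∃ r', r < r' ∧ ∀ t p, r' ≤ ‖p‖ → G (t, p) = g₀ p) ∧
      ∀ t ∈ Icc (0 : ℝ) 1, PlaneImmersion fun p => G (t, p) := by
  set K : Set TP := Icc (0 : ℝ) 1 ×ˢ closedBall (0 : ℝ × ℝ) (r + 4) with hKdef
  have hK : IsCompact K := isCompact_Icc.prod (isCompact_closedBall _ _)
  have hθ : ContDiff ℝ ∞ Real.smoothTransition := Real.smoothTransition.contDiff
  let χ₁ : ContDiffBump (0 : ℝ × ℝ) := ⟨r + 1, r + 2, by linarith, by linarith⟩
  let χ₂ : ContDiffBump (0 : ℝ × ℝ) := ⟨r + 2, r + 3, by linarith, by linarith⟩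
  have hχ₁ : ContDiff ℝ ∞ χ₁ := χ₁.contDiff
  have hχ₂ : ContDiff ℝ ∞ χ₂ := χ₂.contDiff
  let f : TP → V3 := fun z => g₀ z.2 + Real.smoothTransition (5 * z.1 - 2) • (g₁ z.2 - g₀ z.2)
  have hf : ContDiff ℝ ∞ f := by fun_prop
  have hf₀ : ∀ t p, t ≤ 2 / 5 → f (t, p) = g₀ p := fun t p ht => by
    simp only [f]
    rw [Real.smoothTransition.zero_of_nonpos (by linarith)]
    simp
  have hf₁ : ∀ t p, 3 / 5 ≤ t → f (t, p) = g₁ p := fun t p ht => by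
    simp only [f]
    rw [Real.smoothTransition.one_of_one_le (by linarith)]
    simp
  have hfr : ∀ t p, r < ‖p‖ → f (t, p) = g₀ p := fun t p hp => by
    simp [f, hEq p hp]
  let s : TP → TP := fun z => (5 * z.1 - 2, z.2)
  have hs : ContDiff ℝ ∞ s := by fun_prop
  let ρ₁ : TP → ℝ := fun z =>
    Real.smoothTransition (5 * z.1 - 1) * Real.smoothTransition (4 - 5 * z.1) * χ₁ z.2
  have hρ₁ : ContDiff ℝ ∞ ρ₁ := by fun_prop
  let ρ₂ : TP → ℝ := fun z =>
    Real.smoothTransition (5 * z.1) * Real.smoothTransition (5 - 5 * z.1) * χ₂ z.2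
  have hρ₂ : ContDiff ℝ ∞ ρ₂ := by fun_prop
  have hρ₁z : ∀ t p, t ≤ 1 / 5 ∨ 4 / 5 ≤ t ∨ r + 2 ≤ ‖p‖ → ρ₁ (t, p) = 0 := by
    rintro t p (h | h | h)
    · simp only [ρ₁]; rw [Real.smoothTransition.zero_of_nonpos (x := 5 * t - 1) (by linarith)]; simp
    · simp only [ρ₁]; rw [Real.smoothTransition.zero_of_nonpos (x := 4 - 5 * t) (by linarith)]; simp
    · simp only [ρ₁]; rw [χ₁.zero_of_le_dist (by simpa [χ₁] using h)]; simp
  have hρ₂z : ∀ t p, t ≤ 0 ∨ 1 ≤ t ∨ r + 3 ≤ ‖p‖ → ρ₂ (t, p) = 0 := by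
    rintro t p (h | h | h)
    · simp only [ρ₂]; rw [Real.smoothTransition.zero_of_nonpos (x := 5 * t) (by linarith)]; simp
    · simp only [ρ₂]; rw [Real.smoothTransition.zero_of_nonpos (x := 5 - 5 * t) (by linarith)]; simp
    · simp only [ρ₂]; rw [χ₂.zero_of_le_dist (by simpa [χ₂] using h)]; simp
  -- corrugation in the direction of the first coordinate
  obtain ⟨F, hF, hFf, hFi⟩ := exists_corrugation_step (l := ContinuousLinearMap.fst ℝ ℝ ℝ)
    (u := (1, 0)) (u' := (0, 1)) (by simp) (by simp) hf (ha.comp hs) (hn.comp hs) (hb.comp hs)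
    hρ₁ (fun z => mul_nonneg (mul_nonneg (Real.smoothTransition.nonneg _)
      (Real.smoothTransition.nonneg _)) χ₁.nonneg) hK (fun z _ => hT (s z)) (by
    rintro ⟨t, p⟩ -
    rcases le_or_gt t (2 / 5) with ht | ht
    · right
      obtain ⟨⟨lam, mu, h1, h2⟩, -⟩ := h₀ (5 * t - 2) p (Or.inl (by linarith))
      refine ⟨lam, mu, h1, ?_⟩
      rw [fderiv_of_slice_eventuallyEq hf (g := g₀) (Eventually.of_forall fun q => hf₀ t q ht)]
      exact h2
    rcases le_or_gt (3 / 5) t with ht' | ht'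
    · right
      obtain ⟨⟨lam, mu, h1, h2⟩, -⟩ := h₁ (5 * t - 2) p (by linarith)
      refine ⟨lam, mu, h1, ?_⟩
      rw [fderiv_of_slice_eventuallyEq hf (g := g₁) (Eventually.of_forall fun q => hf₁ t q ht')]
      exact h2
    rcases le_or_gt ‖p‖ (r + 1) with hp | hp
    · left
      simp only [ρ₁]
      rw [Real.smoothTransition.one_of_one_le (by linarith),
        Real.smoothTransition.one_of_one_le (by linarith),
        χ₁.one_of_mem_closedBall (by simpa [χ₁] using hp)]
      norm_num
    · right
      have hp' : r < ‖p‖ := by linarith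
      obtain ⟨⟨lam, mu, h1, h2⟩, -⟩ := h₀ (5 * t - 2) p (Or.inr hp')
      refine ⟨lam, mu, h1, ?_⟩
      rw [fderiv_of_slice_eventuallyEq hf (g := g₀)
        ((eventually_lt_norm hp').mono fun q hq => hfr t q hq)]
      exact h2)
  have hF₀ : ∀ t p, t ≤ 1 / 5 → F (t, p) = g₀ p := fun t p ht => by
    rw [hFf _ (hρ₁z t p (Or.inl ht)), hf₀ t p (by linarith)]
  have hF₁ : ∀ t p, 4 / 5 ≤ t → F (t, p) = g₁ p := fun t p ht => by
    rw [hFf _ (hρ₁z t p (Or.inr (Or.inl ht))), hf₁ t p (by linarith)]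
  have hFr : ∀ t p, r + 2 < ‖p‖ → F (t, p) = g₀ p := fun t p hp => by
    rw [hFf _ (hρ₁z t p (Or.inr (Or.inr hp.le))), hfr t p (by linarith)]
  have hw : ContDiff ℝ ∞ fun z => fderiv ℝ F z (0, ((1 : ℝ), (0 : ℝ))) :=
    (hF.fderiv_right (m := ∞) (by simp)).clm_apply contDiff_const
  have hbs : ContDiff ℝ ∞ fun z => b (s z) := hb.comp hs
  -- corrugation in the direction of the second coordinate
  obtain ⟨G, hG, hGF, hGi⟩ := exists_corrugation_step (l := ContinuousLinearMap.snd ℝ ℝ ℝ)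
    (u := (0, 1)) (u' := (1, 0)) (by simp) (by simp) hF hbs (hw.cross hbs) hw
    hρ₂ (fun z => mul_nonneg (mul_nonneg (Real.smoothTransition.nonneg _)
      (Real.smoothTransition.nonneg _)) χ₂.nonneg) hK (by
    intro z hz
    have h1 := (hFi z hz).1
    simp only [comp_apply] at h1
    rw [triple_product_permutation]
    exact fun h => h1 (dotProduct_self_eq_zero.1 h)) (by
    rintro ⟨t, p⟩ -
    rcases le_or_gt t (1 / 5) with ht | ht
    · right
      obtain ⟨-, kappa, h1, h2⟩ := h₀ (5 * t - 2) p (Or.inl (by linarith))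
      refine ⟨kappa, 0, h1, ?_⟩
      rw [fderiv_of_slice_eventuallyEq hF (g := g₀) (Eventually.of_forall fun q => hF₀ t q ht),
        h2]
      simp [s]
    rcases le_or_gt (4 / 5) t with ht' | ht'
    · right
      obtain ⟨-, kappa, h1, h2⟩ := h₁ (5 * t - 2) p (by linarith)
      refine ⟨kappa, 0, h1, ?_⟩
      rw [fderiv_of_slice_eventuallyEq hF (g := g₁) (Eventually.of_forall fun q => hF₁ t q ht'),
        h2]
      simp [s]
    rcases le_or_gt ‖p‖ (r + 2) with hp | hp
    · left
      simp only [ρ₂]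
      rw [Real.smoothTransition.one_of_one_le (by linarith),
        Real.smoothTransition.one_of_one_le (by linarith),
        χ₂.one_of_mem_closedBall (by simpa [χ₂] using hp)]
      norm_num
    · right
      obtain ⟨-, kappa, h1, h2⟩ := h₀ (5 * t - 2) p (Or.inr (by linarith))
      refine ⟨kappa, 0, h1, ?_⟩
      rw [fderiv_of_slice_eventuallyEq hF (g := g₀)
        ((eventually_lt_norm hp).mono fun q hq => hFr t q hq), h2]
      simp [s])
  have hGr : ∀ t p, r + 3 ≤ ‖p‖ → G (t, p) = g₀ p := fun t p hp => by
    rw [hGF _ (hρ₂z t p (Or.inr (Or.inr hp))), hFr t p (by linarith)]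
  refine ⟨G, hG, fun p => ?_, fun p => ?_, ⟨r + 3, by linarith, hGr⟩, fun t ht p => ?_⟩
  · rw [hGF _ (hρ₂z 0 p (Or.inl le_rfl)), hF₀ 0 p (by norm_num)]
  · rw [hGF _ (hρ₂z 1 p (Or.inr (Or.inl le_rfl))), hF₁ 1 p (by norm_num)]
  · rw [fderiv_slice hG, fderiv_slice hG]
    rcases le_or_gt ‖p‖ (r + 4) with hp | hp
    · have h1 := (hGi (t, p) ⟨ht, by simpa using hp⟩).2 rfl
      rw [← cross_anticomm]
      exact neg_ne_zero.2 h1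
    · have h2 : (fun q => G (t, q)) =ᶠ[𝓝 p] g₀ :=
        (eventually_lt_norm hp).mono fun q hq => hGr t q (by linarith)
      rw [fderiv_of_slice_eventuallyEq hG h2, fderiv_of_slice_eventuallyEq hG h2]
      exact hi₀ p

/-- The linear map `v ↦ q v q̄` on imaginary quaternions, as a matrix. -/
def quatRot (q : ℍ) : Matrix (Fin 3) (Fin 3) ℝ :=
  !![q.re ^ 2 + q.imI ^ 2 - q.imJ ^ 2 - q.imK ^ 2, 2 * (q.imI * q.imJ - q.re * q.imK),
      2 * (q.imI * q.imK + q.re * q.imJ);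
    2 * (q.imI * q.imJ + q.re * q.imK), q.re ^ 2 - q.imI ^ 2 + q.imJ ^ 2 - q.imK ^ 2,
      2 * (q.imJ * q.imK - q.re * q.imI);
    2 * (q.imI * q.imK - q.re * q.imJ), 2 * (q.imJ * q.imK + q.re * q.imI),
      q.re ^ 2 - q.imI ^ 2 - q.imJ ^ 2 + q.imK ^ 2]

theorem quatRot_mul (p q : ℍ) : quatRot (p * q) = quatRot p * quatRot q := by
  ext i j
  fin_cases i <;> fin_cases j <;>
    simp [quatRot, Matrix.mul_apply, Fin.sum_univ_three] <;> ring

theorem quatRot_smul (c : ℝ) (q : ℍ) : quatRot (c • q) = c ^ 2 • quatRot q := by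
  ext i j
  fin_cases i <;> fin_cases j <;> simp [quatRot] <;> ring

theorem quatRot_one : quatRot 1 = 1 := by
  ext i j
  fin_cases i <;> fin_cases j <;> simp [quatRot]

theorem quatRot_star (q : ℍ) : quatRot (star q) = (quatRot q)ᵀ := by
  ext i j
  fin_cases i <;> fin_cases j <;> simp [quatRot] <;> ring

theorem det_quatRot (q : ℍ) : (quatRot q).det = Quaternion.normSq q ^ 3 := by
  rw [Matrix.det_fin_three, Quaternion.normSq_def']
  simp [quatRot]
  ring

/-- A quaternion with positive real part representing, up to scaling, a given rotation whose
angle is not `π`. -/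
def quatOfRot (B : Matrix (Fin 3) (Fin 3) ℝ) : ℍ :=
  ⟨1 + B 0 0 + B 1 1 + B 2 2, B 2 1 - B 1 2, B 0 2 - B 2 0, B 1 0 - B 0 1⟩

theorem specialOrthogonal_eqs {B : Matrix (Fin 3) (Fin 3) ℝ}
    (hB : B ∈ Matrix.specialOrthogonalGroup (Fin 3) ℝ) :
    B * Bᵀ = 1 ∧ Bᵀ * B = 1 ∧ B.adjugate = Bᵀ := by
  obtain ⟨h1, h2⟩ := Matrix.mem_specialOrthogonalGroup_iff.1 hB
  have e1 : B * Bᵀ = 1 := (Matrix.mem_orthogonalGroup_iff _ _).1 h1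
  have e2 : Bᵀ * B = 1 := (Matrix.mem_orthogonalGroup_iff' _ _).1 h1
  refine ⟨e1, e2, ?_⟩
  have e3 := B.mul_adjugate
  rw [h2, one_smul] at e3
  calc B.adjugate = (Bᵀ * B) * B.adjugate := by rw [e2, one_mul]
    _ = Bᵀ := by rw [mul_assoc, e3, mul_one]

theorem quatRot_quatOfRot {B : Matrix (Fin 3) (Fin 3) ℝ}
    (hB : B ∈ Matrix.specialOrthogonalGroup (Fin 3) ℝ) :
    quatRot (quatOfRot B) = (4 * (1 + B.trace)) • B := by
  obtain ⟨h1, h2, h3⟩ := specialOrthogonal_eqs hB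
  have r := fun i j => congrFun (congrFun h1 i) j
  have c := fun i j => congrFun (congrFun h2 i) j
  have d := fun i j => congrFun (congrFun h3 i) j
  rw [Matrix.adjugate_fin_three] at d
  have r00 := r 0 0; have r01 := r 0 1; have r02 := r 0 2
  have r11 := r 1 1; have r12 := r 1 2; have r22 := r 2 2
  have c00 := c 0 0; have c01 := c 0 1; have c02 := c 0 2
  have c11 := c 1 1; have c12 := c 1 2; have c22 := c 2 2
  have d00 := d 0 0; have d01 := d 0 1; have d02 := d 0 2
  have d10 := d 1 0; have d11 := d 1 1; have d12 := d 1 2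
  have d20 := d 2 0; have d21 := d 2 1; have d22 := d 2 2
  clear r c d h1 h2 h3
  simp [Matrix.mul_apply, Fin.sum_univ_three] at r00 r01 r02 r11 r12 r22 c00 c01 c02
  simp [Matrix.mul_apply, Fin.sum_univ_three] at c11 c12 c22 d00 d01 d02 d10 d11 d12 d20 d21 d22
  ext i j
  fin_cases i <;> fin_cases j <;> simp [quatRot, quatOfRot, Matrix.trace, Fin.sum_univ_three]
  all_goals grind

theorem normSq_quatOfRot {B : Matrix (Fin 3) (Fin 3) ℝ}
    (hB : B ∈ Matrix.specialOrthogonalGroup (Fin 3) ℝ) :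
    Quaternion.normSq (quatOfRot B) = 4 * (1 + B.trace) := by
  obtain ⟨h1, h2, h3⟩ := specialOrthogonal_eqs hB
  have r := fun i j => congrFun (congrFun h1 i) j
  have d := fun i j => congrFun (congrFun h3 i) j
  rw [Matrix.adjugate_fin_three] at d
  have r00 := r 0 0; have r11 := r 1 1; have r22 := r 2 2
  have d00 := d 0 0; have d11 := d 1 1; have d22 := d 2 2
  simp [Matrix.mul_apply, Fin.sum_univ_three] at r00 r11 r22 d00 d11 d22
  rw [Quaternion.normSq_def']
  simp [quatOfRot, Matrix.trace, Fin.sum_univ_three]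
  linear_combination r00 + r11 + r22 + 2 * d00 + 2 * d11 + 2 * d22

def mkQuat (w x y z : ℝ) : ℍ := ⟨w, x, y, z⟩

theorem ContDiffOn.quaternion_mk {E : Type*} [NormedAddCommGroup E] [NormedSpace ℝ E] {n : ℕ∞ω}
    {s : Set E} {w x y z : E → ℝ} (hw : ContDiffOn ℝ n w s) (hx : ContDiffOn ℝ n x s)
    (hy : ContDiffOn ℝ n y s) (hz : ContDiffOn ℝ n z s) :
    ContDiffOn ℝ n (fun p => mkQuat (w p) (x p) (y p) (z p)) s := by
  have : (fun p => mkQuat (w p) (x p) (y p) (z p)) = fun p => w p • mkQuat 1 0 0 0 +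
      x p • mkQuat 0 1 0 0 + y p • mkQuat 0 0 1 0 + z p • mkQuat 0 0 0 1 := by
    funext p
    refine QuaternionAlgebra.ext ?_ ?_ ?_ ?_
    · change w p = w p * 1 + x p * 0 + y p * 0 + z p * 0; ring
    · change x p = w p * 0 + x p * 1 + y p * 0 + z p * 0; ring
    · change y p = w p * 0 + x p * 0 + y p * 1 + z p * 0; ring
    · change z p = w p * 0 + x p * 0 + y p * 0 + z p * 1; ring
  rw [this]
  fun_prop

theorem matrix_trace_one_three : (1 : Matrix (Fin 3) (Fin 3) ℝ).trace = 3 := by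
  simp

theorem eq_re_of_quatRot_eq_one {q : ℍ} (hq : Quaternion.normSq q = 1) (h : quatRot q = 1) :
    q.re ^ 2 = 1 ∧ q.imI = 0 ∧ q.imJ = 0 ∧ q.imK = 0 := by
  have h0 := congrFun (congrFun h 0) 0
  have h1 := congrFun (congrFun h 1) 1
  have h2 := congrFun (congrFun h 2) 2
  rw [Quaternion.normSq_def'] at hq
  simp [quatRot] at h0 h1 h2
  have e1 : q.imI ^ 2 = 0 := by nlinarith
  have e2 : q.imJ ^ 2 = 0 := by nlinarith
  have e3 : q.imK ^ 2 = 0 := by nlinarith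
  refine ⟨by nlinarith, ?_, ?_, ?_⟩
  · exact pow_eq_zero_iff (two_ne_zero) |>.1 e1
  · exact pow_eq_zero_iff (two_ne_zero) |>.1 e2
  · exact pow_eq_zero_iff (two_ne_zero) |>.1 e3

/-- Local lifts: a family of rotations of trace greater than `-1` lifts to unit quaternions. -/
theorem exists_lift_of_trace {s : Set (ℝ × ℝ)} {B : ℝ × ℝ → Matrix (Fin 3) (Fin 3) ℝ}
    (hB : ∀ i j, ContDiff ℝ ∞ fun p => B p i j)
    (hso : ∀ p, B p ∈ Matrix.specialOrthogonalGroup (Fin 3) ℝ) (ht : ∀ p ∈ s, -1 < (B p).trace) :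
    ∃ q : ℝ × ℝ → ℍ, ContDiffOn ℝ ∞ q s ∧
      ∀ p ∈ s, Quaternion.normSq (q p) = 1 ∧ quatRot (q p) = B p := by
  have hB' := fun i j => (hB i j).contDiffOn (s := s)
  have htr : ContDiffOn ℝ ∞ (fun p => (B p).trace) s := by
    simp only [Matrix.trace, Matrix.diag, Fin.sum_univ_three]
    fun_prop
  have hpos : ∀ p ∈ s, 0 < 4 * (1 + (B p).trace) := fun p hp => by linarith [ht p hp]
  refine ⟨fun p => (√(4 * (1 + (B p).trace)))⁻¹ • quatOfRot (B p), ?_, fun p hp => ⟨?_, ?_⟩⟩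
  · refine ContDiffOn.smul (ContDiffOn.inv (ContDiffOn.sqrt (by fun_prop)
      fun p hp => (hpos p hp).ne') fun p hp => (Real.sqrt_pos.2 (hpos p hp)).ne') ?_
    exact ContDiffOn.quaternion_mk
      (w := fun p => 1 + B p 0 0 + B p 1 1 + B p 2 2) (x := fun p => B p 2 1 - B p 1 2)
      (y := fun p => B p 0 2 - B p 2 0) (z := fun p => B p 1 0 - B p 0 1)
      (by fun_prop) (by fun_prop) (by fun_prop) (by fun_prop)
  · rw [Quaternion.normSq_smul, normSq_quatOfRot (hso p), inv_pow, Real.sq_sqrt (hpos p hp).le,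
      inv_mul_cancel₀ (hpos p hp).ne']
  · rw [quatRot_smul, quatRot_quatOfRot (hso p), inv_pow, Real.sq_sqrt (hpos p hp).le, smul_smul,
      inv_mul_cancel₀ (hpos p hp).ne', one_smul]

theorem mul_transpose_mem_specialOrthogonalGroup {A B : Matrix (Fin 3) (Fin 3) ℝ}
    (hA : A ∈ Matrix.specialOrthogonalGroup (Fin 3) ℝ)
    (hB : B ∈ Matrix.specialOrthogonalGroup (Fin 3) ℝ) :
    A * Bᵀ ∈ Matrix.specialOrthogonalGroup (Fin 3) ℝ := by
  refine mul_mem hA (Matrix.mem_specialOrthogonalGroup_iff.2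
    ⟨(Matrix.mem_orthogonalGroup_iff _ _).2 ?_, ?_⟩)
  · rw [Matrix.transpose_transpose]
    exact (specialOrthogonal_eqs hB).2.1
  · rw [Matrix.det_transpose]
    exact (Matrix.mem_specialOrthogonalGroup_iff.1 hB).2

theorem exists_subdivision_trace {A : ℝ × ℝ → Matrix (Fin 3) (Fin 3) ℝ} (hA : Continuous A)
    (hso : ∀ p, A p ∈ Matrix.specialOrthogonalGroup (Fin 3) ℝ) (R : ℝ) :
    ∃ N : ℕ, 0 < N ∧ ∀ k < N, ∀ p ∈ ball (0 : ℝ × ℝ) R,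
      -1 < (A (((k + 1 : ℝ) / N) • p) * (A (((k : ℝ) / N) • p))ᵀ).trace := by
  let G : ℝ × ℝ × (ℝ × ℝ) → ℝ := fun z => (A (z.1 • z.2.2) * (A (z.2.1 • z.2.2))ᵀ).trace
  have hG : Continuous G := by
    apply Continuous.matrix_trace
    apply Continuous.matrix_mul
    · exact hA.comp (by fun_prop)
    · exact (hA.comp (by fun_prop)).matrix_transpose
  have hK : IsCompact (Icc (0 : ℝ) 1 ×ˢ Icc (0 : ℝ) 1 ×ˢ closedBall (0 : ℝ × ℝ) R) :=
    isCompact_Icc.prod (isCompact_Icc.prod (isCompact_closedBall _ _))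
  obtain ⟨δ, hδ, h⟩ := Metric.uniformContinuousOn_iff.1
    (hK.uniformContinuousOn_of_continuous hG.continuousOn) 1 one_pos
  obtain ⟨N, hN⟩ := exists_nat_gt (1 / δ)
  have hN0 : (0 : ℝ) < N := lt_trans (by positivity) hN
  refine ⟨N, by exact_mod_cast hN0, fun k hk p hp => ?_⟩
  have hk' : (k : ℝ) + 1 ≤ N := by exact_mod_cast hk
  have m1 : ((k + 1 : ℝ) / N) ∈ Icc (0 : ℝ) 1 :=
    ⟨by positivity, (div_le_one hN0).2 hk'⟩
  have m2 : ((k : ℝ) / N) ∈ Icc (0 : ℝ) 1 :=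
    ⟨by positivity, (div_le_one hN0).2 (by linarith)⟩
  have hp' := ball_subset_closedBall hp
  have key := h (((k + 1 : ℝ) / N), ((k : ℝ) / N), p) ⟨m1, m2, hp'⟩
    (((k : ℝ) / N), ((k : ℝ) / N), p) ⟨m2, m2, hp'⟩ (by
      rw [Prod.dist_eq, dist_self, max_eq_left dist_nonneg, Real.dist_eq, ← sub_div,
        add_sub_cancel_left, abs_of_pos (by positivity)]
      rwa [div_lt_comm₀ hN0 hδ])
  have e : G (((k : ℝ) / N), ((k : ℝ) / N), p) = 3 := by
    simp only [G]
    rw [(specialOrthogonal_eqs (hso _)).1, matrix_trace_one_three]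
  rw [e, Real.dist_eq, abs_lt] at key
  have := key.1
  simp only [G] at this
  linarith

theorem isPreconnected_annulus (r R : ℝ) (hr : 0 < r) :
    IsPreconnected {p : ℝ × ℝ | r < ‖p‖ ∧ ‖p‖ < R} := by
  have h1 : IsPreconnected (sphere (0 : ℝ × ℝ) 1) := by
    refine (isConnected_sphere ?_ 0 zero_le_one).isPreconnected
    rw [← Module.finrank_eq_rank ℝ (ℝ × ℝ)]
    simp
  have h2 := (h1.prod (isPreconnected_Ioo (a := r) (b := R))).image
    (fun z : (ℝ × ℝ) × ℝ => z.2 • z.1) (by fun_prop)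
  convert h2 using 1
  ext p
  constructor
  · rintro ⟨hp1, hp2⟩
    have hp : 0 < ‖p‖ := hr.trans hp1
    exact ⟨(‖p‖⁻¹ • p, ‖p‖), ⟨by simp [norm_smul, hp.ne'], hp1, hp2⟩, by
      simp [smul_smul, hp.ne']⟩
  · rintro ⟨⟨u, t⟩, ⟨hu, ht1, ht2⟩, rfl⟩
    have : ‖u‖ = 1 := by simpa using hu
    have ht : 0 < t := hr.trans ht1
    simp only [mem_ofPred_eq, norm_smul, this, mul_one, Real.norm_of_nonneg ht.le]
    exact ⟨ht1, ht2⟩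

/-- A smooth compactly supported map from the plane to the rotation group lifts to a smooth
compactly supported map to the unit quaternions. -/
theorem exists_quaternion_lift {A : ℝ × ℝ → Matrix (Fin 3) (Fin 3) ℝ}
    (hA : ∀ i j, ContDiff ℝ ∞ fun p => A p i j)
    (hso : ∀ p, A p ∈ Matrix.specialOrthogonalGroup (Fin 3) ℝ) {r : ℝ} (hr : 0 < r)
    (h1 : ∀ p, r < ‖p‖ → A p = 1) :
    ∃ q : ℝ × ℝ → ℍ, ContDiff ℝ ∞ q ∧ (∀ p, Quaternion.normSq (q p) = 1) ∧
      (∀ p, quatRot (q p) = A p) ∧ ∀ p, r < ‖p‖ → q p = 1 := by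
  have hAc : Continuous A := by
    refine continuous_matrix fun i j => (hA i j).continuous
  obtain ⟨N, hN, htr⟩ := exists_subdivision_trace hAc hso (r + 4)
  have step : ∀ k : ℕ, k ≤ N → ∃ q : ℝ × ℝ → ℍ, ContDiffOn ℝ ∞ q (ball 0 (r + 4)) ∧
      ∀ p ∈ ball (0 : ℝ × ℝ) (r + 4), Quaternion.normSq (q p) = 1 ∧
        quatRot (q p) = A (((k : ℝ) / N) • p) * (A 0)ᵀ := by
    intro k
    induction k with
    | zero =>
      intro _
      refine ⟨fun _ => 1, contDiffOn_const, fun p _ => ⟨by simp, ?_⟩⟩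
      simp [quatRot_one, (specialOrthogonal_eqs (hso 0)).1]
    | succ k ih =>
      intro hk
      obtain ⟨q, hq, hq'⟩ := ih (by omega)
      obtain ⟨q₂, hq₂, hq₂'⟩ := exists_lift_of_trace (s := ball (0 : ℝ × ℝ) (r + 4))
        (B := fun p => A (((k + 1 : ℝ) / N) • p) * (A (((k : ℝ) / N) • p))ᵀ)
        (fun i j => by
          have e1 := fun i j => (hA i j).comp
            (g := fun p => A p i j) (f := fun p : ℝ × ℝ => ((k + 1 : ℝ) / N) • p) (by fun_prop)
          have e2 := fun i j => (hA i j).comp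
            (g := fun p => A p i j) (f := fun p : ℝ × ℝ => ((k : ℝ) / N) • p) (by fun_prop)
          simp only [Function.comp_def] at e1 e2
          simp only [Matrix.mul_apply, Fin.sum_univ_three, Matrix.transpose_apply]
          fun_prop)
        (fun p => mul_transpose_mem_specialOrthogonalGroup (hso _) (hso _))
        (fun p hp => htr k (by omega) p hp)
      refine ⟨fun p => q₂ p * q p, hq₂.mul hq, fun p hp => ⟨?_, ?_⟩⟩
      · rw [map_mul, (hq' p hp).1, (hq₂' p hp).1, one_mul]
      · rw [quatRot_mul, (hq' p hp).2, (hq₂' p hp).2, Matrix.mul_assoc, ← Matrix.mul_assoc _ᵀ,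
          (specialOrthogonal_eqs (hso _)).2.1, Matrix.one_mul]
        push_cast
        rfl
  obtain ⟨q, hq, hq'⟩ := step N le_rfl
  have hN' : (N : ℝ) ≠ 0 := by exact_mod_cast hN.ne'
  simp only [div_self hN', one_smul] at hq'
  let p₁ : ℝ × ℝ := (r + 1, 0)
  have hp₁ : ‖p₁‖ = r + 1 := by
    simp [p₁, Prod.norm_def, abs_of_pos (by linarith : 0 < r + 1)]
    linarith
  have hp₁' : p₁ ∈ ball (0 : ℝ × ℝ) (r + 4) := by
    rw [mem_ball_zero_iff, hp₁]; linarith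
  let Q : ℝ × ℝ → ℍ := fun p => q p * star (q p₁)
  have hQ : ContDiffOn ℝ ∞ Q (ball 0 (r + 4)) := hq.mul contDiffOn_const
  have hQn : ∀ p ∈ ball (0 : ℝ × ℝ) (r + 4), Quaternion.normSq (Q p) = 1 := fun p hp => by
    simp only [Q]
    rw [map_mul, Quaternion.normSq_star, (hq' p hp).1, (hq' p₁ hp₁').1, one_mul]
  have hQr : ∀ p ∈ ball (0 : ℝ × ℝ) (r + 4), quatRot (Q p) = A p := fun p hp => by
    simp only [Q]
    rw [quatRot_mul, quatRot_star, (hq' p hp).2, (hq' p₁ hp₁').2, h1 p₁ (by rw [hp₁]; linarith),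
      Matrix.one_mul, Matrix.transpose_transpose, Matrix.mul_assoc,
      (specialOrthogonal_eqs (hso _)).2.1, Matrix.mul_one]
  have hQ₁ : Q p₁ = 1 := by
    simp only [Q]
    rw [Quaternion.self_mul_star, (hq' p₁ hp₁').1]
    simp
  have hmem : ∀ p : ℝ × ℝ, ‖p‖ < r + 4 → p ∈ ball (0 : ℝ × ℝ) (r + 4) := fun p hp => by
    simpa using hp
  have hQone : ∀ p : ℝ × ℝ, r < ‖p‖ → ‖p‖ < r + 4 → Q p = 1 := by
    intro p hp hp2
    have hre : EqOn (fun p => (Q p).re) (fun _ => (1 : ℝ)) {p | r < ‖p‖ ∧ ‖p‖ < r + 4} := by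
      refine (isPreconnected_annulus r (r + 4) hr).eq_of_sq_eq ?_ continuousOn_const ?_
        (fun _ => one_ne_zero) (y := p₁) ⟨by rw [hp₁]; linarith, by rw [hp₁]; linarith⟩
        (by simp [hQ₁])
      · exact Quaternion.continuous_re.comp_continuousOn
          (hQ.continuousOn.mono fun p hp => hmem p hp.2)
      · intro p hp
        have := (eq_re_of_quatRot_eq_one (hQn p (hmem p hp.2))
          (by rw [hQr p (hmem p hp.2), h1 p hp.1])).1
        simpa using this
    obtain ⟨-, e1, e2, e3⟩ := eq_re_of_quatRot_eq_one (hQn p (hmem p hp2))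
      (by rw [hQr p (hmem p hp2), h1 p hp])
    have e0 : (Q p).re = 1 := hre ⟨hp, hp2⟩
    ext <;> simp [*]
  let χ : ContDiffBump (0 : ℝ × ℝ) := ⟨r + 1, r + 2, by linarith, by linarith⟩
  have hχ : ContDiff ℝ ∞ χ := χ.contDiff
  let q' : ℝ × ℝ → ℍ := fun p => 1 + χ p • (Q p - 1)
  have hin : ∀ p : ℝ × ℝ, ‖p‖ < r + 4 → q' p = Q p := fun p hp => by
    simp only [q']
    rcases le_or_gt ‖p‖ (r + 1) with h | h
    · rw [χ.one_of_mem_closedBall (by simpa [χ] using h), one_smul, add_sub_cancel]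
    · rw [hQone p (by linarith) hp, sub_self, smul_zero, add_zero]
  have hout : ∀ p : ℝ × ℝ, r + 2 < ‖p‖ → q' p = 1 := fun p hp => by
    simp only [q']
    rw [χ.zero_of_le_dist (by simpa [χ] using hp.le), zero_smul, add_zero]
  refine ⟨q', contDiff_iff_contDiffAt.2 fun p => ?_, fun p => ?_, fun p => ?_, fun p hp => ?_⟩
  · rcases lt_or_ge ‖p‖ (r + 4) with h | h
    · have hQ' : ContDiffAt ℝ ∞ Q p := hQ.contDiffAt (isOpen_ball.mem_nhds (hmem p h))
      have := hχ.contDiffAt (x := p)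
      simp only [q']
      fun_prop
    · refine (contDiffAt_const (c := (1 : ℍ))).congr_of_eventuallyEq ?_
      exact (eventually_lt_norm (by linarith : r + 2 < ‖p‖)).mono hout
  · rcases lt_or_ge ‖p‖ (r + 4) with h | h
    · rw [hin p h, hQn p (hmem p h)]
    · rw [hout p (by linarith)]; simp
  · rcases lt_or_ge ‖p‖ (r + 4) with h | h
    · rw [hin p h, hQr p (hmem p h)]
    · rw [hout p (by linarith), h1 p (by linarith), quatRot_one]
  · rcases lt_or_ge ‖p‖ (r + 4) with h | h
    · rw [hin p h, hQone p hp h]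
    · exact hout p (by linarith)

theorem FrameAdapted.smul {g : ℝ × ℝ → V3} {p : ℝ × ℝ} {a b : V3} (h : FrameAdapted g p a b)
    {c : ℝ} (hc : 0 < c) : FrameAdapted g p (c • a) (c • b) := by
  obtain ⟨⟨lam, mu, hlam, h1⟩, kappa, hkappa, h2⟩ := h
  refine ⟨⟨lam / c, mu / c, by positivity, ?_⟩, kappa / c, by positivity, ?_⟩
  · rw [smul_smul, smul_smul, div_mul_cancel₀ _ hc.ne', div_mul_cancel₀ _ hc.ne', h1]
  · rw [smul_smul, div_mul_cancel₀ _ hc.ne', h2]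

theorem dotProduct_self_pos {v : V3} (hv : v ≠ 0) : 0 < v ⬝ᵥ v :=
  lt_of_le_of_ne (by simp only [dotProduct]; exact Finset.sum_nonneg fun i _ => mul_self_nonneg _)
    fun h => hv (dotProduct_self_eq_zero.1 h.symm)

/-- Normalisation of a vector of `ℝ³`. -/
def unitize (v : V3) : V3 := (√(v ⬝ᵥ v))⁻¹ • v

theorem unitize_dot_self {v : V3} (hv : v ≠ 0) : unitize v ⬝ᵥ unitize v = 1 := by
  have h := dotProduct_self_pos hv
  simp only [unitize, smul_dotProduct, dotProduct_smul, smul_eq_mul]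
  rw [← mul_assoc, ← mul_inv, Real.mul_self_sqrt h.le, inv_mul_cancel₀ h.ne']

theorem ContDiff.unitize {E : Type*} [NormedAddCommGroup E] [NormedSpace ℝ E] {n : ℕ∞ω}
    {f : E → V3} (hf : ContDiff ℝ n f) (h0 : ∀ x, f x ≠ 0) :
    ContDiff ℝ n (fun x => unitize (f x)) :=
  ((hf.dotProduct' hf).sqrt (fun x => (dotProduct_self_pos (h0 x)).ne')).inv
    (fun x => (Real.sqrt_pos.2 (dotProduct_self_pos (h0 x))).ne') |>.smul hf

/-- The rotation matrix whose last two rows are the unit vectors along `b × a` and `b`. -/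
def frameMatrix (a b : V3) : Matrix (Fin 3) (Fin 3) ℝ :=
  Matrix.of ![unitize (b ⨯₃ a) ⨯₃ unitize b, unitize (b ⨯₃ a), unitize b]

theorem ne_zero_of_cross {a b : V3} (h : a ⨯₃ b ≠ 0) : b ≠ 0 ∧ b ⨯₃ a ≠ 0 := by
  refine ⟨fun hb => h (by simp [hb]), fun hb => h ?_⟩
  rw [← cross_anticomm, hb, neg_zero]

theorem frameMatrix_mem {a b : V3} (h : a ⨯₃ b ≠ 0) :
    frameMatrix a b ∈ Matrix.specialOrthogonalGroup (Fin 3) ℝ := by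
  obtain ⟨hb, hba⟩ := ne_zero_of_cross h
  have e1 := unitize_dot_self hb
  have e2 := unitize_dot_self hba
  have e3 : unitize (b ⨯₃ a) ⬝ᵥ unitize b = 0 := by
    simp only [unitize, smul_dotProduct, dotProduct_smul]
    rw [dotProduct_comm (b ⨯₃ a) b, dot_self_cross]
    simp
  unfold frameMatrix
  generalize unitize (b ⨯₃ a) = n at *
  generalize unitize b = u at *
  have e4 : (n ⨯₃ u) ⬝ᵥ (n ⨯₃ u) = 1 := by
    rw [cross_dot_cross, e1, e2, e3, dotProduct_comm u n, e3]; norm_num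
  have e5 : (n ⨯₃ u) ⬝ᵥ n = 0 := by rw [dotProduct_comm, dot_self_cross]
  have e6 : (n ⨯₃ u) ⬝ᵥ u = 0 := by rw [dotProduct_comm, dot_cross_self]
  refine Matrix.mem_specialOrthogonalGroup_iff.2 ⟨(Matrix.mem_orthogonalGroup_iff _ _).2 ?_, ?_⟩
  · ext i j
    change ((![n ⨯₃ u, n, u] : Fin 3 → V3) i) ⬝ᵥ ((![n ⨯₃ u, n, u] : Fin 3 → V3) j) = _
    fin_cases i <;> fin_cases j <;>
      simp [e1, e2, e3, e4, e5, e6, dotProduct_comm u n, dotProduct_comm n (n ⨯₃ u),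
        dotProduct_comm u (n ⨯₃ u)]
  · rw [← e4, triple_product_eq_det]
    rfl

theorem contDiff_frameMatrix {E : Type*} [NormedAddCommGroup E] [NormedSpace ℝ E] {m : ℕ∞ω}
    {a b : E → V3} (ha : ContDiff ℝ m a) (hb : ContDiff ℝ m b) (h : ∀ x, a x ⨯₃ b x ≠ 0)
    (i j : Fin 3) : ContDiff ℝ m fun x => frameMatrix (a x) (b x) i j := by
  have h1 := (hb.cross ha).unitize fun x => (ne_zero_of_cross (h x)).2
  have h2 := hb.unitize fun x => (ne_zero_of_cross (h x)).1
  have h3 := h1.cross h2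
  fin_cases i
  · exact contDiff_pi.1 h3 j
  · exact contDiff_pi.1 h1 j
  · exact contDiff_pi.1 h2 j

theorem frameAdapted_frameMatrix {g : ℝ × ℝ → V3} {p : ℝ × ℝ}
    (h : fderiv ℝ g p (1, 0) ⨯₃ fderiv ℝ g p (0, 1) ≠ 0) :
    FrameAdapted g p (frameMatrix (fderiv ℝ g p (1, 0)) (fderiv ℝ g p (0, 1)) 0)
      (frameMatrix (fderiv ℝ g p (1, 0)) (fderiv ℝ g p (0, 1)) 2) := by
  unfold FrameAdapted
  generalize fderiv ℝ g p (1, 0) = a at *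
  generalize fderiv ℝ g p (0, 1) = b at *
  obtain ⟨hb, hba⟩ := ne_zero_of_cross h
  have p1 := dotProduct_self_pos hb
  have p2 := dotProduct_self_pos hba
  have q1 := Real.sqrt_pos.2 p1
  have q2 := Real.sqrt_pos.2 p2
  change (∃ lam mu : ℝ, 0 < lam ∧ a = lam • (unitize (b ⨯₃ a) ⨯₃ unitize b) + mu • unitize b) ∧
    ∃ kappa : ℝ, 0 < kappa ∧ b = kappa • unitize b
  refine ⟨⟨√((b ⨯₃ a) ⬝ᵥ (b ⨯₃ a)) * √(b ⬝ᵥ b) / (b ⬝ᵥ b), (a ⬝ᵥ b) / (b ⬝ᵥ b) * √(b ⬝ᵥ b),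
    by positivity, ?_⟩, √(b ⬝ᵥ b), q1, ?_⟩
  · have key : (b ⨯₃ a) ⨯₃ b = (b ⬝ᵥ b) • a - (a ⬝ᵥ b) • b := by
      ext i
      fin_cases i <;> simp [cross_apply, dotProduct, Fin.sum_univ_three] <;> ring
    simp only [unitize, map_smul, LinearMap.smul_apply, key, smul_smul]
    set s := √((b ⨯₃ a) ⬝ᵥ (b ⨯₃ a))
    set t := √(b ⬝ᵥ b)
    ext i
    simp only [Pi.add_apply, Pi.smul_apply, Pi.sub_apply, smul_eq_mul]
    field_simp
    ring
  · rw [unitize, smul_smul, mul_inv_cancel₀ q1.ne', one_smul]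

theorem contDiff_quatRot {E : Type*} [NormedAddCommGroup E] [NormedSpace ℝ E] {m : ℕ∞ω}
    {h : E → ℍ} (hh : ContDiff ℝ m h) (i j : Fin 3) : ContDiff ℝ m fun x => quatRot (h x) i j := by
  have hl (L : ℍ →ₗ[ℝ] ℝ) : ContDiff ℝ m fun x => L (h x) :=
    (LinearMap.toContinuousLinearMap L).contDiff.comp hh
  have h0 : ContDiff ℝ m fun x => (h x).re := hl (QuaternionAlgebra.reₗ (-1) 0 (-1))
  have h1 : ContDiff ℝ m fun x => (h x).imI := hl (QuaternionAlgebra.imIₗ (-1) 0 (-1))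
  have h2 : ContDiff ℝ m fun x => (h x).imJ := hl (QuaternionAlgebra.imJₗ (-1) 0 (-1))
  have h3 : ContDiff ℝ m fun x => (h x).imK := hl (QuaternionAlgebra.imKₗ (-1) 0 (-1))
  fin_cases i <;> fin_cases j <;> simp [quatRot] <;> fun_prop

theorem quatRot_coe (c : ℝ) : quatRot (c : ℍ) = c ^ 2 • (1 : Matrix (Fin 3) (Fin 3) ℝ) := by
  rw [← quatRot_one, ← quatRot_smul, ← Quaternion.coe_one, Quaternion.smul_coe, mul_one]

/-- Two plane immersions which agree outside a ball are regularly homotopic relative to the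
complement of a larger ball. -/
theorem exists_plane_homotopy {g₀ g₁ : ℝ × ℝ → V3} (hg₀ : ContDiff ℝ ∞ g₀)
    (hg₁ : ContDiff ℝ ∞ g₁) (hi₀ : PlaneImmersion g₀) (hi₁ : PlaneImmersion g₁) {r : ℝ}
    (hr : 0 < r) (hEq : ∀ p, r < ‖p‖ → g₀ p = g₁ p) :
    ∃ G : TP → V3, ContDiff ℝ ∞ G ∧ (∀ p, G (0, p) = g₀ p) ∧ (∀ p, G (1, p) = g₁ p) ∧
      (∃ r', r < r' ∧ ∀ t p, r' ≤ ‖p‖ → G (t, p) = g₀ p) ∧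
      ∀ t ∈ Icc (0 : ℝ) 1, PlaneImmersion fun p => G (t, p) := by
  have hd₀ : ∀ v, ContDiff ℝ ∞ fun p => fderiv ℝ g₀ p v := fun v =>
    (hg₀.fderiv_right (by simp)).clm_apply contDiff_const
  have hd₁ : ∀ v, ContDiff ℝ ∞ fun p => fderiv ℝ g₁ p v := fun v =>
    (hg₁.fderiv_right (by simp)).clm_apply contDiff_const
  let W₀ : ℝ × ℝ → Matrix (Fin 3) (Fin 3) ℝ := fun p =>
    frameMatrix (fderiv ℝ g₀ p (1, 0)) (fderiv ℝ g₀ p (0, 1))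
  let W₁ : ℝ × ℝ → Matrix (Fin 3) (Fin 3) ℝ := fun p =>
    frameMatrix (fderiv ℝ g₁ p (1, 0)) (fderiv ℝ g₁ p (0, 1))
  have hW₀ : ∀ i j, ContDiff ℝ ∞ fun p => W₀ p i j :=
    contDiff_frameMatrix (hd₀ _) (hd₀ _) hi₀
  have hW₁ : ∀ i j, ContDiff ℝ ∞ fun p => W₁ p i j :=
    contDiff_frameMatrix (hd₁ _) (hd₁ _) hi₁
  have hS₀ : ∀ p, W₀ p ∈ Matrix.specialOrthogonalGroup (Fin 3) ℝ := fun p => frameMatrix_mem (hi₀ p)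
  have hS₁ : ∀ p, W₁ p ∈ Matrix.specialOrthogonalGroup (Fin 3) ℝ := fun p => frameMatrix_mem (hi₁ p)
  have htr : ∀ {B : Matrix (Fin 3) (Fin 3) ℝ}, B ∈ Matrix.specialOrthogonalGroup (Fin 3) ℝ →
      Bᵀ ∈ Matrix.specialOrthogonalGroup (Fin 3) ℝ := fun {B} hB => by
    simpa using mul_transpose_mem_specialOrthogonalGroup (one_mem _) hB
  have hWeq : ∀ p, r < ‖p‖ → W₁ p = W₀ p := fun p hp => by
    have : g₁ =ᶠ[𝓝 p] g₀ := (eventually_lt_norm hp).mono fun q hq => (hEq q hq).symm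
    simp only [W₀, W₁, this.fderiv_eq]
  obtain ⟨q, hq, hqn, hqA, hq1⟩ := exists_quaternion_lift (A := fun p => (W₁ p)ᵀ * W₀ p)
    (fun i j => by
      simp only [Matrix.mul_apply, Fin.sum_univ_three, Matrix.transpose_apply]
      fun_prop)
    (fun p => mul_mem (htr (hS₁ p)) (hS₀ p)) hr
    (fun p hp => by rw [hWeq p hp]; exact (specialOrthogonal_eqs (hS₀ p)).2.1)
  obtain ⟨v₀, hv₀⟩ : ∃ v₀ : ℍ, ∀ (s : ℝ) p, s • q p ≠ v₀ := by
    have hc : ContDiff ℝ ∞ fun z : TP => z.1 • q z.2 := by fun_prop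
    have hdim : Module.finrank ℝ TP < Module.finrank ℝ ℍ := by
      rw [Quaternion.finrank_eq_four]
      simp
    obtain ⟨v₀, hv₀⟩ :=
      ((hc.of_le (by simp)).dense_compl_range_of_finrank_lt_finrank hdim).nonempty
    exact ⟨v₀, fun s p h => hv₀ ⟨(s, p), h⟩⟩
  have hne : ∀ (s : ℝ) p, (1 - s) • q p - s • v₀ ≠ 0 := by
    intro s p h
    rcases eq_or_ne s 0 with rfl | hs
    · have h0 : q p = 0 := by simpa using h
      have := hqn p
      rw [h0] at this
      simp at this
    · refine hv₀ ((1 - s) / s) p ?_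
      rw [div_eq_inv_mul, mul_smul, sub_eq_zero.1 h, smul_smul, inv_mul_cancel₀ hs, one_smul]
  have hfar : ‖((r + 1, 0) : ℝ × ℝ)‖ > r := by
    rw [Prod.norm_def, Real.norm_of_nonneg (by linarith)]
    exact lt_of_lt_of_le (by linarith) (le_max_left _ _)
  have hne1 : ∀ s : ℝ, (1 - s) • (1 : ℍ) - s • v₀ ≠ 0 := fun s => by
    have := hne s (r + 1, 0)
    rwa [hq1 _ hfar] at this
  let σ : ℝ → ℝ := fun t => 1 - Real.smoothTransition t
  have hσ : ContDiff ℝ ∞ σ := contDiff_const.sub Real.smoothTransition.contDiff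
  let h : TP → ℍ := fun z =>
    star ((1 - σ z.1) • (1 : ℍ) - σ z.1 • v₀) * ((1 - σ z.1) • q z.2 - σ z.1 • v₀)
  have hh : ContDiff ℝ ∞ h := by
    have h1 : ContDiff ℝ ∞ fun z : TP => (1 - σ z.1) • (1 : ℍ) - σ z.1 • v₀ := by fun_prop
    let S : ℍ →ₗ[ℝ] ℍ := ⟨⟨star, star_add⟩, fun c x => Quaternion.star_smul c x⟩
    have h2 : ContDiff ℝ ∞ fun z : TP => star ((1 - σ z.1) • (1 : ℍ) - σ z.1 • v₀) :=
      (LinearMap.toContinuousLinearMap S).contDiff.comp h1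
    exact h2.mul (by fun_prop)
  have hpos : ∀ {x : ℍ}, x ≠ 0 → 0 < Quaternion.normSq x ^ 2 := fun {x} hx => by
    have : Quaternion.normSq x ≠ 0 := Quaternion.normSq_ne_zero.2 hx
    positivity
  let T : TP → Matrix (Fin 3) (Fin 3) ℝ := fun z => W₀ z.2 * (quatRot (h z))ᵀ
  have hT : ∀ i j, ContDiff ℝ ∞ fun z => T z i j := fun i j => by
    have := contDiff_quatRot hh
    have h0 : ∀ i j, ContDiff ℝ ∞ fun z : TP => W₀ z.2 i j := fun i j =>
      (hW₀ i j).comp contDiff_snd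
    simp only [T, Matrix.mul_apply, Fin.sum_univ_three, Matrix.transpose_apply]
    fun_prop
  have hTc : ∀ {c : ℝ} {z : TP}, h z = (c : ℍ) → T z = c ^ 2 • W₀ z.2 := fun {c z} hc => by
    simp only [T, hc, quatRot_coe, Matrix.transpose_smul, Matrix.transpose_one, Matrix.mul_smul,
      Matrix.mul_one]
  have hTq : ∀ {z : TP}, h z = q z.2 → T z = W₁ z.2 := fun {z} hz => by
    simp only [T, hz, hqA, Matrix.transpose_mul, Matrix.transpose_transpose]
    rw [← Matrix.mul_assoc, (specialOrthogonal_eqs (hS₀ z.2)).1, Matrix.one_mul]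
  have hrow : ∀ i, ContDiff ℝ ∞ fun z => T z i := fun i => contDiff_pi.2 fun j => hT i j
  refine exists_plane_homotopy_of_frames hg₀ hg₁ hi₀ hr hEq (hrow 0) (hrow 1) (hrow 2)
    (fun z => ?_) (fun t p ht => ?_) (fun t p ht => ?_)
  · rw [triple_product_eq_det]
    have e : (![T z 0, T z 1, T z 2] : Matrix (Fin 3) (Fin 3) ℝ) = T z := by
      ext i j
      fin_cases i <;> rfl
    rw [e, Matrix.det_mul, Matrix.det_transpose, det_quatRot,
      (Matrix.mem_specialOrthogonalGroup_iff.1 (hS₀ z.2)).2, one_mul]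
    refine pow_ne_zero _ (Quaternion.normSq_ne_zero.2 (mul_ne_zero ?_ (hne _ _)))
    exact star_ne_zero.2 (hne1 _)
  · obtain ⟨x, hx, e⟩ : ∃ x : ℍ, x ≠ 0 ∧ h (t, p) = ((Quaternion.normSq x : ℝ) : ℍ) := by
      refine ⟨_, hne1 (σ t), ?_⟩
      rw [← Quaternion.star_mul_self]
      simp only [h]
      congr 1
      rcases ht with ht | ht
      · simp [σ, Real.smoothTransition.zero_of_nonpos ht]
      · rw [hq1 p ht]
    rw [hTc e]
    exact (frameAdapted_frameMatrix (hi₀ p)).smul (hpos hx)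
  · have e : h (t, p) = q p := by
      simp [h, σ, Real.smoothTransition.one_of_one_le ht]
    rw [hTq e]
    exact frameAdapted_frameMatrix (hi₁ p)

/-- The differential of `F : ℝ³ → ℝ³` is injective on the tangent planes of the unit sphere. -/
def SphereImm (F : E3 → E3) : Prop :=
  ∀ x ∈ sphere (0 : E3) 1, ∀ v : E3, inner ℝ x v = 0 → fderiv ℝ F x v = 0 → v = 0

/-- The differential of the inclusion of the sphere. -/
def inclDeriv (x : S2) : TangentSpace (𝓡 2) x →L[ℝ] E3 :=
  mfderiv (𝓡 2) 𝓘(ℝ, E3) ((↑) : S2 → E3) x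

theorem inclDeriv_injective (x : S2) : Injective (inclDeriv x) :=
  injective_mvfderiv_subtypeVal_sphere x

theorem exists_inclDeriv {x : S2} {v : E3} (hv : inner ℝ (x : E3) v = 0) :
    ∃ w, inclDeriv x w = v := by
  have h := range_mvfderiv_subtypeVal (E := E3) (n := 2) x
  have hv' : v ∈ (ℝ ∙ (x : E3))ᗮ := Submodule.mem_orthogonal_singleton_iff_inner_right.2 hv
  rw [← h] at hv'
  exact hv'

theorem inner_inclDeriv (x : S2) (w : TangentSpace (𝓡 2) x) :
    inner ℝ (x : E3) (inclDeriv x w) = 0 := by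
  have h := range_mvfderiv_subtypeVal (E := E3) (n := 2) x
  refine Submodule.mem_orthogonal_singleton_iff_inner_right.1 (h ▸ ?_)
  exact ⟨w, rfl⟩

theorem mfderiv_comp_coe {F : E3 → E3} (hF : Differentiable ℝ F) (x : S2) :
    mfderiv (𝓡 2) 𝓘(ℝ, E3) (fun y : S2 => F y) x = (fderiv ℝ F x).comp (inclDeriv x) := by
  have h1 : MDifferentiableAt 𝓘(ℝ, E3) 𝓘(ℝ, E3) F (x : E3) := (hF x).mdifferentiableAt
  have h2 : MDifferentiableAt (𝓡 2) 𝓘(ℝ, E3) ((↑) : S2 → E3) x :=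
    (contMDiff_coe_sphere (m := 1) x).mdifferentiableAt one_ne_zero
  have := mfderiv_comp x h1 h2
  rw [mfderiv_eq_fderiv] at this
  exact this

theorem sphereImm_iff {F : E3 → E3} (hF : Differentiable ℝ F) :
    SphereImm F ↔ ∀ x : S2, Injective (mfderiv (𝓡 2) 𝓘(ℝ, E3) (fun y : S2 => F y) x) := by
  constructor
  · intro h x
    rw [mfderiv_comp_coe hF x]
    refine (injective_iff_map_eq_zero ((fderiv ℝ F x).comp (inclDeriv x))).2 fun w hw => ?_
    exact (injective_iff_map_eq_zero (inclDeriv x)).1 (inclDeriv_injective x) w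
      (h x x.2 _ (inner_inclDeriv x w) hw)
  · intro h x hx v hv h0
    obtain ⟨w, rfl⟩ := exists_inclDeriv (x := ⟨x, hx⟩) hv
    have := h ⟨x, hx⟩
    rw [mfderiv_comp_coe hF ⟨x, hx⟩] at this
    have hw := (injective_iff_map_eq_zero ((fderiv ℝ F x).comp (inclDeriv ⟨x, hx⟩))).1 this w h0
    rw [hw, map_zero]

theorem isImmersionS2_of_sphereImm {F : E3 → E3} (hF : ContDiff ℝ 1 F) (hI : SphereImm F) :
    IsImmersionS2 fun x : S2 => F x :=
  ⟨hF.contMDiff.comp contMDiff_coe_sphere, (sphereImm_iff (hF.differentiable one_ne_zero)).1 hI⟩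

theorem fderiv_uncurry_slice {F : ℝ → E3 → E3} (hF : ContDiff ℝ 1 fun z : ℝ × E3 => F z.1 z.2)
    (t : ℝ) (x v : E3) :
    fderiv ℝ (F t) x v = fderiv ℝ (fun z : ℝ × E3 => F z.1 z.2) (t, x) (0, v) := by
  have h : HasFDerivAt (fun q : E3 => (t, q)) (ContinuousLinearMap.inr ℝ ℝ E3) x :=
    hasFDerivAt_prodMk_right t x
  have := ((hF.differentiable (by simp) (t, x)).hasFDerivAt.comp x h).fderiv
  rw [show F t = (fun z : ℝ × E3 => F z.1 z.2) ∘ fun q => (t, q) from rfl, this]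
  simp

/-- A homotopy of maps of the ambient space through immersions of the sphere is a regular
homotopy. -/
theorem RegularlyHomotopic.of_ambient {F : ℝ → E3 → E3}
    (hF : ContDiff ℝ 1 fun z : ℝ × E3 => F z.1 z.2) (hI : ∀ t ∈ Icc (0 : ℝ) 1, SphereImm (F t)) :
    RegularlyHomotopic (fun x => F 0 x) (fun x => F 1 x) := by
  have hFt : ∀ t, ContDiff ℝ 1 (F t) := fun t =>
    hF.comp (contDiff_const.prodMk contDiff_id : ContDiff ℝ 1 fun x : E3 => (t, x))
  refine ⟨fun t x => F t x, fun t ht => isImmersionS2_of_sphereImm (hFt t) (hI t ht), rfl, rfl, ?_⟩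
  let ι : TangentBundle (𝓡 2) S2 → TangentBundle 𝓘(ℝ, E3) E3 :=
    tangentMap (𝓡 2) 𝓘(ℝ, E3) ((↑) : S2 → E3)
  have hι : Continuous ι := (contMDiff_coe_sphere (m := 1)).continuous_tangentMap le_rfl
  have hι' : Continuous fun q : TangentBundle (𝓡 2) S2 =>
      tangentBundleModelSpaceHomeomorph 𝓘(ℝ, E3) (ι q) :=
    (Homeomorph.continuous _).comp hι
  have h1 : Continuous fun q : TangentBundle (𝓡 2) S2 => (q.1 : E3) := continuous_fst.comp hι'
  have h2 : Continuous fun q : TangentBundle (𝓡 2) S2 => inclDeriv q.1 q.2 :=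
    continuous_snd.comp hι'
  have hd : Continuous fun z : ℝ × E3 => fderiv ℝ (fun z : ℝ × E3 => F z.1 z.2) z :=
    hF.continuous_fderiv one_ne_zero
  have h3 : Continuous fun q : ℝ × TangentBundle (𝓡 2) S2 =>
      ((F q.1 (q.2.1 : E3), fderiv ℝ (F q.1) (q.2.1 : E3) (inclDeriv q.2.1 q.2.2)) :
        ModelProd E3 E3) := by
    refine Continuous.prodMk ?_ ?_
    · exact hF.continuous.comp (continuous_fst.prodMk (h1.comp continuous_snd))
    · simp only [fderiv_uncurry_slice hF]
      exact (hd.comp (continuous_fst.prodMk (h1.comp continuous_snd))).clm_apply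
        (continuous_const.prodMk (h2.comp continuous_snd))
  convert (tangentBundleModelSpaceHomeomorph 𝓘(ℝ, E3)).symm.continuous.comp h3 using 2 with q
  rw [tangentBundleModelSpaceHomeomorph_coe_symm]
  simp only [tangentMap, mfderiv_comp_coe ((hFt q.1).differentiable one_ne_zero)]
  rfl

theorem RegularlyHomotopic.symm {f g : S2 → E3} (h : RegularlyHomotopic f g) :
    RegularlyHomotopic g f := by
  obtain ⟨F, hF, h0, h1, hc⟩ := h
  refine ⟨fun t => F (1 - t), fun t ht => hF _ ⟨by linarith [ht.2], by linarith [ht.1]⟩,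
    by simpa using h1, by simpa using h0, ?_⟩
  exact hc.comp (f := fun q : ℝ × TangentBundle (𝓡 2) S2 => (1 - q.1, q.2)) (by fun_prop)

theorem RegularlyHomotopic.trans {f g k : S2 → E3} (h : RegularlyHomotopic f g)
    (h' : RegularlyHomotopic g k) : RegularlyHomotopic f k := by
  obtain ⟨F, hF, h0, h1, hc⟩ := h
  obtain ⟨F', hF', h0', h1', hc'⟩ := h'
  refine ⟨fun t => if t ≤ 1 / 2 then F (2 * t) else F' (2 * t - 1), fun t ht => ?_,
    by simpa using h0, ?_, ?_⟩
  · dsimp only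
    split_ifs with h
    · exact hF _ ⟨by linarith [ht.1], by linarith⟩
    · exact hF' _ ⟨by linarith, by linarith [ht.2]⟩
  · simp only []
    rw [if_neg (by norm_num), ← h1']
    norm_num
  · have c1 : Continuous fun q : ℝ × TangentBundle (𝓡 2) S2 =>
        tangentMap (𝓡 2) 𝓘(ℝ, E3) (F (2 * q.1)) q.2 :=
      hc.comp (f := fun q : ℝ × TangentBundle (𝓡 2) S2 => (2 * q.1, q.2)) (by fun_prop)
    have c2 : Continuous fun q : ℝ × TangentBundle (𝓡 2) S2 =>
        tangentMap (𝓡 2) 𝓘(ℝ, E3) (F' (2 * q.1 - 1)) q.2 :=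
      hc'.comp (f := fun q : ℝ × TangentBundle (𝓡 2) S2 => (2 * q.1 - 1, q.2)) (by fun_prop)
    convert c1.if_le c2 continuous_fst (continuous_const (y := (1 / 2 : ℝ))) ?_ using 2 with q
    · dsimp only
      split_ifs <;> rfl
    · intro q hq
      rw [hq]
      norm_num
      rw [h0', h1]

/-- Immersions of the sphere are restrictions of compactly supported `C¹` maps of the ambient
space. -/
theorem exists_ambient_extension {f : S2 → E3} (hf : ContMDiff (𝓡 2) 𝓘(ℝ, E3) 1 f)
    (hinj : ∀ x : S2, Injective (mfderiv (𝓡 2) 𝓘(ℝ, E3) f x)) :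
    ∃ F : E3 → E3, ContDiff ℝ 1 F ∧ HasCompactSupport F ∧ SphereImm F ∧
      (fun x : S2 => F x) = f := by
  let U : TopologicalSpace.Opens E3 := ⟨{0}ᶜ, isOpen_compl_singleton⟩
  have hU : ∀ x : U, ‖(x : E3)‖ ≠ 0 := fun x => norm_ne_zero_iff.2 x.2
  have hsph : ∀ x : U, ‖(x : E3)‖⁻¹ • (x : E3) ∈ sphere (0 : E3) 1 := fun x => by
    rw [mem_sphere_zero_iff_norm, norm_smul, norm_inv, norm_norm, inv_mul_cancel₀ (hU x)]
  have hn : ContMDiff 𝓘(ℝ, E3) 𝓘(ℝ, E3) 1 fun x : U => ‖(x : E3)‖⁻¹ • (x : E3) := fun x => by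
    refine (contMDiffAt_subtype_iff (f := fun x : E3 => ‖x‖⁻¹ • x)).2 ?_
    exact (((contDiffAt_norm ℝ x.2).inv (hU x)).smul contDiffAt_id).contMDiffAt
  have hfn := hf.comp (hn.codRestrict_sphere hsph)
  classical
  let x₀ : S2 := ⟨EuclideanSpace.single 0 1, by simp⟩
  let g : E3 → E3 := fun x => f (if h : ‖x‖⁻¹ • x ∈ sphere (0 : E3) 1 then ⟨_, h⟩ else x₀)
  have hg : ∀ x : E3, x ≠ 0 → ContDiffAt ℝ 1 g x := fun x hx => by
    have h1 := hfn ⟨x, hx⟩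
    have e : (f ∘ codRestrict (fun x : U => ‖(x : E3)‖⁻¹ • (x : E3)) (sphere (0 : E3) 1) hsph) =
        fun x : U => g x := by
      funext y
      simp only [g, dif_pos (hsph y)]
      rfl
    rw [e] at h1
    exact (contMDiffAt_subtype_iff.1 h1).contDiffAt
  let χ : E3 → ℝ := fun x =>
    Real.smoothTransition (4 * ‖x‖ ^ 2 - 1) * Real.smoothTransition (4 - ‖x‖ ^ 2)
  have hχ : ContDiff ℝ 1 χ := by
    have h := contDiff_norm_sq ℝ (E := E3) (n := 1)
    exact (Real.smoothTransition.contDiff.comp (by fun_prop)).mul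
      (Real.smoothTransition.contDiff.comp (by fun_prop))
  let F : E3 → E3 := fun x => χ x • g x
  have hF : ContDiff ℝ 1 F := contDiff_iff_contDiffAt.2 fun x => by
    rcases eq_or_ne x 0 with rfl | hx
    · refine (contDiffAt_const (c := (0 : E3))).congr_of_eventuallyEq ?_
      filter_upwards [ball_mem_nhds (0 : E3) (show (0 : ℝ) < 1 / 2 by norm_num)] with y hy
      rw [mem_ball_zero_iff] at hy
      simp only [F, χ]
      rw [Real.smoothTransition.zero_of_nonpos (by nlinarith [norm_nonneg y]), zero_mul, zero_smul]
    · exact hχ.contDiffAt.smul (hg x hx)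
  have hFf : (fun x : S2 => F x) = f := by
    funext x
    have hx : ‖(x : E3)‖ = 1 := mem_sphere_zero_iff_norm.1 x.2
    have h1 : ‖(x : E3)‖⁻¹ • (x : E3) = x := by rw [hx, inv_one, one_smul]
    have h2 : g x = f x := by
      simp only [g]
      congr 1
      rw [dif_pos (by rw [h1]; exact x.2)]
      exact Subtype.ext h1
    simp only [F, χ, hx, h2]
    rw [Real.smoothTransition.one_of_one_le (by norm_num),
      Real.smoothTransition.one_of_one_le (by norm_num), one_mul, one_smul]
  refine ⟨F, hF, ?_, ?_, hFf⟩
  · refine HasCompactSupport.intro (isCompact_closedBall (0 : E3) 2) fun x hx => ?_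
    rw [mem_closedBall_zero_iff, not_le] at hx
    simp only [F, χ]
    rw [Real.smoothTransition.zero_of_nonpos (x := 4 - ‖x‖ ^ 2) (by nlinarith), mul_zero,
      zero_smul]
  · rw [sphereImm_iff (hF.differentiable one_ne_zero), hFf]
    exact hinj

/-- Maps which are `C¹`-close on the sphere to an immersion are immersions regularly homotopic
to it. -/
theorem SphereImm.exists_near {F : E3 → E3} (hF : ContDiff ℝ 1 F) (hI : SphereImm F) :
    ∃ η > 0, ∀ H : E3 → E3, ContDiff ℝ 1 H →
      (∀ x ∈ sphere (0 : E3) 1, ‖fderiv ℝ H x - fderiv ℝ F x‖ < η) →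
      SphereImm H ∧ RegularlyHomotopic (fun x => F x) (fun x => H x) := by
  have hK : IsCompact ((sphere (0 : E3) 1 ×ˢ sphere (0 : E3) 1) ∩
      {z : E3 × E3 | inner ℝ z.1 z.2 = 0}) :=
    ((isCompact_sphere _ _).prod (isCompact_sphere _ _)).inter_right
      (isClosed_eq (by fun_prop) continuous_const)
  have hd := hF.continuous_fderiv one_ne_zero
  have hc : Continuous fun z : E3 × E3 => ‖fderiv ℝ F z.1 z.2‖ :=
    ((hd.comp continuous_fst).clm_apply continuous_snd).norm
  obtain ⟨η, hη, h⟩ := hK.exists_forall_le' hc.continuousOn (a := 0) (by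
    rintro ⟨x, v⟩ ⟨⟨hx, hv⟩, hxv⟩
    refine norm_pos_iff.2 fun h0 => ?_
    have := hI x hx v hxv h0
    subst this
    simp at hv)
  have key : ∀ x ∈ sphere (0 : E3) 1, ∀ A : E3 →L[ℝ] E3, ‖A - fderiv ℝ F x‖ < η →
      ∀ v : E3, inner ℝ x v = 0 → A v = 0 → v = 0 := by
    intro x hx A hA v hv hAv
    by_contra hv0
    have hvn : 0 < ‖v‖ := norm_pos_iff.2 hv0
    have h1 := h (x, ‖v‖⁻¹ • v) ⟨⟨hx, by simp [norm_smul, hvn.ne']⟩, by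
      change inner ℝ x (‖v‖⁻¹ • v) = 0
      rw [inner_smul_right, hv, mul_zero]⟩
    have h2 := (A - fderiv ℝ F x).le_opNorm (‖v‖⁻¹ • v)
    have h3 : (A - fderiv ℝ F x) (‖v‖⁻¹ • v) = - fderiv ℝ F x (‖v‖⁻¹ • v) := by
      simp [hAv]
    rw [h3, norm_neg, norm_smul, norm_inv, norm_norm, inv_mul_cancel₀ hvn.ne', mul_one] at h2
    exact absurd (h1.trans h2) (not_le.2 hA)
  refine ⟨η, hη, fun H hH hHF => ⟨fun x hx => key x hx _ (hHF x hx), ?_⟩⟩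
  have hFd := hF.differentiable one_ne_zero
  have hHd := hH.differentiable one_ne_zero
  have := RegularlyHomotopic.of_ambient (F := fun t x => F x + t • (H x - F x)) (by fun_prop)
    (fun t ht x hx => key x hx _ (by
      have e : fderiv ℝ (fun x => F x + t • (H x - F x)) x =
          fderiv ℝ F x + t • (fderiv ℝ H x - fderiv ℝ F x) := by
        exact ((hFd x).hasFDerivAt.add
          (((hHd x).hasFDerivAt.sub (hFd x).hasFDerivAt).const_smul t)).fderiv
      rw [e, add_sub_cancel_left, norm_smul, Real.norm_of_nonneg ht.1]
      exact lt_of_le_of_lt (mul_le_of_le_one_left (norm_nonneg _) ht.2) (hHF x hx)))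
  simpa using this

/-- Compactly supported `C¹` maps can be smoothed with control on the derivative. -/
theorem exists_smooth_approx {F : E3 → E3} (hF : ContDiff ℝ 1 F) (hc : HasCompactSupport F)
    {η : ℝ} (hη : 0 < η) :
    ∃ H : E3 → E3, ContDiff ℝ ∞ H ∧ ∀ x, ‖fderiv ℝ H x - fderiv ℝ F x‖ < η := by
  have hd := hF.continuous_fderiv one_ne_zero
  obtain ⟨δ, hδ, h⟩ := Metric.uniformContinuous_iff.1
    ((hc.fderiv (𝕜 := ℝ)).uniformContinuous_of_continuous hd) (η / 2) (by positivity)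
  let φ : ContDiffBump (0 : E3) := ⟨δ / 2, δ, by positivity, by linarith⟩
  let μ : MeasureTheory.Measure E3 := MeasureTheory.volume
  have hφ : ContDiff ℝ ∞ (φ.normed μ) := φ.contDiff_normed
  refine ⟨MeasureTheory.convolution (φ.normed μ) F (ContinuousLinearMap.lsmul ℝ ℝ) μ,
    φ.hasCompactSupport_normed.contDiff_convolution_left _ hφ hF.continuous.locallyIntegrable,
    fun x => ?_⟩
  rw [(hc.hasFDerivAt_convolution_right (ContinuousLinearMap.lsmul ℝ ℝ)
    (hφ.continuous.locallyIntegrable (μ := μ)) hF x).fderiv]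
  have e : ContinuousLinearMap.precompR E3 (ContinuousLinearMap.lsmul ℝ ℝ : ℝ →L[ℝ] E3 →L[ℝ] E3) =
      (ContinuousLinearMap.lsmul ℝ ℝ : ℝ →L[ℝ] (E3 →L[ℝ] E3) →L[ℝ] (E3 →L[ℝ] E3)) := by
    ext a T v
    simp
  rw [e, ← dist_eq_norm]
  refine lt_of_le_of_lt (φ.dist_normed_convolution_le (μ := μ) (ε := η / 2)
    hd.aestronglyMeasurable fun y hy => (h hy).le) (by linarith)

/-- A map vanishing to first order at a point can be truncated near this point to a
`C¹`-small map. -/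
theorem exists_germ_small {R : E3 → E3} (hR : ContDiff ℝ ∞ R) {N : E3} (h0 : R N = 0)
    (h1 : fderiv ℝ R N = 0) {η : ℝ} (hη : 0 < η) :
    ∃ S : E3 → E3, ContDiff ℝ ∞ S ∧ (∀ x, ‖fderiv ℝ S x‖ < η) ∧ S =ᶠ[𝓝 N] R := by
  let χ : ContDiffBump (0 : E3) := ⟨1, 2, by norm_num, by norm_num⟩
  have hχ : ContDiff ℝ ∞ χ := χ.contDiff
  obtain ⟨C, hC⟩ := (χ.hasCompactSupport.fderiv (𝕜 := ℝ)).exists_bound_of_continuous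
    (hχ.continuous_fderiv (by simp))
  have hC0 : 0 ≤ C := (norm_nonneg _).trans (hC 0)
  let κ : ℝ := η / (2 * (2 * C + 1))
  have hκ : 0 < κ := by positivity
  have hRd := hR.differentiable (by simp)
  obtain ⟨δ, hδ, hb⟩ := Metric.continuous_iff.1 (hR.continuous_fderiv (by simp)) N κ hκ
  simp only [h1, dist_zero_right] at hb
  let ε : ℝ := δ / 3
  have hε : 0 < ε := by positivity
  let ψ : E3 → ℝ := fun x => χ (ε⁻¹ • (x - N))
  have hψ : ContDiff ℝ ∞ ψ := hχ.comp (by fun_prop)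
  have hψ' : ∀ x, ‖fderiv ℝ ψ x‖ ≤ C * ε⁻¹ := fun x => by
    have e : HasFDerivAt (fun x : E3 => ε⁻¹ • (x - N)) (ε⁻¹ • ContinuousLinearMap.id ℝ E3) x :=
      ((hasFDerivAt_id x).sub_const N).const_smul ε⁻¹
    have e2 : fderiv ℝ ψ x = ε⁻¹ • fderiv ℝ χ (ε⁻¹ • (x - N)) := by
      have := ((hχ.differentiable (by simp) _).hasFDerivAt.comp x e).fderiv
      rw [show ψ = χ ∘ fun x : E3 => ε⁻¹ • (x - N) from rfl, this]
      ext v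
      simp
    rw [e2, norm_smul, Real.norm_of_nonneg (by positivity), mul_comm]
    gcongr
    exact hC _
  have hout : ∀ x, 2 * ε ≤ dist x N → ψ x = 0 := fun x hx => by
    refine χ.zero_of_le_dist ?_
    rw [dist_zero_right, norm_smul, norm_inv, Real.norm_of_nonneg hε.le, ← dist_eq_norm,
      inv_mul_eq_div, le_div_iff₀ hε]
    exact hx
  refine ⟨fun x => ψ x • R x, hψ.smul hR, fun x => ?_, ?_⟩
  · rcases lt_or_ge (2 * ε) (dist x N) with hx | hx
    · have : (fun x => ψ x • R x) =ᶠ[𝓝 x] fun _ => 0 := by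
        filter_upwards [(continuous_id.dist continuous_const).continuousAt.eventually_const_lt hx]
          with y hy
        rw [hout y hy.le, zero_smul]
      rw [this.fderiv_eq]
      simpa using hη
    · have hball : x ∈ ball N δ := by
        rw [mem_ball]; simp only [ε] at hx; linarith
      have hmv := (convex_ball N δ).norm_image_sub_le_of_norm_fderiv_le (f := R) (C := κ)
        (fun y _ => hRd y) (fun y hy => (hb y hy).le) (mem_ball_self hδ) hball
      rw [h0, sub_zero, ← dist_eq_norm] at hmv
      rw [fderiv_fun_smul (hψ.differentiable (by simp) x) (hRd x)]
      have b1 : ‖ψ x • fderiv ℝ R x‖ ≤ 1 * κ := by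
        rw [norm_smul, Real.norm_of_nonneg χ.nonneg]
        exact mul_le_mul χ.le_one (hb x hball).le (norm_nonneg _) zero_le_one
      have b2 : ‖(fderiv ℝ ψ x).smulRight (R x)‖ ≤ (C * ε⁻¹) * (κ * (2 * ε)) := by
        rw [ContinuousLinearMap.norm_smulRight_apply]
        refine mul_le_mul (hψ' x) (hmv.trans (by gcongr)) (norm_nonneg _) (by positivity)
      have b3 : (C * ε⁻¹) * (κ * (2 * ε)) + 1 * κ = η / 2 := by
        simp only [κ]
        field_simp
      refine lt_of_le_of_lt (norm_add_le _ _) ?_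
      linarith
  · filter_upwards [ball_mem_nhds N hε] with x hx
    have : ψ x = 1 := by
      refine χ.one_of_mem_closedBall ?_
      rw [mem_closedBall_zero_iff, norm_smul, norm_inv, Real.norm_of_nonneg hε.le, ← dist_eq_norm,
        inv_mul_eq_div, div_le_one hε]
      exact (mem_ball.1 hx).le
    simp only [this, one_smul]

theorem quatRot_mem {d : ℍ} (hd : Quaternion.normSq d = 1) :
    quatRot d ∈ Matrix.specialOrthogonalGroup (Fin 3) ℝ := by
  refine Matrix.mem_specialOrthogonalGroup_iff.2 ⟨(Matrix.mem_orthogonalGroup_iff _ _).2 ?_, ?_⟩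
  · rw [← quatRot_star, ← quatRot_mul, Quaternion.self_mul_star, hd, Quaternion.coe_one,
      quatRot_one]
  · rw [det_quatRot, hd, one_pow]

/-- Every rotation is represented by a quaternion with nonnegative real part. -/
theorem exists_quatRot_eq {B : Matrix (Fin 3) (Fin 3) ℝ}
    (hB : B ∈ Matrix.specialOrthogonalGroup (Fin 3) ℝ) :
    ∃ q : ℍ, quatRot q = B ∧ q ≠ 0 ∧ 0 ≤ q.re := by
  have main : ∀ d : ℍ, Quaternion.normSq d = 1 → -1 < (B * quatRot d).trace →
      ∃ q : ℍ, quatRot q = B ∧ q ≠ 0 ∧ 0 ≤ q.re := by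
    intro d hd htr
    obtain ⟨f, -, hf⟩ := exists_lift_of_trace (s := univ) (B := fun _ => B * quatRot d)
      (fun i j => contDiff_const) (fun _ => mul_mem hB (quatRot_mem hd)) (fun _ _ => htr)
    obtain ⟨h1, h2⟩ := hf 0 (mem_univ _)
    let q := f 0 * star d
    have hqn : Quaternion.normSq q = 1 := by
      rw [map_mul, h1, Quaternion.normSq_star, hd, one_mul]
    have hq0 : q ≠ 0 := fun h => by simp [h] at hqn
    have hq : quatRot q = B := by
      rw [quatRot_mul, h2, quatRot_star, Matrix.mul_assoc,
        (specialOrthogonal_eqs (quatRot_mem hd)).1, Matrix.mul_one]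
    rcases le_total 0 q.re with h | h
    · exact ⟨q, hq, hq0, h⟩
    · refine ⟨(-1 : ℝ) • q, ?_, smul_ne_zero (by norm_num) hq0, ?_⟩
      · rw [quatRot_smul, hq]; norm_num
      · simpa using h
  have t0 : (B * quatRot (mkQuat 1 0 0 0)).trace = B 0 0 + B 1 1 + B 2 2 := by
    simp [quatRot, mkQuat, Matrix.trace, Fin.sum_univ_three, Matrix.mul_apply]
  have t1 : (B * quatRot (mkQuat 0 1 0 0)).trace = B 0 0 - B 1 1 - B 2 2 := by
    simp [quatRot, mkQuat, Matrix.trace, Fin.sum_univ_three, Matrix.mul_apply]; ring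
  have t2 : (B * quatRot (mkQuat 0 0 1 0)).trace = - B 0 0 + B 1 1 - B 2 2 := by
    simp [quatRot, mkQuat, Matrix.trace, Fin.sum_univ_three, Matrix.mul_apply]; ring
  have t3 : (B * quatRot (mkQuat 0 0 0 1)).trace = - B 0 0 - B 1 1 + B 2 2 := by
    simp [quatRot, mkQuat, Matrix.trace, Fin.sum_univ_three, Matrix.mul_apply]; ring
  by_contra hcon
  have n := fun d hd => not_lt.1 fun h => hcon (main d hd h)
  have n0 := n (mkQuat 1 0 0 0) (by rw [Quaternion.normSq_def']; simp [mkQuat])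
  have n1 := n (mkQuat 0 1 0 0) (by rw [Quaternion.normSq_def']; simp [mkQuat])
  have n2 := n (mkQuat 0 0 1 0) (by rw [Quaternion.normSq_def']; simp [mkQuat])
  have n3 := n (mkQuat 0 0 0 1) (by rw [Quaternion.normSq_def']; simp [mkQuat])
  linarith

theorem exists_path_of_triangular_mul {T W : Matrix (Fin 3) (Fin 3) ℝ}
    (hW : W ∈ Matrix.specialOrthogonalGroup (Fin 3) ℝ) (e01 : T 0 1 = 0) (e21 : T 2 1 = 0)
    (e20 : T 2 0 = 0) (e00 : 0 < T 0 0) (e11 : 0 < T 1 1) (e22 : 0 < T 2 2) :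
    ∃ γ : ℝ → Matrix (Fin 3) (Fin 3) ℝ, (∀ i j, ContDiff ℝ ∞ fun t => γ t i j) ∧ γ 0 = 1 ∧
      γ 1 = T * W ∧ ∀ t ∈ Icc (0 : ℝ) 1, 0 < (γ t).det := by
  obtain ⟨q, hqW, hq0, hqre⟩ := exists_quatRot_eq hW
  let Q : ℝ → ℍ := fun t => (1 - t) • (1 : ℍ) + t • q
  have hQ : ContDiff ℝ ∞ Q := by fun_prop
  have hQ0 : ∀ t ∈ Icc (0 : ℝ) 1, Q t ≠ 0 := fun t ht h => by
    rcases eq_or_lt_of_le ht.2 with rfl | h1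
    · exact hq0 (by simpa [Q] using h)
    · have : (Q t).re = 0 := by rw [h]; rfl
      have e : (Q t).re = (1 - t) + t * q.re := by simp [Q]
      have := mul_nonneg ht.1 hqre
      linarith
  have hQR := contDiff_quatRot hQ
  have hS : ∀ i j, ContDiff ℝ ∞ fun t : ℝ =>
      ((1 - t) • (1 : Matrix (Fin 3) (Fin 3) ℝ) + t • T) i j := by
    intro i j
    simp only [Matrix.add_apply, Matrix.smul_apply]
    fun_prop
  refine ⟨fun t => ((1 - t) • (1 : Matrix (Fin 3) (Fin 3) ℝ) + t • T) * quatRot (Q t),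
    fun i j => ?_, ?_, ?_, fun t ht => ?_⟩
  · simp only [Matrix.mul_apply]
    exact ContDiff.sum fun k _ => (hS i k).mul (hQR k j)
  · simp [Q, quatRot_one]
  · simp [Q, hqW]
  · rw [Matrix.det_mul, det_quatRot]
    have hn : 0 < Quaternion.normSq (Q t) :=
      lt_of_le_of_ne Quaternion.normSq_nonneg (Quaternion.normSq_ne_zero.2 (hQ0 t ht)).symm
    refine mul_pos ?_ (pow_pos hn 3)
    have hp : ∀ x : ℝ, 0 < x → 0 < 1 - t + t * x := fun x hx => by
      rcases eq_or_lt_of_le ht.1 with h | h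
      · rw [← h]; norm_num
      · have := mul_pos h hx
        linarith [ht.2]
    rw [Matrix.det_fin_three]
    simp [e01, e21, e20]
    exact mul_pos (mul_pos (hp _ e00) (hp _ e11)) (hp _ e22)

/-- Matrices of positive determinant are joined to the identity by a smooth path of such
matrices. -/
theorem exists_path_of_det_pos {M : Matrix (Fin 3) (Fin 3) ℝ} (hM : 0 < M.det) :
    ∃ γ : ℝ → Matrix (Fin 3) (Fin 3) ℝ, (∀ i j, ContDiff ℝ ∞ fun t => γ t i j) ∧ γ 0 = 1 ∧
      γ 1 = M ∧ ∀ t ∈ Icc (0 : ℝ) 1, 0 < (γ t).det := by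
  have hdet : M 1 ⬝ᵥ (M 2) ⨯₃ (M 0) = M.det := by
    rw [triple_product_permutation, triple_product_permutation, triple_product_eq_det]
    congr 1
    ext i j
    fin_cases i <;> rfl
  have hcr : M 0 ⨯₃ M 2 ≠ 0 := fun h => by
    rw [← cross_anticomm, h, neg_zero, dotProduct_zero] at hdet
    exact hM.ne hdet
  obtain ⟨h2, h20⟩ := ne_zero_of_cross hcr
  let W := frameMatrix (M 0) (M 2)
  have hW : W ∈ Matrix.specialOrthogonalGroup (Fin 3) ℝ := frameMatrix_mem hcr
  let T := M * Wᵀ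
  have hTW : T * W = M := by
    rw [Matrix.mul_assoc, (specialOrthogonal_eqs hW).2.1, Matrix.mul_one]
  have hTdet : T.det = M.det := by
    rw [Matrix.det_mul, Matrix.det_transpose, (Matrix.mem_specialOrthogonalGroup_iff.1 hW).2,
      mul_one]
  have e01 : T 0 1 = 0 := by
    change M 0 ⬝ᵥ unitize (M 2 ⨯₃ M 0) = 0
    rw [unitize, dotProduct_smul, dot_cross_self, smul_zero]
  have e21 : T 2 1 = 0 := by
    change M 2 ⬝ᵥ unitize (M 2 ⨯₃ M 0) = 0
    rw [unitize, dotProduct_smul, dot_self_cross, smul_zero]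
  have e20 : T 2 0 = 0 := by
    change M 2 ⬝ᵥ unitize (M 2 ⨯₃ M 0) ⨯₃ unitize (M 2) = 0
    simp only [unitize, map_smul, dotProduct_smul, LinearMap.smul_apply, dot_cross_self, smul_zero]
  have e22 : 0 < T 2 2 := by
    change 0 < M 2 ⬝ᵥ unitize (M 2)
    rw [unitize, dotProduct_smul]
    exact mul_pos (inv_pos.2 (Real.sqrt_pos.2 (dotProduct_self_pos h2))) (dotProduct_self_pos h2)
  have e11 : 0 < T 1 1 := by
    change 0 < M 1 ⬝ᵥ unitize (M 2 ⨯₃ M 0)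
    rw [unitize, dotProduct_smul, hdet]
    exact mul_pos (inv_pos.2 (Real.sqrt_pos.2 (dotProduct_self_pos h20))) hM
  have e00 : 0 < T 0 0 := by
    have : T.det = T 0 0 * (T 1 1 * T 2 2) := by
      rw [Matrix.det_fin_three, e01, e21, e20]; ring
    rw [← hTdet, this] at hM
    exact (pos_iff_pos_of_mul_pos hM).2 (mul_pos e11 e22)
  simpa only [hTW] using exists_path_of_triangular_mul hW e01 e21 e20 e00 e11 e22

/-- The linear endomorphism of Euclidean space given by a matrix. -/
abbrev euclid (M : Matrix (Fin 3) (Fin 3) ℝ) : E3 →L[ℝ] E3 := Matrix.toEuclideanCLM (𝕜 := ℝ) M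

theorem euclid_mul_apply (M M' : Matrix (Fin 3) (Fin 3) ℝ) (v : E3) :
    euclid (M * M') v = euclid M (euclid M' v) := by
  rw [euclid, map_mul]; rfl

theorem euclid_one_apply (v : E3) : euclid 1 v = v := by
  rw [euclid, map_one]; rfl

theorem euclid_single (M : Matrix (Fin 3) (Fin 3) ℝ) (i j : Fin 3) :
    euclid M (EuclideanSpace.single j 1) i = M i j := by
  change (M *ᵥ (EuclideanSpace.single j (1 : ℝ)).ofLp) i = M i j
  simp

theorem euclid_injective {M : Matrix (Fin 3) (Fin 3) ℝ} (hM : M.det ≠ 0) {v : E3}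
    (h : euclid M v = 0) : v = 0 := by
  rw [← euclid_one_apply v, ← Matrix.nonsing_inv_mul M (isUnit_iff_ne_zero.2 hM),
    euclid_mul_apply, h, map_zero]

theorem contDiff_euclid {γ : ℝ → Matrix (Fin 3) (Fin 3) ℝ}
    (hγ : ∀ i j, ContDiff ℝ ∞ fun t => γ t i j) : ContDiff ℝ ∞ fun t => euclid (γ t) := by
  have h : (fun t => euclid (γ t)) =
      fun t => ∑ i, ∑ j, γ t i j • euclid (Matrix.single i j 1) := by
    ext1 t
    conv_lhs => rw [Matrix.matrix_eq_sum_single (γ t)]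
    simp only [euclid, map_sum, ← map_smul, Matrix.smul_single, smul_eq_mul, mul_one]
  rw [h]
  exact ContDiff.sum fun i _ => ContDiff.sum fun j _ => (hγ i j).smul contDiff_const

/-- The north pole. -/
def northPole : E3 := EuclideanSpace.single 2 1

theorem northPole_mem : northPole ∈ sphere (0 : E3) 1 := by
  simp [northPole]

/-- An immersion of the sphere that is orientation preserving and affine near the north pole. -/
structure PolarForm (H : E3 → E3) (c : E3) (M : Matrix (Fin 3) (Fin 3) ℝ) : Prop where
  contDiff : ContDiff ℝ ∞ H
  sphereImm : SphereImm H
  eventuallyEq : H =ᶠ[𝓝 northPole] fun y => c + euclid M (y - northPole)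
  det_pos : 0 < M.det

/-- Two immersions in polar form can be made to agree near the north pole. -/
theorem PolarForm.exists_eventuallyEq {H₀ H₁ : E3 → E3} {c₀ c₁ : E3}
    {M₀ M₁ : Matrix (Fin 3) (Fin 3) ℝ} (h₀ : PolarForm H₀ c₀ M₀) (h₁ : PolarForm H₁ c₁ M₁) :
    ∃ H : E3 → E3, ContDiff ℝ ∞ H ∧ SphereImm H ∧ H =ᶠ[𝓝 northPole] H₁ ∧
      RegularlyHomotopic (fun x => H₀ x) (fun x => H x) := by
  have hdet : 0 < (M₁ * M₀⁻¹).det := by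
    rw [Matrix.det_mul, Matrix.det_nonsing_inv, Ring.inverse_eq_inv']
    exact mul_pos h₁.det_pos (inv_pos.2 h₀.det_pos)
  obtain ⟨γ, hγ, hγ0, hγ1, hγd⟩ := exists_path_of_det_pos hdet
  let F : ℝ → E3 → E3 := fun t y => euclid (γ t) (H₀ y - c₀) + c₀ + t • (c₁ - c₀)
  have hF : ContDiff ℝ ∞ fun z : ℝ × E3 => F z.1 z.2 :=
    ((((contDiff_euclid hγ).comp contDiff_fst).clm_apply
      ((h₀.contDiff.comp contDiff_snd).sub contDiff_const)).add contDiff_const).add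
      (contDiff_fst.smul contDiff_const)
  have hFt (t : ℝ) : ContDiff ℝ ∞ (F t) := (((euclid (γ t)).contDiff.comp
    (h₀.contDiff.sub contDiff_const)).add contDiff_const).add contDiff_const
  have hd (t : ℝ) (x : E3) : fderiv ℝ (F t) x = (euclid (γ t)).comp (fderiv ℝ H₀ x) := by
    have h := ((h₀.contDiff.differentiable (by simp)) x).hasFDerivAt
    exact ((((euclid (γ t)).hasFDerivAt.comp x (h.sub_const c₀)).add_const c₀).add_const
      (t • (c₁ - c₀))).fderiv
  have hI : ∀ t ∈ Icc (0 : ℝ) 1, SphereImm (F t) := by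
    intro t ht x hx v hv h
    rw [hd] at h
    exact h₀.sphereImm x hx v hv (euclid_injective (hγd t ht).ne' h)
  refine ⟨F 1, hFt 1, hI 1 (by simp), ?_, ?_⟩
  · filter_upwards [h₀.eventuallyEq, h₁.eventuallyEq] with y e0 e1
    simp only [F, e0, e1, hγ1, add_sub_cancel_left]
    rw [← euclid_mul_apply, Matrix.mul_assoc,
      Matrix.nonsing_inv_mul _ (isUnit_iff_ne_zero.2 h₀.det_pos.ne'), Matrix.mul_one, one_smul]
    abel
  · have := RegularlyHomotopic.of_ambient (hF.of_le (by simp)) hI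
    have e : F 0 = H₀ := by
      ext1 y
      simp only [F, hγ0, euclid_one_apply, zero_smul]
      abel
    rwa [e] at this

/-- An immersion of the sphere has an extension that is orientation preserving at the pole. -/
theorem SphereImm.exists_det_pos {G : E3 → E3} (hG : ContDiff ℝ ∞ G) (hI : SphereImm G) :
    ∃ (G' : E3 → E3) (M : Matrix (Fin 3) (Fin 3) ℝ), ContDiff ℝ ∞ G' ∧ SphereImm G' ∧
      (∀ x ∈ sphere (0 : E3) 1, G' x = G x) ∧ fderiv ℝ G' northPole = euclid M ∧ 0 < M.det := by
  let A := fderiv ℝ G northPole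
  let a : V3 := (A (EuclideanSpace.single 0 1)).ofLp
  let b : V3 := (A (EuclideanSpace.single 1 1)).ofLp
  let k : E3 := (2⁻¹ : ℝ) • (WithLp.toLp 2 (a ⨯₃ b) - A (EuclideanSpace.single 2 1))
  have hab : a ⨯₃ b ≠ 0 := by
    refine crossProduct_ne_zero_iff_linearIndependent.2 (LinearIndependent.pair_iff.2 ?_)
    intro s t hst
    have h : s • (EuclideanSpace.single 0 1 : E3) + t • EuclideanSpace.single 1 1 = 0 := by
      refine hI northPole northPole_mem _ ?_ ?_
      · simp [northPole, inner_add_right, inner_smul_right, EuclideanSpace.inner_single_left]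
      · rw [map_add, map_smul, map_smul]
        exact WithLp.ofLp_injective 2 hst
    constructor
    · simpa using congrArg (fun v : E3 => v 0) h
    · simpa using congrArg (fun v : E3 => v 1) h
  let G' : E3 → E3 := fun x => G x + (‖x‖ ^ 2 - 1) • k
  have hG' : ContDiff ℝ ∞ G' :=
    hG.add (((contDiff_norm_sq ℝ).sub contDiff_const).smul contDiff_const)
  have hd (x v : E3) : fderiv ℝ G' x v = fderiv ℝ G x v + (2 * inner ℝ x v) • k := by
    have h1 := ((hG.differentiable (by simp)) x).hasFDerivAt
    have h2 := (hasStrictFDerivAt_norm_sq x).hasFDerivAt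
    have := (h1.add ((h2.sub_const 1).smul_const k)).fderiv
    change fderiv ℝ G' x = _ at this
    rw [this]
    simp
  obtain ⟨M, hM⟩ : ∃ M, euclid M = fderiv ℝ G' northPole :=
    ⟨_, StarAlgEquiv.apply_symm_apply (Matrix.toEuclideanCLM (n := Fin 3) (𝕜 := ℝ)) _⟩
  refine ⟨G', M, hG', ?_, ?_, hM.symm, ?_⟩
  · intro x hx v hv h
    rw [hd, hv, mul_zero, zero_smul, add_zero] at h
    exact hI x hx v hv h
  · intro x hx
    have : ‖x‖ = 1 := by simpa using hx
    simp [G', this]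
  · have c0 (i : Fin 3) : M i 0 = a i := by
      rw [← euclid_single M, hM, hd]
      simp [northPole, a, A, EuclideanSpace.inner_single_left]
    have c1 (i : Fin 3) : M i 1 = b i := by
      rw [← euclid_single M, hM, hd]
      simp [northPole, b, A, EuclideanSpace.inner_single_left]
    have c2 (i : Fin 3) : M i 2 = (a ⨯₃ b) i := by
      rw [← euclid_single M, hM, hd]
      simp [northPole, A, k]
    have h := dotProduct_self_pos hab
    rw [Matrix.det_fin_three, c0, c0, c0, c1, c1, c1, c2, c2, c2]
    convert h using 1
    generalize a = a, b = b
    simp [cross_apply, dotProduct, Fin.sum_univ_three]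
    ring

/-- Every immersion of the sphere is regularly homotopic to one in polar form. -/
theorem exists_polarForm {f : S2 → E3} (hf : ContMDiff (𝓡 2) 𝓘(ℝ, E3) 1 f)
    (hinj : ∀ x : S2, Injective (mfderiv (𝓡 2) 𝓘(ℝ, E3) f x)) :
    ∃ (H : E3 → E3) (c : E3) (M : Matrix (Fin 3) (Fin 3) ℝ), PolarForm H c M ∧
      RegularlyHomotopic f (fun x => H x) := by
  obtain ⟨F, hF, hFc, hFI, rfl⟩ := exists_ambient_extension hf hinj
  obtain ⟨η, hη, hnear⟩ := hFI.exists_near hF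
  obtain ⟨G, hG, hGF⟩ := exists_smooth_approx hF hFc hη
  obtain ⟨hGI, hFG⟩ := hnear G (hG.of_le (by simp)) fun x _ => hGF x
  obtain ⟨G', M, hG', hGI', hGG', hM, hdet⟩ := hGI.exists_det_pos hG
  have e : (fun x : S2 => G' x) = fun x : S2 => G x := funext fun x => hGG' x x.2
  rw [← e] at hFG
  obtain ⟨ε, hε, hnear'⟩ := hGI'.exists_near (hG'.of_le (by simp))
  let R : E3 → E3 := fun y => G' northPole + euclid M (y - northPole) - G' y
  have hR : ContDiff ℝ ∞ R :=
    (contDiff_const.add ((euclid M).contDiff.comp (contDiff_id.sub contDiff_const))).sub hG'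
  have hR1 : fderiv ℝ R northPole = 0 := by
    have h1 := ((hG'.differentiable (by simp)) northPole).hasFDerivAt
    have h2 := (euclid M).hasFDerivAt.comp northPole
      ((hasFDerivAt_id northPole).sub_const northPole)
    have := ((h2.const_add (G' northPole)).sub h1).fderiv
    change fderiv ℝ R northPole = _ at this
    rw [this, hM]
    simp
  obtain ⟨S, hS, hSd, hSR⟩ := exists_germ_small hR (by simp [R]) hR1 hε
  obtain ⟨hHI, hGH⟩ := hnear' (fun y => G' y + S y) ((hG'.add hS).of_le (by simp)) fun x _ => by
    have := (((hG'.differentiable (by simp)) x).hasFDerivAt.add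
      ((hS.differentiable (by simp)) x).hasFDerivAt).fderiv
    change fderiv ℝ (fun y => G' y + S y) x = _ at this
    rw [this, add_sub_cancel_left]
    exact hSd x
  refine ⟨fun y => G' y + S y, G' northPole, M, ⟨hG'.add hS, hHI, ?_, hdet⟩, hFG.trans hGH⟩
  filter_upwards [hSR] with y hy
  rw [hy]
  simp [R]

/-- Inverse stereographic projection from the north pole. -/
def invStereo (p : ℝ × ℝ) : E3 :=
  WithLp.toLp 2 ![2 * p.1 / (p.1 ^ 2 + p.2 ^ 2 + 1), 2 * p.2 / (p.1 ^ 2 + p.2 ^ 2 + 1),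
    (p.1 ^ 2 + p.2 ^ 2 - 1) / (p.1 ^ 2 + p.2 ^ 2 + 1)]

/-- Stereographic projection from the north pole. -/
def stereoPlane (x : E3) : ℝ × ℝ := (x 0 / (1 - x 2), x 1 / (1 - x 2))

theorem invStereo_denom_pos (p : ℝ × ℝ) : 0 < p.1 ^ 2 + p.2 ^ 2 + 1 := by positivity

theorem one_sub_invStereo (p : ℝ × ℝ) : 1 - invStereo p 2 = 2 / (p.1 ^ 2 + p.2 ^ 2 + 1) := by
  have := (invStereo_denom_pos p).ne'
  change 1 - (p.1 ^ 2 + p.2 ^ 2 - 1) / (p.1 ^ 2 + p.2 ^ 2 + 1) = _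
  field_simp
  ring

theorem invStereo_lt_one (p : ℝ × ℝ) : invStereo p 2 < 1 := by
  have := div_pos two_pos (invStereo_denom_pos p)
  rw [← one_sub_invStereo] at this
  linarith

theorem stereoPlane_invStereo (p : ℝ × ℝ) : stereoPlane (invStereo p) = p := by
  have := (invStereo_denom_pos p).ne'
  ext
  · change invStereo p 0 / (1 - invStereo p 2) = _
    rw [one_sub_invStereo]
    change 2 * p.1 / (p.1 ^ 2 + p.2 ^ 2 + 1) / _ = _
    field_simp
  · change invStereo p 1 / (1 - invStereo p 2) = _
    rw [one_sub_invStereo]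
    change 2 * p.2 / (p.1 ^ 2 + p.2 ^ 2 + 1) / _ = _
    field_simp

theorem contDiff_invStereo : ContDiff ℝ ∞ invStereo := by
  refine contDiff_euclidean.2 fun i => ?_
  have h : ContDiff ℝ ∞ fun p : ℝ × ℝ => p.1 ^ 2 + p.2 ^ 2 + 1 := by fun_prop
  have hne := fun p => (invStereo_denom_pos p).ne'
  fin_cases i
  · exact ContDiff.div (f := fun p : ℝ × ℝ => 2 * p.1) (by fun_prop) h hne
  · exact ContDiff.div (f := fun p : ℝ × ℝ => 2 * p.2) (by fun_prop) h hne
  · exact ContDiff.div (f := fun p : ℝ × ℝ => p.1 ^ 2 + p.2 ^ 2 - 1) (by fun_prop) h hne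

theorem norm_invStereo (p : ℝ × ℝ) : ‖invStereo p‖ = 1 := by
  have := (invStereo_denom_pos p).ne'
  rw [← sq_eq_sq₀ (norm_nonneg _) zero_le_one, EuclideanSpace.real_norm_sq_eq, Fin.sum_univ_three]
  change (2 * p.1 / (p.1 ^ 2 + p.2 ^ 2 + 1)) ^ 2 + (2 * p.2 / (p.1 ^ 2 + p.2 ^ 2 + 1)) ^ 2 +
    ((p.1 ^ 2 + p.2 ^ 2 - 1) / (p.1 ^ 2 + p.2 ^ 2 + 1)) ^ 2 = 1 ^ 2
  field_simp
  ring

theorem invStereo_mem (p : ℝ × ℝ) : invStereo p ∈ sphere (0 : E3) 1 := by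
  rw [mem_sphere_zero_iff_norm, norm_invStereo]

theorem exists_invStereo {x : E3} (hx : x ∈ sphere (0 : E3) 1) (hN : x ≠ northPole) :
    ∃ p, invStereo p = x := by
  have h1 : x 0 ^ 2 + x 1 ^ 2 + x 2 ^ 2 = 1 := by
    rw [← Fin.sum_univ_three (fun i => x i ^ 2), ← EuclideanSpace.real_norm_sq_eq,
      mem_sphere_zero_iff_norm.1 hx, one_pow]
  have h2 : 1 - x 2 ≠ 0 := by
    intro h
    have e2 : x 2 = 1 := by linarith
    have e0 : x 0 = 0 := by nlinarith [sq_nonneg (x 0), sq_nonneg (x 1)]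
    have e1 : x 1 = 0 := by nlinarith [sq_nonneg (x 0), sq_nonneg (x 1)]
    refine hN ?_
    ext i
    fin_cases i
    · simpa [northPole] using e0
    · simpa [northPole] using e1
    · simpa [northPole] using e2
  have hD : (x 0 / (1 - x 2)) ^ 2 + (x 1 / (1 - x 2)) ^ 2 + 1 = 2 / (1 - x 2) := by
    field_simp
    linear_combination h1
  have hD' : (x 0 / (1 - x 2)) ^ 2 + (x 1 / (1 - x 2)) ^ 2 - 1 = 2 * x 2 / (1 - x 2) := by
    field_simp
    linear_combination h1
  refine ⟨(x 0 / (1 - x 2), x 1 / (1 - x 2)), ?_⟩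
  ext i
  simp only [invStereo, hD, hD']
  fin_cases i <;> simp <;> field_simp

theorem contDiffAt_stereoPlane {x : E3} (hx : x 2 < 1) : ContDiffAt ℝ ∞ stereoPlane x := by
  have h (i : Fin 3) : ContDiffAt ℝ ∞ (fun x : E3 => x i) x :=
    contDiffAt_euclidean.1 contDiffAt_id i
  have hne : 1 - x 2 ≠ 0 := by linarith
  exact ((h 0).div (contDiffAt_const.sub (h 2)) hne).prodMk
    ((h 1).div (contDiffAt_const.sub (h 2)) hne)

theorem differentiable_invStereo : Differentiable ℝ invStereo :=
  contDiff_invStereo.differentiable (by simp)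

theorem fderiv_invStereo_injective (p : ℝ × ℝ) : Injective (fderiv ℝ invStereo p) := by
  have h1 := ((contDiffAt_stereoPlane (invStereo_lt_one p)).differentiableAt (by simp)).hasFDerivAt
  have h2 := h1.comp p (differentiable_invStereo p).hasFDerivAt
  have e : stereoPlane ∘ invStereo = id := funext stereoPlane_invStereo
  rw [e] at h2
  have h3 := h2.unique (hasFDerivAt_id p)
  refine LeftInverse.injective (g := fderiv ℝ stereoPlane (invStereo p)) fun w => ?_
  exact congrArg (fun A : ℝ × ℝ →L[ℝ] ℝ × ℝ => A w) h3

theorem inner_fderiv_invStereo (p w : ℝ × ℝ) :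
    inner ℝ (invStereo p) (fderiv ℝ invStereo p w) = 0 := by
  have h := (differentiable_invStereo p).hasFDerivAt.norm_sq
  have e : (fun p => ‖invStereo p‖ ^ 2) = fun _ => (1 : ℝ) := funext fun p => by
    rw [norm_invStereo, one_pow]
  rw [e] at h
  have := congrArg (fun A : ℝ × ℝ →L[ℝ] ℝ => A w) (h.unique (hasFDerivAt_const 1 p))
  simpa using this

theorem exists_fderiv_invStereo {p : ℝ × ℝ} {v : E3} (hv : inner ℝ (invStereo p) v = 0) :
    ∃ w, fderiv ℝ invStereo p w = v := by
  have hne : invStereo p ≠ 0 := fun h => by simpa [h] using norm_invStereo p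
  have hle : LinearMap.range (fderiv ℝ invStereo p : ℝ × ℝ →ₗ[ℝ] E3) ≤ (ℝ ∙ invStereo p)ᗮ := by
    rintro _ ⟨w, rfl⟩
    exact Submodule.mem_orthogonal_singleton_iff_inner_right.2 (inner_fderiv_invStereo p w)
  have heq := Submodule.eq_of_le_of_finrank_eq hle (by
    rw [Submodule.finrank_orthogonal_span_singleton (n := 2) hne,
      LinearMap.finrank_range_of_inj (fderiv_invStereo_injective p)]
    simp)
  have : v ∈ (ℝ ∙ invStereo p)ᗮ := Submodule.mem_orthogonal_singleton_iff_inner_right.2 hv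
  rw [← heq] at this
  exact this

theorem planeImmersion_iff {g : ℝ × ℝ → V3} :
    PlaneImmersion g ↔ ∀ p w, fderiv ℝ g p w = 0 → w = 0 := by
  refine forall_congr' fun p => ?_
  have key (w : ℝ × ℝ) : fderiv ℝ g p w =
      w.1 • fderiv ℝ g p (1, 0) + w.2 • fderiv ℝ g p (0, 1) := by
    rw [← map_smul, ← map_smul, ← map_add]
    simp
  rw [crossProduct_ne_zero_iff_linearIndependent, LinearIndependent.pair_iff]
  constructor
  · intro h w hw
    rw [key] at hw
    exact Prod.ext_iff.2 (h _ _ hw)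
  · intro h s t hst
    exact Prod.ext_iff.1 (h (s, t) (by rw [key]; exact hst))

theorem fderiv_ofLp_comp_invStereo {F : E3 → E3} (hF : Differentiable ℝ F) (p w : ℝ × ℝ) :
    fderiv ℝ (fun p => (F (invStereo p)).ofLp) p w =
      (fderiv ℝ F (invStereo p) (fderiv ℝ invStereo p w)).ofLp := by
  have h := (hF (invStereo p)).hasFDerivAt.comp p (differentiable_invStereo p).hasFDerivAt
  have := ((EuclideanSpace.equiv (Fin 3) ℝ : E3 →L[ℝ] V3).hasFDerivAt.comp p h).fderiv
  exact congrArg (fun A : ℝ × ℝ →L[ℝ] V3 => A w) this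

theorem SphereImm.planeImmersion {F : E3 → E3} (hF : Differentiable ℝ F) (hI : SphereImm F) :
    PlaneImmersion fun p => (F (invStereo p)).ofLp := by
  refine planeImmersion_iff.2 fun p w hw => ?_
  rw [fderiv_ofLp_comp_invStereo hF] at hw
  have := hI _ (invStereo_mem p) _ (inner_fderiv_invStereo p w) (WithLp.ofLp_injective 2 hw)
  exact fderiv_invStereo_injective p (this.trans (map_zero _).symm)

theorem sphereImm_of_planeImmersion {F : E3 → E3} (hF : Differentiable ℝ F)
    (hP : PlaneImmersion fun p => (F (invStereo p)).ofLp)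
    (hN : ∀ v : E3, inner ℝ northPole v = 0 → fderiv ℝ F northPole v = 0 → v = 0) :
    SphereImm F := by
  intro x hx v hv h
  by_cases hxN : x = northPole
  · subst hxN
    exact hN v hv h
  · obtain ⟨p, rfl⟩ := exists_invStereo hx hxN
    obtain ⟨w, rfl⟩ := exists_fderiv_invStereo hv
    rw [planeImmersion_iff.1 hP p w (by rw [fderiv_ofLp_comp_invStereo hF, h]; rfl), map_zero]

theorem norm_sq_le_sq_add_sq (p : ℝ × ℝ) : ‖p‖ ^ 2 ≤ p.1 ^ 2 + p.2 ^ 2 := by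
  rcases max_choice ‖p.1‖ ‖p.2‖ with h | h <;>
    rw [Prod.norm_def, h, Real.norm_eq_abs, sq_abs] <;> nlinarith [sq_nonneg p.1, sq_nonneg p.2]

theorem sq_add_sq_le_norm_sq (p : ℝ × ℝ) : p.1 ^ 2 + p.2 ^ 2 ≤ 2 * ‖p‖ ^ 2 := by
  have h1 : |p.1| ≤ ‖p‖ := norm_fst_le p
  have h2 : |p.2| ≤ ‖p‖ := norm_snd_le p
  have := sq_le_sq' (by linarith [abs_nonneg p.1, norm_nonneg p]) h1
  have := sq_le_sq' (by linarith [abs_nonneg p.2, norm_nonneg p]) h2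
  rw [sq_abs] at *
  linarith

theorem norm_invStereo_sub_sq (p : ℝ × ℝ) :
    ‖invStereo p - northPole‖ ^ 2 = 4 / (p.1 ^ 2 + p.2 ^ 2 + 1) := by
  have h : inner ℝ (invStereo p) northPole = invStereo p 2 := by
    simp [northPole, EuclideanSpace.inner_single_right]
  have h1 := one_sub_invStereo p
  rw [norm_sub_sq_real, norm_invStereo, mem_sphere_zero_iff_norm.1 northPole_mem, h]
  have : (4 : ℝ) / (p.1 ^ 2 + p.2 ^ 2 + 1) = 2 * (2 / (p.1 ^ 2 + p.2 ^ 2 + 1)) := by ring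
  rw [this, ← h1]
  ring

/-- Sphere immersions that agree near a point are regularly homotopic. -/
theorem regularlyHomotopic_of_eventuallyEq {H₀ H₁ : E3 → E3} (h₀ : ContDiff ℝ ∞ H₀)
    (h₁ : ContDiff ℝ ∞ H₁) (hI₀ : SphereImm H₀) (hI₁ : SphereImm H₁)
    (heq : H₀ =ᶠ[𝓝 northPole] H₁) :
    RegularlyHomotopic (fun x => H₀ x) (fun x => H₁ x) := by
  have hd₀ := h₀.differentiable (by simp)
  have hd₁ := h₁.differentiable (by simp)
  let g₀ : ℝ × ℝ → V3 := fun p => (H₀ (invStereo p)).ofLp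
  let g₁ : ℝ × ℝ → V3 := fun p => (H₁ (invStereo p)).ofLp
  have hofLp : ContDiff ℝ ∞ (WithLp.ofLp : E3 → V3) := (EuclideanSpace.equiv (Fin 3) ℝ).contDiff
  have htoLp : ContDiff ℝ ∞ (WithLp.toLp 2 : V3 → E3) :=
    (EuclideanSpace.equiv (Fin 3) ℝ).symm.contDiff
  have hg₀ : ContDiff ℝ ∞ g₀ := hofLp.comp (h₀.comp contDiff_invStereo)
  have hg₁ : ContDiff ℝ ∞ g₁ := hofLp.comp (h₁.comp contDiff_invStereo)
  obtain ⟨δ, hδ, hball⟩ := Metric.eventually_nhds_iff.1 heq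
  have hEq : ∀ p, 2 / δ < ‖p‖ → g₀ p = g₁ p := by
    intro p hp
    refine congrArg WithLp.ofLp (hball (y := invStereo p) ?_)
    rw [dist_eq_norm]
    refine lt_of_pow_lt_pow_left₀ 2 hδ.le ?_
    rw [norm_invStereo_sub_sq, div_lt_iff₀ (invStereo_denom_pos p)]
    have h1 := norm_sq_le_sq_add_sq p
    have h2 : 2 < δ * ‖p‖ := by rwa [div_lt_iff₀' hδ] at hp
    nlinarith [sq_pos_of_pos hδ]
  obtain ⟨G, hG, hG0, hG1, ⟨r', hr', hGr⟩, hGI⟩ := exists_plane_homotopy hg₀ hg₁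
    (hI₀.planeImmersion hd₀) (hI₁.planeImmersion hd₁) (div_pos two_pos hδ) hEq
  have hr'0 : 0 < r' := (div_pos two_pos hδ).trans hr'
  obtain ⟨d, hd⟩ : ∃ d, d = 2 / (2 * r' ^ 2 + 1) := ⟨_, rfl⟩
  have hd0 : 0 < d := by rw [hd]; positivity
  let η : ℝ → ℝ := fun s => Real.smoothTransition (2 * (1 - s) / d - 1)
  have hη : ContDiff ℝ ∞ η := Real.smoothTransition.contDiff.comp (by fun_prop)
  have hη1 {s : ℝ} (hs : d ≤ 1 - s) : η s = 1 := by
    refine Real.smoothTransition.one_of_one_le ?_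
    rw [le_sub_iff_add_le, le_div_iff₀ hd0]
    linarith
  have hη0 {s : ℝ} (hs : 1 - d / 2 < s) : η s = 0 := by
    refine Real.smoothTransition.zero_of_nonpos ?_
    rw [sub_nonpos, div_le_one hd0]
    linarith
  let F : ℝ → E3 → E3 := fun t x => H₀ x +
    η (x 2) • WithLp.toLp 2 (G (t, stereoPlane x) - g₀ (stereoPlane x))
  have hcoord : ContDiff ℝ ∞ fun z : ℝ × E3 => z.2 2 := contDiff_euclidean.1 contDiff_snd 2
  have hF : ContDiff ℝ ∞ fun z : ℝ × E3 => F z.1 z.2 := by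
    refine contDiff_iff_contDiffAt.2 fun z => ?_
    rcases lt_or_ge (z.2 2) 1 with hz | hz
    · have hs : ContDiffAt ℝ ∞ (fun z : ℝ × E3 => stereoPlane z.2) z :=
        ContDiffAt.comp z (contDiffAt_stereoPlane hz) contDiffAt_snd
      have hs' : ContDiffAt ℝ ∞ (fun z : ℝ × E3 => (z.1, stereoPlane z.2)) z :=
        contDiffAt_fst.prodMk hs
      exact (h₀.comp contDiff_snd).contDiffAt.add ((hη.comp hcoord).contDiffAt.smul
        (htoLp.contDiffAt.comp z ((hG.contDiffAt.comp z hs').sub (hg₀.contDiffAt.comp z hs))))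
    · refine (h₀.comp contDiff_snd).contDiffAt.congr_of_eventuallyEq ?_
      have : ∀ᶠ y : ℝ × E3 in 𝓝 z, 1 - d / 2 < y.2 2 :=
        hcoord.continuous.continuousAt.eventually (lt_mem_nhds (by linarith))
      filter_upwards [this] with y hy
      simp [F, hη0 hy]
  have hFt (t : ℝ) : Differentiable ℝ (F t) := fun x =>
    (hF.differentiable (by simp) (t, x)).comp x
      ((differentiableAt_const t).prodMk differentiableAt_id)
  have hFσ (t : ℝ) (p : ℝ × ℝ) : (F t (invStereo p)).ofLp = G (t, p) := by
    have h : η (invStereo p 2) • (G (t, p) - g₀ p) = G (t, p) - g₀ p := by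
      rcases le_or_gt d (1 - invStereo p 2) with hp | hp
      · rw [hη1 hp, one_smul]
      · rw [hGr t p, sub_self, smul_zero]
        rw [one_sub_invStereo, hd, div_lt_div_iff_of_pos_left two_pos (invStereo_denom_pos p)
          (by positivity)] at hp
        have := sq_add_sq_le_norm_sq p
        exact le_of_sq_le_sq (by linarith) (norm_nonneg p)
    simp only [F, stereoPlane_invStereo, WithLp.ofLp_add, WithLp.ofLp_smul]
    rw [h]
    exact add_sub_cancel _ _
  have hFN (t : ℝ) : F t =ᶠ[𝓝 northPole] H₀ := by
    have : ∀ᶠ y : E3 in 𝓝 northPole, 1 - d / 2 < y 2 :=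
      (EuclideanSpace.proj (𝕜 := ℝ) (2 : Fin 3)).continuous.continuousAt.eventually
        (lt_mem_nhds (by simp [northPole, hd0]))
    filter_upwards [this] with y hy
    simp [F, hη0 hy]
  have hI : ∀ t ∈ Icc (0 : ℝ) 1, SphereImm (F t) := fun t ht => by
    refine sphereImm_of_planeImmersion (hFt t) ?_ fun v hv h => ?_
    · simp only [hFσ]
      exact hGI t ht
    · rw [(hFN t).fderiv_eq] at h
      exact hI₀ _ northPole_mem v hv h
  have ends {t : ℝ} {H : E3 → E3} (hH : ∀ p, G (t, p) = (H (invStereo p)).ofLp)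
      (hN : F t northPole = H northPole) : (fun x : S2 => F t x) = fun x : S2 => H x := by
    funext x
    by_cases hx : (x : E3) = northPole
    · rw [hx, hN]
    · obtain ⟨p, hp⟩ := exists_invStereo x.2 hx
      rw [← hp]
      exact WithLp.ofLp_injective 2 ((hFσ t p).trans (hH p))
  have := RegularlyHomotopic.of_ambient (hF.of_le (by simp)) hI
  rwa [ends hG0 (hFN 0).eq_of_nhds, ends hG1 ((hFN 1).eq_of_nhds.trans heq.eq_of_nhds)] at this

end

/-- **Smale's theorem**: any two `C²` immersions of the 2-sphere into `ℝ³` are regularly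
homotopic (equivalently, the space of immersions `Imm(S², ℝ³)` is path-connected). -/
theorem smale_immersions_sphere_regularly_homotopic (f₀ f₁ : S2 → E3)
    (h₀ : ContMDiff (𝓡 2) 𝓘(ℝ, E3) 2 f₀) (h₁ : ContMDiff (𝓡 2) 𝓘(ℝ, E3) 2 f₁)
    (h₀' : ∀ x : S2, Injective (mfderiv (𝓡 2) 𝓘(ℝ, E3) f₀ x))
    (h₁' : ∀ x : S2, Injective (mfderiv (𝓡 2) 𝓘(ℝ, E3) f₁ x)) :
    RegularlyHomotopic f₀ f₁ := by
  obtain ⟨H₀, c₀, M₀, hP₀, hH₀⟩ := exists_polarForm (h₀.of_le (by norm_num)) h₀'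
  obtain ⟨H₁, c₁, M₁, hP₁, hH₁⟩ := exists_polarForm (h₁.of_le (by norm_num)) h₁'
  obtain ⟨H, hH, hHI, hHeq, hHH⟩ := hP₀.exists_eventuallyEq hP₁
  exact ((hH₀.trans hHH).trans (regularlyHomotopic_of_eventuallyEq hH hP₁.contDiff hHI
    hP₁.sphereImm hHeq)).trans hH₁.symm

end
end

section
/- Sphere eversion: the standard inclusion f₀ : S² ↪ ℝ³ and its antipode f₁ = −f₀ are regularly homotopic, i.e. there is a continuous family (f_t), t ∈ [0,1], of immersions S² → ℝ³ with f_0 the inclusion and f_1 = −f_0. -/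
open Metric Function
open scoped Manifold

noncomputable section

lemma tangentMap_comp_coe {g : E3 → E3} (hg : ∀ x : S2, DifferentiableAt ℝ g x)
    (w : TangentBundle (𝓡 2) S2) :
    tangentMap (𝓡 2) 𝓘(ℝ, E3) (fun x : S2 => g x) w =
      ⟨g w.1, fderiv ℝ g w.1 (mfderiv (𝓡 2) 𝓘(ℝ, E3) ((↑) : S2 → E3) w.1 w.2)⟩ := by
  have h := mfderiv_comp (I := 𝓡 2) (I' := 𝓘(ℝ, E3)) (I'' := 𝓘(ℝ, E3)) w.1 (g := g)
    (f := ((↑) : S2 → E3)) (hg w.1).mdifferentiableAt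
    ((contMDiff_coe_sphere (n := 2) (m := 1)).mdifferentiableAt one_ne_zero)
  have h' : mfderiv (𝓡 2) 𝓘(ℝ, E3) (fun x : S2 => g x) w.1 =
    mfderiv (𝓡 2) 𝓘(ℝ, E3) (g ∘ ((↑) : S2 → E3)) w.1 := rfl
  unfold tangentMap
  rw [h', h, mfderiv_eq_fderiv]
  rfl

/-- A path in a family of maps of space that are jointly `C¹` and immersive along the sphere gives a
regular homotopy. -/
lemma regularlyHomotopic_of_contDiffAt {A : Type*} [NormedAddCommGroup A] [NormedSpace ℝ A]
    (f : A × E3 → E3) (γ : ℝ → A) (hγ : Continuous γ)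
    (hf : ∀ s, ∀ x : E3, ‖x‖ = 1 → ContDiffAt ℝ 1 f (γ s, x))
    (himm : ∀ s, ∀ x v : E3, ‖x‖ = 1 → inner ℝ x v = 0 →
      fderiv ℝ (fun y => f (γ s, y)) x v = 0 → v = 0) :
    RegularlyHomotopic (fun x => f (γ 0, x)) (fun x => f (γ 1, x)) := by
  have hnorm : ∀ x : S2, ‖(x : E3)‖ = 1 := fun x => by simp
  have hslice : ∀ s, ∀ x : E3, ‖x‖ = 1 → ContDiffAt ℝ 1 (fun y => f (γ s, y)) x :=
    fun s x hx => (hf s x hx).comp x (by fun_prop)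
  have hdiff : ∀ s, ∀ x : S2, DifferentiableAt ℝ (fun y => f (γ s, y)) x :=
    fun s x => (hslice s x (hnorm x)).differentiableAt one_ne_zero
  have hcoe : ContMDiff (𝓡 2) 𝓘(ℝ, E3) 1 ((↑) : S2 → E3) := contMDiff_coe_sphere
  refine ⟨fun s x => f (γ s, x), fun s _ => ⟨fun x => ?_, fun x => ?_⟩, rfl, rfl, ?_⟩
  · exact (hslice s x (hnorm x)).contMDiffAt.comp x (hcoe x)
  · rw [injective_iff_map_eq_zero]
    intro v hv
    have h := tangentMap_comp_coe (hdiff s) ⟨x, v⟩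
    have h2 : fderiv ℝ (fun y => f (γ s, y)) x
        (mfderiv (𝓡 2) 𝓘(ℝ, E3) ((↑) : S2 → E3) x v) = 0 := by
      have h3 := congrArg (fun w => (tangentBundleModelSpaceHomeomorph 𝓘(ℝ, E3) w).2) h
      have h4 : mfderiv (𝓡 2) 𝓘(ℝ, E3) (fun x : S2 => f (γ s, x)) x v = fderiv ℝ (fun y => f (γ s, y)) x
        (mfderiv (𝓡 2) 𝓘(ℝ, E3) ((↑) : S2 → E3) x v) := h3
      exact h4.symm.trans hv
    have hperp : inner ℝ (x : E3) (mfderiv (𝓡 2) 𝓘(ℝ, E3) ((↑) : S2 → E3) x v : E3) = 0 := by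
      have : (mfderiv (𝓡 2) 𝓘(ℝ, E3) ((↑) : S2 → E3) x v : E3) ∈ (ℝ ∙ (x : E3))ᗮ := by
        rw [← range_mvfderiv_subtypeVal (n := 2) x]
        exact ⟨v, rfl⟩
      exact (Submodule.mem_orthogonal_singleton_iff_inner_right).1 this
    have h0 := himm s x _ (hnorm x) hperp h2
    exact (injective_iff_map_eq_zero _).1 (injective_mvfderiv_subtypeVal_sphere (n := 2) x) v h0
  · rw [← (tangentBundleModelSpaceHomeomorph 𝓘(ℝ, E3)).comp_continuous_iff]
    have hE : Continuous (fun q : ℝ × TangentBundle (𝓡 2) S2 =>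
        (tangentBundleModelSpaceHomeomorph 𝓘(ℝ, E3))
          (tangentMap (𝓡 2) 𝓘(ℝ, E3) ((↑) : S2 → E3) q.2)) :=
      (Homeomorph.continuous _).comp ((hcoe.continuous_tangentMap le_rfl).comp continuous_snd)
    have hv : Continuous (fun q : ℝ × TangentBundle (𝓡 2) S2 =>
        (mfderiv (𝓡 2) 𝓘(ℝ, E3) ((↑) : S2 → E3) q.2.1 q.2.2 : E3)) := continuous_snd.comp hE
    have hx : Continuous (fun q : ℝ × TangentBundle (𝓡 2) S2 => (γ q.1, (q.2.1 : E3))) :=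
      (hγ.comp continuous_fst).prodMk (continuous_fst.comp hE)
    have hfd : ∀ s, ∀ x : S2, fderiv ℝ (fun y => f (γ s, y)) x =
        (fderiv ℝ f (γ s, (x : E3))).comp (ContinuousLinearMap.inr ℝ A E3) := fun s x =>
      (((hf s x (hnorm x)).differentiableAt one_ne_zero).hasFDerivAt.comp (x : E3)
        (hasFDerivAt_prodMk_right (γ s) (x : E3))).fderiv
    have hD : Continuous (fun q : ℝ × TangentBundle (𝓡 2) S2 =>
        fderiv ℝ f (γ q.1, (q.2.1 : E3))) := by
      rw [continuous_iff_continuousAt]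
      intro q
      have h1 : ContinuousAt (fderiv ℝ f) (γ q.1, (q.2.1 : E3)) :=
        ((hf q.1 q.2.1 (hnorm _)).fderiv_right (m := 0) (by norm_num)).continuousAt
      exact ContinuousAt.comp (f := fun q : ℝ × TangentBundle (𝓡 2) S2 => (γ q.1, (q.2.1 : E3)))
        h1 hx.continuousAt
    have hF : Continuous (fun q : ℝ × TangentBundle (𝓡 2) S2 => f (γ q.1, (q.2.1 : E3))) := by
      rw [continuous_iff_continuousAt]
      intro q
      exact ContinuousAt.comp (f := fun q : ℝ × TangentBundle (𝓡 2) S2 => (γ q.1, (q.2.1 : E3)))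
        (hf q.1 q.2.1 (hnorm _)).continuousAt hx.continuousAt
    have hL : Continuous (fun q : ℝ × TangentBundle (𝓡 2) S2 =>
        fderiv ℝ f (γ q.1, (q.2.1 : E3)) (0, (mfderiv (𝓡 2) 𝓘(ℝ, E3) ((↑) : S2 → E3) q.2.1 q.2.2 : E3))) :=
      hD.clm_apply (continuous_const.prodMk hv)
    refine (hF.prodMk hL).congr fun q => ?_
    have h := tangentMap_comp_coe (hdiff q.1) q.2
    rw [hfd] at h
    exact (congrArg (tangentBundleModelSpaceHomeomorph 𝓘(ℝ, E3)) h).symm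

/-! The eversion passes through the ruled cylinders
`(φ, h) ↦ (t e_r + p (sin φ, cos φ) + h e_φ, h sin 2φ - (t / 2) cos 2φ - t h)`, where
`e_r = (cos φ, sin φ)`, `e_φ = (-sin φ, cos φ)` and `p = 1 - |t|`, with `t` from `-1` to `1`
(A. Bednorz and W. Bednorz, *Analytic sphere eversion using ruled surfaces*). With
`h = c / (a ^ 2 + b ^ 2)` at the point `(a, b, c)` of the sphere, a diffeomorphism from space to the
complement of a ray closes the two ends of the cylinder at the poles. For `t = ±1` the surface
is deformed to a surface of revolution, and then to a round sphere.
-/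

namespace SphereEversion

/-- The squared distance to the vertical axis. -/
def sqRad (a b : ℝ) : ℝ := a ^ 2 + b ^ 2

/-- The first horizontal coordinate of the ruled cylinder, times `sqRad a b ^ (3 / 2)`. -/
def planar₁ (t p a b c : ℝ) : ℝ := sqRad a b * (t * a + p * b) - c * b

/-- The second horizontal coordinate of the ruled cylinder, times `sqRad a b ^ (3 / 2)`. -/
def planar₂ (t p a b c : ℝ) : ℝ := sqRad a b * (t * b + p * a) + c * a

/-- The squared radius of the ruled cylinder, times `sqRad a b ^ 2`. -/
def spread (t p a b c : ℝ) : ℝ :=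
  (t * sqRad a b + 2 * p * a * b) ^ 2 + (c + p * (a ^ 2 - b ^ 2)) ^ 2

/-- The positive root `E` of `E ^ 2 = sqRad a b * E + spread t p a b c`. -/
def scale (t p a b c : ℝ) : ℝ :=
  (sqRad a b + √(sqRad a b ^ 2 + 4 * spread t p a b c)) / 2

/-- The vertical coordinate of the ruled cylinder, times `sqRad a b ^ 2`. -/
def height (t a b c : ℝ) : ℝ :=
  2 * a * b * c - t / 2 * (a ^ 2 - b ^ 2) * sqRad a b - t * c * sqRad a b

/-- The logarithm of the norm of the image point. -/
def logNorm (t p l a b c : ℝ) : ℝ :=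
  (1 - l) * (height t a b c / scale t p a b c ^ 2) + l / 2 * Real.log (5 - 4 * t * c)

/-- The first coordinate of a vector in the direction of the image point. -/
def dir₁ (t p m a b c : ℝ) : ℝ := (1 - m) * (2 * planar₁ t p a b c) + m * (t * a)

/-- The second coordinate of a vector in the direction of the image point. -/
def dir₂ (t p m a b c : ℝ) : ℝ := (1 - m) * (2 * planar₂ t p a b c) + m * (t * b)

/-- The third coordinate of a vector in the direction of the image point. -/
def dir₃ (t p m a b c : ℝ) : ℝ :=
  (1 - m) * (√(scale t p a b c) * (scale t p a b c - 2 * sqRad a b)) + m * (2 - t * c)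

/-- The squared norm of the direction vector. -/
def dirSq (t p m a b c : ℝ) : ℝ :=
  dir₁ t p m a b c ^ 2 + dir₂ t p m a b c ^ 2 + dir₃ t p m a b c ^ 2

/-- The ratio of the image point to the direction vector. -/
def factor (t p l m a b c : ℝ) : ℝ :=
  Real.exp (logNorm t p l a b c) / √(dirSq t p m a b c)

lemma planar_sq (t p a b c : ℝ) :
    planar₁ t p a b c ^ 2 + planar₂ t p a b c ^ 2 = sqRad a b * spread t p a b c := by
  unfold planar₁ planar₂ spread sqRad; ring

lemma sqRad_nonneg (a b : ℝ) : 0 ≤ sqRad a b := by unfold sqRad; positivity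

lemma spread_nonneg (t p a b c : ℝ) : 0 ≤ spread t p a b c := by unfold spread; positivity

lemma radicand_pos {a b c : ℝ} (t p : ℝ) (h : 0 < sqRad a b ∨ c ≠ 0) :
    0 < sqRad a b ^ 2 + 4 * spread t p a b c := by
  have hW := spread_nonneg t p a b c
  rcases (sqRad_nonneg a b).lt_or_eq with hq | hq
  · positivity
  · have hc : c ≠ 0 := h.resolve_left (by simp [← hq])
    have ha : a = 0 := by unfold sqRad at hq; nlinarith
    have hb : b = 0 := by unfold sqRad at hq; nlinarith
    subst ha hb
    have : 0 < c ^ 2 := by positivity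
    simp [spread, sqRad, this]

lemma scale_pos {a b c : ℝ} (t p : ℝ) (h : 0 < sqRad a b ∨ c ≠ 0) : 0 < scale t p a b c := by
  have := Real.sqrt_pos.2 (radicand_pos t p h)
  have := sqRad_nonneg a b
  unfold scale; positivity

lemma scale_sq (t p a b c : ℝ) :
    scale t p a b c ^ 2 = sqRad a b * scale t p a b c + spread t p a b c := by
  have hW := spread_nonneg t p a b c
  have := Real.sq_sqrt (show 0 ≤ sqRad a b ^ 2 + 4 * spread t p a b c by positivity)
  unfold scale; linarith

lemma dirSq_zero {a b c : ℝ} (t p : ℝ) (h : 0 < sqRad a b ∨ c ≠ 0) :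
    dirSq t p 0 a b c = scale t p a b c ^ 3 := by
  have h1 := planar_sq t p a b c
  have h2 := scale_sq t p a b c
  have h3 := Real.sq_sqrt (scale_pos t p h).le
  unfold dirSq dir₁ dir₂ dir₃
  generalize scale t p a b c = E at *
  have hW : spread t p a b c = E ^ 2 - sqRad a b * E := by linarith
  rw [hW] at h1
  linear_combination 4 * h1 + (E - 2 * sqRad a b) ^ 2 * h3

lemma dirSq_pos {t p m a b c : ℝ} (hs : a ^ 2 + b ^ 2 + c ^ 2 = 1) (hm : m ∈ Set.Icc (0 : ℝ) 1)
    (htp : m ≠ 0 → t ^ 2 = 1 ∧ p = 0) : 0 < dirSq t p m a b c := by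
  have hqc : 0 < sqRad a b ∨ c ≠ 0 := by
    by_contra! h
    have : a ^ 2 + b ^ 2 ≤ 0 := h.1
    nlinarith [h.2]
  by_cases hm0 : m = 0
  · subst hm0
    rw [dirSq_zero t p hqc]
    exact pow_pos (scale_pos t p hqc) 3
  obtain ⟨ht, rfl⟩ := htp hm0
  have hmpos : 0 < m := lt_of_le_of_ne hm.1 (Ne.symm hm0)
  have hm1 : 0 ≤ 1 - m := by linarith [hm.2]
  rcases (sqRad_nonneg a b).lt_or_eq with hq | hq
  · have key : dir₁ t 0 m a b c ^ 2 + dir₂ t 0 m a b c ^ 2 =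
        sqRad a b * ((2 * (1 - m) * sqRad a b + m) ^ 2 * t ^ 2 + (2 * (1 - m) * c) ^ 2) := by
      unfold dir₁ dir₂ planar₁ planar₂ sqRad; ring
    unfold dirSq
    rw [key, ht]
    positivity
  · have ha : a = 0 := by unfold sqRad at hq; nlinarith
    have hb : b = 0 := by unfold sqRad at hq; nlinarith
    have hE := scale_pos t 0 hqc
    have htc : (t * c) ^ 2 = 1 := by rw [mul_pow, ht]; nlinarith
    have : 0 < dir₃ t 0 m a b c := by
      unfold dir₃
      rw [← hq, mul_zero, sub_zero]
      have : 0 < 2 - t * c := by nlinarith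
      positivity
    unfold dirSq
    positivity

lemma arg_log_pos {t a b c : ℝ} (hs : a ^ 2 + b ^ 2 + c ^ 2 = 1) (ht : |t| ≤ 1) :
    0 < 5 - 4 * t * c := by
  have h1 : t ^ 2 ≤ 1 := by rw [← sq_abs]; nlinarith [abs_nonneg t]
  nlinarith [sq_nonneg (t - c), sq_nonneg a, sq_nonneg b]

/-- The logarithm of the norm. -/
def invLog (X : ℝ × ℝ × ℝ) : ℝ := Real.log √(X.1 ^ 2 + X.2.1 ^ 2 + X.2.2 ^ 2)

/-- The denominator of the stereographic projection from the vertical axis. -/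
def gap (X : ℝ × ℝ × ℝ) : ℝ := √(X.1 ^ 2 + X.2.1 ^ 2 + X.2.2 ^ 2) - X.2.2

/-- One plus the squared norm of the stereographic projection. -/
def invRad (X : ℝ × ℝ × ℝ) : ℝ := 1 + (X.1 / gap X) ^ 2 + (X.2.1 / gap X) ^ 2

/-- Recovers the first coordinate of the ruled cylinder. -/
def inv₁ (X : ℝ × ℝ × ℝ) : ℝ := X.1 / gap X * √(invRad X)

/-- Recovers the second coordinate of the ruled cylinder. -/
def inv₂ (X : ℝ × ℝ × ℝ) : ℝ := X.2.1 / gap X * √(invRad X)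

/-- Recovers the third coordinate of the ruled cylinder. -/
def inv₃ (X : ℝ × ℝ × ℝ) : ℝ := invLog X * invRad X ^ 2

lemma differentiableAt_inv {X : ℝ × ℝ × ℝ} (h : 0 < X.1 ^ 2 + X.2.1 ^ 2 + X.2.2 ^ 2)
    (hg : gap X ≠ 0) :
    DifferentiableAt ℝ invLog X ∧ DifferentiableAt ℝ inv₁ X ∧ DifferentiableAt ℝ inv₂ X ∧
      DifferentiableAt ℝ inv₃ X := by
  have h0 := h.ne'
  have hs := (Real.sqrt_pos.2 h).ne'
  have hlog : DifferentiableAt ℝ invLog X := by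
    unfold invLog; fun_prop (disch := assumption)
  have hgap : DifferentiableAt ℝ gap X := by
    unfold gap; fun_prop (disch := assumption)
  have hrad : DifferentiableAt ℝ invRad X := by
    unfold invRad; fun_prop (disch := assumption)
  have hr : invRad X ≠ 0 := by unfold invRad; positivity
  refine ⟨hlog, ?_, ?_, ?_⟩
  · unfold inv₁; fun_prop (disch := assumption)
  · unfold inv₂; fun_prop (disch := assumption)
  · unfold inv₃; fun_prop (disch := assumption)

/-- The image point (reflected in the horizontal plane and not yet translated). -/
def image (t p l m a b c : ℝ) : ℝ × ℝ × ℝ :=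
  (factor t p l m a b c * dir₁ t p m a b c, factor t p l m a b c * dir₂ t p m a b c,
    factor t p l m a b c * dir₃ t p m a b c)

lemma image_sq {t p l m a b c : ℝ} (h : 0 < dirSq t p m a b c) :
    (image t p l m a b c).1 ^ 2 + (image t p l m a b c).2.1 ^ 2 + (image t p l m a b c).2.2 ^ 2 =
      Real.exp (logNorm t p l a b c) ^ 2 := by
  have h2 : factor t p l m a b c ^ 2 * dirSq t p m a b c = Real.exp (logNorm t p l a b c) ^ 2 := by
    unfold factor
    rw [div_pow, Real.sq_sqrt h.le]
    field_simp
  rw [← h2]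
  unfold image dirSq
  ring

lemma inv_image {t p l a b c : ℝ} (hq : 0 < sqRad a b) :
    0 < gap (image t p l 0 a b c) ∧
    invLog (image t p l 0 a b c) = logNorm t p l a b c ∧
    inv₁ (image t p l 0 a b c) = planar₁ t p a b c / (sqRad a b * √(sqRad a b)) ∧
    inv₂ (image t p l 0 a b c) = planar₂ t p a b c / (sqRad a b * √(sqRad a b)) ∧
    inv₃ (image t p l 0 a b c) =
      logNorm t p l a b c * scale t p a b c ^ 2 / sqRad a b ^ 2 := by
  have hE := scale_pos (c := c) t p (.inl hq)
  have hd := dirSq_zero (c := c) t p (.inl hq)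
  have hdp : 0 < dirSq t p 0 a b c := by rw [hd]; positivity
  have hsE := Real.sqrt_pos.2 hE
  have hR : √(dirSq t p 0 a b c) = scale t p a b c * √(scale t p a b c) := by
    rw [hd, show scale t p a b c ^ 3 = scale t p a b c ^ 2 * scale t p a b c by ring,
      Real.sqrt_mul (by positivity), Real.sqrt_sq hE.le]
  have hn : √((image t p l 0 a b c).1 ^ 2 + (image t p l 0 a b c).2.1 ^ 2 +
      (image t p l 0 a b c).2.2 ^ 2) = Real.exp (logNorm t p l a b c) := by
    rw [image_sq hdp, Real.sqrt_sq (Real.exp_pos _).le]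
  have hf : factor t p l 0 a b c =
      Real.exp (logNorm t p l a b c) / (scale t p a b c * √(scale t p a b c)) := by
    rw [factor, hR]
  have hfp : 0 < factor t p l 0 a b c := by rw [hf]; positivity
  have hgap : gap (image t p l 0 a b c) =
      factor t p l 0 a b c * (2 * sqRad a b * √(scale t p a b c)) := by
    have : Real.exp (logNorm t p l a b c) =
        factor t p l 0 a b c * (scale t p a b c * √(scale t p a b c)) := by
      rw [hf]; field_simp
    rw [gap, hn, this]
    unfold image dir₃
    ring
  have hu₁ : (image t p l 0 a b c).1 / gap (image t p l 0 a b c) =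
      planar₁ t p a b c / (sqRad a b * √(scale t p a b c)) := by
    rw [hgap]; simp only [image, dir₁]; field_simp; ring
  have hu₂ : (image t p l 0 a b c).2.1 / gap (image t p l 0 a b c) =
      planar₂ t p a b c / (sqRad a b * √(scale t p a b c)) := by
    rw [hgap]; simp only [image, dir₂]; field_simp; ring
  have hrad : invRad (image t p l 0 a b c) = scale t p a b c / sqRad a b := by
    rw [invRad, hu₁, hu₂]
    have h1 := planar_sq t p a b c
    have h2 := scale_sq t p a b c
    have h3 := Real.sq_sqrt hE.le
    field_simp
    rw [h3]
    linear_combination h1 - sqRad a b * h2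
  refine ⟨by rw [hgap]; positivity, by rw [invLog, hn, Real.log_exp], ?_, ?_, ?_⟩
  · rw [inv₁, hu₁, hrad, Real.sqrt_div hE.le]; field_simp
  · rw [inv₂, hu₂, hrad, Real.sqrt_div hE.le]; field_simp
  · rw [inv₃, hrad, invLog, hn, Real.log_exp]; field_simp

lemma hasDerivAt_comp_zero {L : ℝ × ℝ × ℝ → ℝ} {X : ℝ → ℝ × ℝ × ℝ} (hX : HasDerivAt X 0 0)
    (hL : DifferentiableAt ℝ L (X 0)) : HasDerivAt (fun s => L (X s)) 0 0 := by
  have h := hL.hasFDerivAt.comp_hasDerivAt 0 hX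
  rw [map_zero] at h
  exact h

lemma hasDerivAt_line (a α : ℝ) : HasDerivAt (fun s : ℝ => a + s * α) α 0 := by
  simpa using ((hasDerivAt_id (0 : ℝ)).mul_const α).const_add a

lemma hasDerivAt_sqRad (a b α β : ℝ) :
    HasDerivAt (fun s : ℝ => sqRad (a + s * α) (b + s * β)) (2 * (a * α + b * β)) 0 := by
  refine (((hasDerivAt_line a α).fun_pow 2).fun_add
    ((hasDerivAt_line b β).fun_pow 2)).congr_deriv ?_
  simp; ring

lemma hasDerivAt_unit {a b : ℝ} (α β : ℝ) (hq : 0 < sqRad a b) :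
    HasDerivAt (fun s : ℝ => (a + s * α) / √(sqRad (a + s * α) (b + s * β)))
      (-((a * β - b * α) / sqRad a b) * (b / √(sqRad a b))) 0 ∧
    HasDerivAt (fun s : ℝ => (b + s * β) / √(sqRad (a + s * α) (b + s * β)))
      ((a * β - b * α) / sqRad a b * (a / √(sqRad a b))) 0 := by
  have hr := Real.sqrt_pos.2 hq
  have hrr : √(sqRad a b) ^ 2 = a ^ 2 + b ^ 2 := Real.sq_sqrt hq.le
  have hsq := (hasDerivAt_sqRad a b α β).sqrt (by simpa using hq.ne')
  simp only [zero_mul, add_zero] at hsq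
  constructor
  · refine ((hasDerivAt_line a α).fun_div hsq (by simpa using hr.ne')).congr_deriv ?_
    simp only [zero_mul, add_zero]
    rw [← Real.sq_sqrt hq.le, Real.sqrt_sq hr.le]
    field_simp
    rw [hrr]
    ring
  · refine ((hasDerivAt_line b β).fun_div hsq (by simpa using hr.ne')).congr_deriv ?_
    simp only [zero_mul, add_zero]
    rw [← Real.sq_sqrt hq.le, Real.sqrt_sq hr.le]
    field_simp
    rw [hrr]
    ring

lemma hasDerivAt_ratio {a b : ℝ} (c α β γ : ℝ) (hq : 0 < sqRad a b) :
    HasDerivAt (fun s : ℝ => (c + s * γ) / sqRad (a + s * α) (b + s * β))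
      ((γ * sqRad a b - c * (2 * (a * α + b * β))) / sqRad a b ^ 2) 0 := by
  simpa using (hasDerivAt_line c γ).fun_div (hasDerivAt_sqRad a b α β) (by simpa using hq.ne')

/-- The horizontal part of the ruled cylinder in terms of the unit vector `e_r` and of `h`. -/
lemma planar_eq {t p a b c : ℝ} (hq : 0 < sqRad a b) :
    planar₁ t p a b c / (sqRad a b * √(sqRad a b)) =
      t * (a / √(sqRad a b)) + p * (b / √(sqRad a b)) - c / sqRad a b * (b / √(sqRad a b)) ∧
    planar₂ t p a b c / (sqRad a b * √(sqRad a b)) =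
      t * (b / √(sqRad a b)) + p * (a / √(sqRad a b)) + c / sqRad a b * (a / √(sqRad a b)) := by
  have hr := Real.sqrt_pos.2 hq
  constructor
  · unfold planar₁; field_simp
  · unfold planar₂; field_simp

/-- The vertical part of the ruled cylinder in terms of the unit vector `e_r` and of `h`. -/
lemma height_eq {t a b c : ℝ} (hq : 0 < sqRad a b) :
    height t a b c / sqRad a b ^ 2 =
      2 * (c / sqRad a b) * (a / √(sqRad a b)) * (b / √(sqRad a b)) -
      t / 2 * ((a / √(sqRad a b)) ^ 2 - (b / √(sqRad a b)) ^ 2) - t * (c / sqRad a b) := by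
  have hr := Real.sqrt_pos.2 hq
  have hrr := Real.sq_sqrt hq.le
  unfold height
  rw [div_pow, div_pow, hrr]
  field_simp
  rw [hrr]
  field_simp

/-- The algebraic core: the ruled cylinder is immersed. -/
lemma cylinder_core {t x y h ω η : ℝ} (ht : |t| ≤ 1) (hxy : x ^ 2 + y ^ 2 = 1)
    (h₁ : t * (-ω * y) + (1 - |t|) * (ω * x) - (η * y + h * (ω * x)) = 0)
    (h₂ : t * (ω * x) + (1 - |t|) * (-ω * y) + (η * x + h * (-ω * y)) = 0)
    (h₃ : 2 * (η * x * y + h * (-ω * y) * y + h * x * (ω * x)) -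
      t / 2 * (2 * x * (-ω * y) - 2 * y * (ω * x)) - t * η = 0) : ω = 0 ∧ η = 0 := by
  set p := 1 - |t| with hp
  have hr : ω * (p * (x ^ 2 - y ^ 2) - h) = 0 := by
    linear_combination x * h₁ + y * h₂ + ω * h * hxy
  have hφ : ω * (t - p * (2 * x * y)) + η = 0 := by
    linear_combination x * h₂ - y * h₁ - (ω * t + η) * hxy
  by_cases hω : ω = 0
  · subst hω
    exact ⟨rfl, by simpa using hφ⟩
  exfalso
  have hh : h = p * (x ^ 2 - y ^ 2) := by
    have := (mul_eq_zero.1 hr).resolve_left hω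
    linarith
  have hη : η = -(ω * (t - p * (2 * x * y))) := by linarith
  rw [hh, hη] at h₃
  have key : ω * (p * (2 * (x ^ 2 - y ^ 2) ^ 2 + (2 * x * y) ^ 2 - t * (2 * x * y)) + t ^ 2) = 0 := by
    linear_combination h₃
  have hz := (mul_eq_zero.1 key).resolve_left hω
  have hp0 : 0 ≤ p := by linarith
  have hCS : (x ^ 2 - y ^ 2) ^ 2 + (2 * x * y) ^ 2 = 1 := by
    linear_combination (x ^ 2 + y ^ 2 + 1) * hxy
  have hS : |2 * x * y| ≤ 1 := by
    rw [abs_le]; constructor <;> nlinarith [sq_nonneg (x + y), sq_nonneg (x - y)]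
  have hts : t * (2 * x * y) ≤ |t| := by
    calc t * (2 * x * y) ≤ |t * (2 * x * y)| := le_abs_self _
      _ = |t| * |2 * x * y| := abs_mul _ _
      _ ≤ |t| * 1 := by gcongr
      _ = |t| := mul_one _
  have hb : p ≤ 2 * (x ^ 2 - y ^ 2) ^ 2 + (2 * x * y) ^ 2 - t * (2 * x * y) := by
    nlinarith [sq_nonneg (x ^ 2 - y ^ 2)]
  have : p * p + t ^ 2 ≤ 0 := by
    rw [← hz]; gcongr
  have ht0 : t = 0 := by nlinarith
  rw [ht0, abs_zero] at hp
  rw [hp, ht0] at this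
  norm_num at this

/-- A tangent vector at a point off the axis is determined by its angular velocity and by the
velocity of the parameter `c / (a² + b²)` along the rulings. -/
lemma tangent_eq_zero {a b c α β γ : ℝ} (hq : 0 < sqRad a b) (hv : a * α + b * β + c * γ = 0)
    (hω : (a * β - b * α) / sqRad a b = 0)
    (hη : (γ * sqRad a b - c * (2 * (a * α + b * β))) / sqRad a b ^ 2 = 0) :
    α = 0 ∧ β = 0 ∧ γ = 0 := by
  have h1 : a * β - b * α = 0 := by simpa [hq.ne'] using hω
  have h2 : γ * sqRad a b - c * (2 * (a * α + b * β)) = 0 := by simpa [hq.ne'] using hη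
  have h3 : γ * (sqRad a b + 2 * c ^ 2) = 0 := by linear_combination h2 + 2 * c * hv
  have hγ : γ = 0 := (mul_eq_zero.1 h3).resolve_right (by positivity)
  subst hγ
  have h4 : a * α + b * β = 0 := by linarith
  have ha : sqRad a b * α = 0 := by unfold sqRad; linear_combination a * h4 - b * h1
  have hb : sqRad a b * β = 0 := by unfold sqRad; linear_combination b * h4 + a * h1
  exact ⟨(mul_eq_zero.1 ha).resolve_left hq.ne', (mul_eq_zero.1 hb).resolve_left hq.ne', rfl⟩

lemma eventually_sqRad_pos {a b : ℝ} (α β : ℝ) (hq : 0 < sqRad a b) :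
    ∀ᶠ s in nhds (0 : ℝ), 0 < sqRad (a + s * α) (b + s * β) :=
  (hasDerivAt_sqRad a b α β).continuousAt.eventually (lt_mem_nhds (by simpa using hq))

/-- During the eversion proper (before the final unfolding), a critical direction is critical for
the data of the ruled cylinder. -/
lemma hasDerivAt_of_image {t p l a b c α β γ : ℝ} (hq : 0 < sqRad a b)
    (hX : HasDerivAt (fun s : ℝ => image t p l 0 (a + s * α) (b + s * β) (c + s * γ)) 0 0) :
    HasDerivAt (fun s : ℝ => logNorm t p l (a + s * α) (b + s * β) (c + s * γ)) 0 0 ∧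
    HasDerivAt (fun s : ℝ => logNorm t p l (a + s * α) (b + s * β) (c + s * γ) *
      scale t p (a + s * α) (b + s * β) (c + s * γ) ^ 2 /
        sqRad (a + s * α) (b + s * β) ^ 2) 0 0 ∧
    t * (-((a * β - b * α) / sqRad a b) * (b / √(sqRad a b))) +
      p * ((a * β - b * α) / sqRad a b * (a / √(sqRad a b))) -
      ((γ * sqRad a b - c * (2 * (a * α + b * β))) / sqRad a b ^ 2 * (b / √(sqRad a b)) +
        c / sqRad a b * ((a * β - b * α) / sqRad a b * (a / √(sqRad a b)))) = 0 ∧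
    t * ((a * β - b * α) / sqRad a b * (a / √(sqRad a b))) +
      p * (-((a * β - b * α) / sqRad a b) * (b / √(sqRad a b))) +
      ((γ * sqRad a b - c * (2 * (a * α + b * β))) / sqRad a b ^ 2 * (a / √(sqRad a b)) +
        c / sqRad a b * (-((a * β - b * α) / sqRad a b) * (b / √(sqRad a b)))) = 0 := by
  have hqc : 0 < sqRad a b ∨ c ≠ 0 := .inl hq
  have hdp : 0 < dirSq t p 0 a b c := by
    rw [dirSq_zero t p hqc]; exact pow_pos (scale_pos t p hqc) 3
  obtain ⟨hg, -⟩ := inv_image (t := t) (p := p) (l := l) (c := c) hq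
  have hsq := image_sq (l := l) hdp
  obtain ⟨d0, d1, d2, d3⟩ := differentiableAt_inv (X := image t p l 0 a b c)
    (by rw [hsq]; positivity) hg.ne'
  have hev := eventually_sqRad_pos α β hq
  have k0 := hasDerivAt_comp_zero hX (L := invLog) (by simpa using d0)
  have k1 := hasDerivAt_comp_zero hX (L := inv₁) (by simpa using d1)
  have k2 := hasDerivAt_comp_zero hX (L := inv₂) (by simpa using d2)
  have k3 := hasDerivAt_comp_zero hX (L := inv₃) (by simpa using d3)
  obtain ⟨he₁, he₂⟩ := hasDerivAt_unit α β hq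
  have hh := hasDerivAt_ratio c α β γ hq
  refine ⟨k0.congr_of_eventuallyEq ?_, k3.congr_of_eventuallyEq ?_, ?_, ?_⟩
  · filter_upwards [hev] with s hs using (inv_image hs).2.1.symm
  · filter_upwards [hev] with s hs using (inv_image hs).2.2.2.2.symm
  · have := ((he₁.const_mul t).fun_add (he₂.const_mul p)).fun_sub (hh.fun_mul he₂)
    have h' := this.unique (k1.congr_of_eventuallyEq (by
      filter_upwards [hev] with s hs
      rw [(inv_image hs).2.2.1, (planar_eq hs).1]))
    simpa using h'
  · have := ((he₂.const_mul t).fun_add (he₁.const_mul p)).fun_add (hh.fun_mul he₁)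
    have h' := this.unique (k2.congr_of_eventuallyEq (by
      filter_upwards [hev] with s hs
      rw [(inv_image hs).2.2.2.1, (planar_eq hs).2]))
    simpa using h'

section Smooth

variable {B : Type*} [NormedAddCommGroup B] [NormedSpace ℝ B] {t p l m a b c : B → ℝ} {y : B}

lemma contDiffAt_sqRad (ha : ContDiffAt ℝ 1 a y) (hb : ContDiffAt ℝ 1 b y) :
    ContDiffAt ℝ 1 (fun x => sqRad (a x) (b x)) y := by
  unfold sqRad; fun_prop

lemma contDiffAt_scale (ht : ContDiffAt ℝ 1 t y) (hp : ContDiffAt ℝ 1 p y)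
    (ha : ContDiffAt ℝ 1 a y) (hb : ContDiffAt ℝ 1 b y) (hc : ContDiffAt ℝ 1 c y)
    (h : 0 < sqRad (a y) (b y) ∨ c y ≠ 0) :
    ContDiffAt ℝ 1 (fun x => scale (t x) (p x) (a x) (b x) (c x)) y := by
  have h0 := (radicand_pos (t y) (p y) h).ne'
  have hq := contDiffAt_sqRad ha hb
  unfold spread at h0
  unfold scale spread
  fun_prop (disch := assumption)

lemma contDiffAt_dir (ht : ContDiffAt ℝ 1 t y) (hp : ContDiffAt ℝ 1 p y)
    (hm : ContDiffAt ℝ 1 m y)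
    (ha : ContDiffAt ℝ 1 a y) (hb : ContDiffAt ℝ 1 b y) (hc : ContDiffAt ℝ 1 c y)
    (h : 0 < sqRad (a y) (b y) ∨ c y ≠ 0) :
    ContDiffAt ℝ 1 (fun x => dir₁ (t x) (p x) (m x) (a x) (b x) (c x)) y ∧
    ContDiffAt ℝ 1 (fun x => dir₂ (t x) (p x) (m x) (a x) (b x) (c x)) y ∧
    ContDiffAt ℝ 1 (fun x => dir₃ (t x) (p x) (m x) (a x) (b x) (c x)) y := by
  have hq := contDiffAt_sqRad ha hb
  have hE := contDiffAt_scale ht hp ha hb hc h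
  have h0 := (scale_pos (t y) (p y) h).ne'
  refine ⟨?_, ?_, ?_⟩
  · unfold dir₁ planar₁; fun_prop
  · unfold dir₂ planar₂; fun_prop
  · unfold dir₃; fun_prop (disch := assumption)

lemma contDiffAt_dirSq (ht : ContDiffAt ℝ 1 t y) (hp : ContDiffAt ℝ 1 p y)
    (hm : ContDiffAt ℝ 1 m y)
    (ha : ContDiffAt ℝ 1 a y) (hb : ContDiffAt ℝ 1 b y) (hc : ContDiffAt ℝ 1 c y)
    (h : 0 < sqRad (a y) (b y) ∨ c y ≠ 0) :
    ContDiffAt ℝ 1 (fun x => dirSq (t x) (p x) (m x) (a x) (b x) (c x)) y := by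
  obtain ⟨h1, h2, h3⟩ := contDiffAt_dir ht hp hm ha hb hc h
  unfold dirSq; fun_prop

lemma contDiffAt_factor (ht : ContDiffAt ℝ 1 t y) (hp : ContDiffAt ℝ 1 p y)
    (hl : ContDiffAt ℝ 1 l y) (hm : ContDiffAt ℝ 1 m y)
    (ha : ContDiffAt ℝ 1 a y) (hb : ContDiffAt ℝ 1 b y) (hc : ContDiffAt ℝ 1 c y)
    (h : 0 < sqRad (a y) (b y) ∨ c y ≠ 0)
    (hd : 0 < dirSq (t y) (p y) (m y) (a y) (b y) (c y)) (hlog : 0 < 5 - 4 * t y * c y) :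
    ContDiffAt ℝ 1 (fun x => factor (t x) (p x) (l x) (m x) (a x) (b x) (c x)) y := by
  have hq := contDiffAt_sqRad ha hb
  have hE := contDiffAt_scale ht hp ha hb hc h
  have h0 := pow_ne_zero 2 (scale_pos (t y) (p y) h).ne'
  have hd' := contDiffAt_dirSq ht hp hm ha hb hc h
  have hd0 := hd.ne'
  have hds := (Real.sqrt_pos.2 hd).ne'
  have hl0 := hlog.ne'
  unfold factor logNorm height
  fun_prop (disch := assumption)

end Smooth

lemma contDiffAt_line (a α : ℝ) : ContDiffAt ℝ 1 (fun s : ℝ => a + s * α) 0 := by fun_prop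

/-- The eversion proper is immersed off the axis. -/
lemma immersed_of_ruled {t a b c α β γ : ℝ} (ht : |t| ≤ 1) (hq : 0 < sqRad a b)
    (hv : a * α + b * β + c * γ = 0)
    (hX : HasDerivAt (fun s : ℝ =>
      image t (1 - |t|) 0 0 (a + s * α) (b + s * β) (c + s * γ)) 0 0) :
    α = 0 ∧ β = 0 ∧ γ = 0 := by
  obtain ⟨-, k3, k1, k2⟩ := hasDerivAt_of_image hq hX
  obtain ⟨he₁, he₂⟩ := hasDerivAt_unit α β hq
  have hh := hasDerivAt_ratio c α β γ hq
  have h3 := ((((hh.const_mul 2).fun_mul he₁).fun_mul he₂).fun_sub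
    (((he₁.fun_pow 2).fun_sub (he₂.fun_pow 2)).const_mul (t / 2))).fun_sub (hh.const_mul t)
  have h3' := h3.unique (k3.congr_of_eventuallyEq (by
    filter_upwards [eventually_sqRad_pos α β hq] with s hs
    rw [← height_eq hs, logNorm]
    have := scale_pos (c := c + s * γ) t (1 - |t|) (.inl hs)
    field_simp
    ring))
  simp only [zero_mul, add_zero] at h3'
  have hr := Real.sqrt_pos.2 hq
  have hxy : (a / √(sqRad a b)) ^ 2 + (b / √(sqRad a b)) ^ 2 = 1 := by
    rw [div_pow, div_pow, Real.sq_sqrt hq.le, ← add_div]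
    exact div_self hq.ne'
  obtain ⟨hω, hη⟩ := cylinder_core ht hxy k1 k2 (by rw [← h3']; push_cast; ring)
  exact tangent_eq_zero hq hv hω hη

/-- The passage from the ruled surface to a surface of revolution is immersed off the axis. -/
lemma immersed_of_linear {t l a b c α β γ : ℝ} (ht : t ^ 2 = 1) (hl : l ∈ Set.Icc (0 : ℝ) 1)
    (hs : a ^ 2 + b ^ 2 + c ^ 2 = 1) (hq : 0 < sqRad a b)
    (hv : a * α + b * β + c * γ = 0)
    (hX : HasDerivAt (fun s : ℝ => image t 0 l 0 (a + s * α) (b + s * β) (c + s * γ)) 0 0) :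
    α = 0 ∧ β = 0 ∧ γ = 0 := by
  obtain ⟨k0, -, k1, k2⟩ := hasDerivAt_of_image hq hX
  have hr := Real.sqrt_pos.2 hq
  have hrr := Real.sq_sqrt hq.le
  have hxy : (a / √(sqRad a b)) ^ 2 + (b / √(sqRad a b)) ^ 2 = 1 := by
    rw [div_pow, div_pow, Real.sq_sqrt hq.le, ← add_div]
    exact div_self hq.ne'
  suffices h : (a * β - b * α) / sqRad a b = 0 ∧
      (γ * sqRad a b - c * (2 * (a * α + b * β))) / sqRad a b ^ 2 = 0 from
    tangent_eq_zero hq hv h.1 h.2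
  set x := a / √(sqRad a b)
  set y := b / √(sqRad a b)
  set ω := (a * β - b * α) / sqRad a b with hω
  set η := (γ * sqRad a b - c * (2 * (a * α + b * β))) / sqRad a b ^ 2 with hη
  have h1 : ω * (c / sqRad a b) = 0 := by
    linear_combination -x * k1 - y * k2 - ω * (c / sqRad a b) * (hxy)
  have h2 : η = - (t * ω) := by
    linear_combination x * k2 - y * k1 - (ω * t + η) * hxy
  rcases mul_eq_zero.1 h1 with h1 | h1
  · exact ⟨h1, by rw [h2, h1]; ring⟩
  have hc : c = 0 := by simpa [hq.ne'] using h1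
  subst hc
  have hq1 : sqRad a b = 1 := by unfold sqRad; linarith
  have hq1' : a ^ 2 + b ^ 2 = 1 := hq1
  have hv' : a * α + b * β = 0 := by linarith
  have hγ : η = γ := by rw [hη, hq1]; ring
  have hω' : ω = a * β - b * α := by rw [hω, hq1, div_one]
  have hα : α = -ω * b := by rw [hω']; linear_combination a * hv' - α * hq1'
  have hβ : β = ω * a := by rw [hω']; linear_combination b * hv' - β * hq1'
  have dq : HasDerivAt (fun s : ℝ => sqRad (a + s * α) (b + s * β)) 0 0 := by
    simpa [hv'] using hasDerivAt_sqRad a b α β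
  have dc := hasDerivAt_line 0 γ
  have dE : HasDerivAt (fun s : ℝ => scale t 0 (a + s * α) (b + s * β) (0 + s * γ)) 0 0 := by
    have d := ((dq.fun_pow 2).fun_add ((((dq.const_mul t).fun_pow 2).fun_add
      (dc.fun_pow 2)).const_mul 4)).sqrt (by
        have h : (1 : ℝ) + 4 * t ^ 2 ≠ 0 := by positivity
        simpa [hq1] using h)
    have d' := (dq.fun_add d).div_const 2
    simp only [mul_zero, zero_mul, add_zero, ne_eq, OfNat.ofNat_ne_zero, not_false_eq_true,
      zero_pow, zero_div, Nat.add_one_sub_one, pow_one] at d'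
    refine d'.congr_of_eventuallyEq (.of_forall fun s => ?_)
    simp [scale, spread]
  have hE := scale_pos (a := a) (b := b) (c := 0) t 0 (.inl hq)
  have da := hasDerivAt_line a α
  have db := hasDerivAt_line b β
  have dZ : HasDerivAt (fun s : ℝ => height t (a + s * α) (b + s * β) (0 + s * γ)) (-t * γ) 0 := by
    have d := (((((da.const_mul 2).fun_mul db).fun_mul dc).fun_sub
      ((((da.fun_pow 2).fun_sub (db.fun_pow 2)).const_mul (t / 2)).fun_mul dq)).fun_sub
      ((dc.const_mul t).fun_mul dq))
    refine d.congr_deriv ?_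
    rw [← hγ, h2]
    simp [hq1, hα, hβ]
    ring
  have dlog := (((dc.const_mul (4 * t)).const_sub 5).log (by simp)).const_mul (l / 2)
  have dS := ((dZ.fun_div (dE.fun_pow 2) (by simpa using hE.ne')).const_mul (1 - l)).fun_add dlog
  have h0 := k0.unique dS
  simp only [zero_mul, add_zero, mul_zero, sub_zero] at h0
  have hE2 : 0 < scale t 0 a b 0 ^ 2 := by positivity
  have h5 : t * γ * ((1 - l) / scale t 0 a b 0 ^ 2 + 2 * l / 5) = 0 := by
    field_simp at h0 ⊢
    linarith
  have hpos : 0 < (1 - l) / scale t 0 a b 0 ^ 2 + 2 * l / 5 := by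
    rcases hl.2.lt_or_eq with h | h
    · have h6 : 0 < 1 - l := by linarith
      have := hl.1
      positivity
    · rw [h]; norm_num
  have h6 := (mul_eq_zero.1 h5).resolve_right hpos.ne'
  have ht0 : t ≠ 0 := by rintro rfl; norm_num at ht
  have hγ0 : γ = 0 := (mul_eq_zero.1 h6).resolve_left ht0
  have hω0 : ω = 0 := by
    have : t * ω = 0 := by linarith
    exact (mul_eq_zero.1 this).resolve_left ht0
  exact ⟨hω0, by rw [hγ, hγ0]⟩

lemma hasDerivAt_components {t p l m a b c α β γ : ℝ}
    (hX : HasDerivAt (fun s : ℝ => image t p l m (a + s * α) (b + s * β) (c + s * γ)) 0 0) :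
    HasDerivAt (fun s : ℝ => factor t p l m (a + s * α) (b + s * β) (c + s * γ) *
      dir₁ t p m (a + s * α) (b + s * β) (c + s * γ)) 0 0 ∧
    HasDerivAt (fun s : ℝ => factor t p l m (a + s * α) (b + s * β) (c + s * γ) *
      dir₂ t p m (a + s * α) (b + s * β) (c + s * γ)) 0 0 :=
  ⟨hasDerivAt_comp_zero (L := fun X => X.1) hX (by fun_prop),
    hasDerivAt_comp_zero (L := fun X => X.2.1) hX (by fun_prop)⟩

lemma factor_pos {t p l m a b c : ℝ} (h : 0 < dirSq t p m a b c) : 0 < factor t p l m a b c := by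
  have := Real.sqrt_pos.2 h
  unfold factor; positivity

/-- The surfaces of revolution of the final stage are immersed off the axis. -/
lemma immersed_of_revolution {t m a b c α β γ : ℝ} (ht : t ^ 2 = 1) (hm : m ∈ Set.Icc (0 : ℝ) 1)
    (hs : a ^ 2 + b ^ 2 + c ^ 2 = 1) (hq : 0 < sqRad a b) (hv : a * α + b * β + c * γ = 0)
    (hX : HasDerivAt (fun s : ℝ => image t 0 1 m (a + s * α) (b + s * β) (c + s * γ)) 0 0) :
    α = 0 ∧ β = 0 ∧ γ = 0 := by
  have hd : 0 < dirSq t 0 m a b c := dirSq_pos hs hm fun _ => ⟨ht, rfl⟩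
  have hta : |t| ≤ 1 := by rw [← sq_abs] at ht; nlinarith [abs_nonneg t]
  have hlog : 0 < 5 - 4 * t * c := arg_log_pos hs hta
  have ht0 : t ≠ 0 := by rintro rfl; norm_num at ht
  have hlin := contDiffAt_line
  have hc1 : ∀ k : ℝ, ContDiffAt ℝ 1 (fun _ : ℝ => k) 0 := fun k => contDiffAt_const
  have dc := hasDerivAt_line c γ
  have hγ : γ = 0 := by
    have k := hasDerivAt_comp_zero (L := fun X => X.1 ^ 2 + X.2.1 ^ 2 + X.2.2 ^ 2) hX
      (by fun_prop)
    have e1 := (contDiffAt_dirSq (hc1 t) (hc1 0) (hc1 m) (hlin a α) (hlin b β) (hlin c γ)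
      (.inl (by simpa using hq))).continuousAt.eventually (lt_mem_nhds (by simpa using hd))
    have dl := (dc.const_mul (4 * t)).const_sub 5
    have hlog0 : 0 < 5 - 4 * t * (c + 0 * γ) := by simpa using hlog
    have e2 := dl.continuousAt.eventually (lt_mem_nhds hlog0)
    have h := dl.unique (k.congr_of_eventuallyEq (by
      filter_upwards [e1, e2] with s h1 h2
      rw [image_sq h1, ← Real.exp_nat_mul, logNorm]
      convert (Real.exp_log h2).symm using 2
      push_cast; ring))
    have h' : t * γ = 0 := by linarith
    exact (mul_eq_zero.1 h').resolve_left ht0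
  subst hγ
  have hv' : a * α + b * β = 0 := by linarith
  obtain ⟨k1, k2⟩ := hasDerivAt_components hX
  have hF := ((contDiffAt_factor (hc1 t) (hc1 0) (hc1 1) (hc1 m) (hlin a α) (hlin b β) (hlin c 0)
    (.inl (by simpa using hq)) (by simpa using hd) (by simpa using hlog)).differentiableAt
      one_ne_zero).hasDerivAt
  set D := deriv (fun s : ℝ => factor t 0 1 m (a + s * α) (b + s * β) (c + s * 0)) 0
  have dq : HasDerivAt (fun s : ℝ => sqRad (a + s * α) (b + s * β)) 0 0 := by
    simpa [hv'] using hasDerivAt_sqRad a b α β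
  have da := hasDerivAt_line a α
  have db := hasDerivAt_line b β
  have d1 := ((((dq.fun_mul ((da.const_mul t).fun_add (db.const_mul 0))).fun_sub
    (dc.fun_mul db)).const_mul 2).const_mul (1 - m)).fun_add ((da.const_mul t).const_mul m)
  have d2 := ((((dq.fun_mul ((db.const_mul t).fun_add (da.const_mul 0))).fun_add
    (dc.fun_mul da)).const_mul 2).const_mul (1 - m)).fun_add ((db.const_mul t).const_mul m)
  have h1 := (hF.fun_mul d1).unique k1
  have h2 := (hF.fun_mul d2).unique k2
  simp only [zero_mul, add_zero, mul_zero, zero_add] at h1 h2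
  have hFp := factor_pos (l := 1) hd
  generalize factor t 0 1 m a b c = F at *
  set g₁ := (1 - m) * (2 * sqRad a b * t) + m * t with hg₁
  set g₂ := (1 - m) * (2 * c) with hg₂
  have h1' : D * (a * g₁ - b * g₂) + F * (α * g₁ - β * g₂) = 0 := by
    rw [← h1]; ring
  have h2' : D * (a * g₂ + b * g₁) + F * (α * g₂ + β * g₁) = 0 := by
    rw [← h2]; ring
  have hg : 0 < g₁ ^ 2 + g₂ ^ 2 := by
    have : 0 < 2 * (1 - m) * sqRad a b + m := by
      rcases hm.1.lt_or_eq with h | h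
      · have : 0 ≤ 1 - m := by linarith [hm.2]
        positivity
      · rw [← h]; linarith
    have : g₁ ^ 2 = (2 * (1 - m) * sqRad a b + m) ^ 2 := by
      rw [hg₁]; linear_combination ((1 - m) * (2 * sqRad a b) + m) ^ 2 * ht
    rw [this]; positivity
  have h3 : F * (g₁ ^ 2 + g₂ ^ 2) * (a * β - b * α) = 0 := by
    linear_combination (a * g₁ - b * g₂) * h2' - (a * g₂ + b * g₁) * h1'
  have h4 : a * β - b * α = 0 := (mul_eq_zero.1 h3).resolve_left (by positivity)
  exact tangent_eq_zero hq hv (by rw [h4, zero_div]) (by rw [hv']; simp)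

/-- All the surfaces are immersed at the poles. -/
lemma immersed_of_pole {t p l m c α β γ : ℝ} (ht : |t| ≤ 1) (hc : c ^ 2 = 1)
    (hm : m ∈ Set.Icc (0 : ℝ) 1) (htp : m ≠ 0 → t ^ 2 = 1 ∧ p = 0) (hv : c * γ = 0)
    (hX : HasDerivAt (fun s : ℝ => image t p l m (0 + s * α) (0 + s * β) (c + s * γ)) 0 0) :
    α = 0 ∧ β = 0 ∧ γ = 0 := by
  have hs : (0 : ℝ) ^ 2 + 0 ^ 2 + c ^ 2 = 1 := by simp [hc]
  have hd : 0 < dirSq t p m 0 0 c := dirSq_pos hs hm htp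
  have hlog : 0 < 5 - 4 * t * c := arg_log_pos hs ht
  have hc0 : c ≠ 0 := by rintro rfl; norm_num at hc
  have hγ : γ = 0 := (mul_eq_zero.1 hv).resolve_left hc0
  subst hγ
  have hlin := contDiffAt_line
  have hc1 : ∀ k : ℝ, ContDiffAt ℝ 1 (fun _ : ℝ => k) 0 := fun k => contDiffAt_const
  obtain ⟨k1, k2⟩ := hasDerivAt_components hX
  have hF := ((contDiffAt_factor (hc1 t) (hc1 p) (hc1 l) (hc1 m) (hlin 0 α) (hlin 0 β) (hlin c 0)
    (.inr (by simpa using hc0)) (by simpa using hd) (by simpa using hlog)).differentiableAt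
      one_ne_zero).hasDerivAt
  have dq := hasDerivAt_sqRad 0 0 α β
  have da := hasDerivAt_line 0 α
  have db := hasDerivAt_line 0 β
  have dc := hasDerivAt_line c 0
  have d1 := ((((dq.fun_mul ((da.const_mul t).fun_add (db.const_mul p))).fun_sub
    (dc.fun_mul db)).const_mul 2).const_mul (1 - m)).fun_add ((da.const_mul t).const_mul m)
  have d2 := ((((dq.fun_mul ((db.const_mul t).fun_add (da.const_mul p))).fun_add
    (dc.fun_mul da)).const_mul 2).const_mul (1 - m)).fun_add ((db.const_mul t).const_mul m)
  have h1 := (hF.fun_mul d1).unique k1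
  have h2 := (hF.fun_mul d2).unique k2
  have hFp := factor_pos (l := l) hd
  have hsq0 : sqRad 0 0 = 0 := by simp [sqRad]
  simp only [zero_mul, add_zero, mul_zero, zero_add, hsq0, sub_zero] at h1 h2
  have h1' := (mul_eq_zero.1 h1).resolve_left hFp.ne'
  have h2' := (mul_eq_zero.1 h2).resolve_left hFp.ne'
  have hg : 0 < (2 * (1 - m) * c) ^ 2 + (m * t) ^ 2 := by
    by_cases h : m = 0
    · rw [h]; nlinarith
    · rw [mul_pow m, (htp h).1]; positivity
  have hα : ((2 * (1 - m) * c) ^ 2 + (m * t) ^ 2) * α = 0 := by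
    linear_combination (m * t) * h1' + (2 * (1 - m) * c) * h2'
  have hβ : ((2 * (1 - m) * c) ^ 2 + (m * t) ^ 2) * β = 0 := by
    linear_combination (m * t) * h2' - (2 * (1 - m) * c) * h1'
  exact ⟨(mul_eq_zero.1 hα).resolve_left hg.ne', (mul_eq_zero.1 hβ).resolve_left hg.ne', rfl⟩

/-- The eversion, as a family of maps of space with parameters `t`, `p`, `l`, `m`: the surface
`image`, reflected in the horizontal plane and translated vertically. -/
def family (z : (ℝ × ℝ × ℝ × ℝ) × E3) : E3 :=
  !₂[(image z.1.1 z.1.2.1 z.1.2.2.1 z.1.2.2.2 (z.2 0) (z.2 1) (z.2 2)).1,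
    (image z.1.1 z.1.2.1 z.1.2.2.1 z.1.2.2.2 (z.2 0) (z.2 1) (z.2 2)).2.1,
    2 * z.1.2.2.2 - (image z.1.1 z.1.2.1 z.1.2.2.1 z.1.2.2.2 (z.2 0) (z.2 1) (z.2 2)).2.2]

/-- Clamping to `[0, 1]`. -/
def ramp (s : ℝ) : ℝ := max 0 (min 1 s)

/-- The path of parameters: `t` crosses `[-1, 1]` in the middle, where `l = m = 0`; near both
ends `t = ±1` is constant, and `l` and then `m` run between `0` and `1`. -/
def path (s : ℝ) : ℝ × ℝ × ℝ × ℝ :=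
  (max (-1) (min 1 (3 - 6 * s)), 1 - |max (-1) (min 1 (3 - 6 * s))|,
    ramp (|3 - 6 * s| - 1), ramp (|3 - 6 * s| - 2))

lemma continuous_path : Continuous path := by
  unfold path ramp; fun_prop

lemma ramp_mem (s : ℝ) : ramp s ∈ Set.Icc (0 : ℝ) 1 :=
  ⟨le_max_left _ _, max_le zero_le_one (min_le_left _ _)⟩

lemma ramp_of_nonpos {s : ℝ} (h : s ≤ 0) : ramp s = 0 :=
  max_eq_left ((min_le_right _ _).trans h)

lemma ramp_of_one_le {s : ℝ} (h : 1 ≤ s) : ramp s = 1 := by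
  unfold ramp; rw [min_eq_left h]; exact max_eq_right zero_le_one

/-- The parameters that occur along the eversion. -/
def Admissible (t p l m : ℝ) : Prop :=
  |t| ≤ 1 ∧ p = 1 - |t| ∧ l ∈ Set.Icc (0 : ℝ) 1 ∧ m ∈ Set.Icc (0 : ℝ) 1 ∧
    (l ≠ 0 → t ^ 2 = 1 ∧ p = 0) ∧ (m ≠ 0 → l = 1)

lemma admissible_path (s : ℝ) :
    Admissible (path s).1 (path s).2.1 (path s).2.2.1 (path s).2.2.2 := by
  unfold path
  set r := 3 - 6 * s
  refine ⟨?_, rfl, ramp_mem _, ramp_mem _, fun h => ?_, fun h => ?_⟩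
  · exact abs_le.2 ⟨le_max_left _ _, max_le (by norm_num) (min_le_left _ _)⟩
  · have h1 : 1 < |r| := by
      by_contra! h'
      exact h (ramp_of_nonpos (by linarith))
    rcases lt_abs.1 h1 with h2 | h2
    · have : max (-1) (min 1 r) = 1 := by rw [min_eq_left h2.le]; norm_num
      simp [this]
    · have : max (-1) (min 1 r) = -1 := by
        rw [min_eq_right (by linarith)]; exact max_eq_left (by linarith)
      simp [this]
  · have h1 : 2 < |r| := by
      by_contra! h'
      exact h (ramp_of_nonpos (by linarith))
    exact ramp_of_one_le (by linarith)

lemma immersed {t p l m a b c α β γ : ℝ} (h : Admissible t p l m)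
    (hs : a ^ 2 + b ^ 2 + c ^ 2 = 1) (hv : a * α + b * β + c * γ = 0)
    (hX : HasDerivAt (fun s : ℝ => image t p l m (a + s * α) (b + s * β) (c + s * γ)) 0 0) :
    α = 0 ∧ β = 0 ∧ γ = 0 := by
  obtain ⟨ht, hp, hl, hm, hlt, hml⟩ := h
  have htp : m ≠ 0 → t ^ 2 = 1 ∧ p = 0 := fun h => hlt (by simp [hml h])
  rcases (sqRad_nonneg a b).lt_or_eq with hq | hq
  · by_cases hm0 : m = 0
    · subst hm0
      by_cases hl0 : l = 0
      · subst hl0 hp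
        exact immersed_of_ruled ht hq hv hX
      · obtain ⟨ht1, rfl⟩ := hlt hl0
        exact immersed_of_linear ht1 hl hs hq hv hX
    · obtain ⟨ht1, rfl⟩ := htp hm0
      obtain rfl := hml hm0
      exact immersed_of_revolution ht1 hm hs hq hv hX
  · have ha : a = 0 := by unfold sqRad at hq; nlinarith
    have hb : b = 0 := by unfold sqRad at hq; nlinarith
    subst ha hb
    exact immersed_of_pole ht (by linarith) hm htp (by linarith) hX

lemma norm_sq_eq {x : E3} (hx : ‖x‖ = 1) : x 0 ^ 2 + x 1 ^ 2 + x 2 ^ 2 = 1 := by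
  have h := EuclideanSpace.norm_sq_eq x
  rw [hx, Fin.sum_univ_three] at h
  simpa using h.symm

lemma contDiffAt_image {t p l m : ℝ} {x : E3} (h : Admissible t p l m) (hx : ‖x‖ = 1) :
    ContDiffAt ℝ 1 (fun z : (ℝ × ℝ × ℝ × ℝ) × E3 =>
      image z.1.1 z.1.2.1 z.1.2.2.1 z.1.2.2.2 (z.2 0) (z.2 1) (z.2 2)) ((t, p, l, m), x) := by
  have hs := norm_sq_eq hx
  obtain ⟨ht, hp, hl, hm, hlt, hml⟩ := h
  have htp : m ≠ 0 → t ^ 2 = 1 ∧ p = 0 := fun h => hlt (by simp [hml h])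
  have hqc : 0 < sqRad (x 0) (x 1) ∨ x 2 ≠ 0 := by
    by_contra! h
    have : x 0 ^ 2 + x 1 ^ 2 ≤ 0 := h.1
    nlinarith [h.2]
  have hd : 0 < dirSq t p m (x 0) (x 1) (x 2) := dirSq_pos hs hm htp
  have hlog := arg_log_pos hs ht
  have c0 : ∀ i : Fin 3, ContDiffAt ℝ 1 (fun z : (ℝ × ℝ × ℝ × ℝ) × E3 => z.2 i)
    ((t, p, l, m), x) := fun i => by fun_prop
  have ct : ContDiffAt ℝ 1 (fun z : (ℝ × ℝ × ℝ × ℝ) × E3 => z.1.1) ((t, p, l, m), x) := by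
    fun_prop
  have cp : ContDiffAt ℝ 1 (fun z : (ℝ × ℝ × ℝ × ℝ) × E3 => z.1.2.1) ((t, p, l, m), x) := by
    fun_prop
  have cl : ContDiffAt ℝ 1 (fun z : (ℝ × ℝ × ℝ × ℝ) × E3 => z.1.2.2.1) ((t, p, l, m), x) := by
    fun_prop
  have cm : ContDiffAt ℝ 1 (fun z : (ℝ × ℝ × ℝ × ℝ) × E3 => z.1.2.2.2) ((t, p, l, m), x) := by
    fun_prop
  have hF := contDiffAt_factor ct cp cl cm (c0 0) (c0 1) (c0 2) hqc hd hlog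
  obtain ⟨h1, h2, h3⟩ := contDiffAt_dir ct cp cm (c0 0) (c0 1) (c0 2) hqc
  exact (hF.mul h1).prodMk ((hF.mul h2).prodMk (hF.mul h3))

lemma contDiffAt_family {t p l m : ℝ} {x : E3} (h : Admissible t p l m) (hx : ‖x‖ = 1) :
    ContDiffAt ℝ 1 family ((t, p, l, m), x) := by
  have hi := contDiffAt_image h hx
  rw [contDiffAt_euclidean]
  intro i
  fin_cases i
  · exact hi.fst
  · exact hi.snd.fst
  · exact ContDiffAt.sub (by fun_prop) hi.snd.snd

lemma family_immersed {t p l m : ℝ} {x v : E3} (h : Admissible t p l m) (hx : ‖x‖ = 1)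
    (hxv : inner ℝ x v = 0) (hf : fderiv ℝ (fun y => family ((t, p, l, m), y)) x v = 0) :
    v = 0 := by
  have hd : DifferentiableAt ℝ (fun y => family ((t, p, l, m), y)) x :=
    ((contDiffAt_family h hx).comp x (by fun_prop)).differentiableAt one_ne_zero
  have hl : HasDerivAt (fun s : ℝ => family ((t, p, l, m), x + s • v)) 0 0 := by
    have h2 := hd.hasFDerivAt.hasLineDerivAt v
    rw [hf] at h2
    exact h2
  have hl' : ∀ i, HasDerivAt (fun s : ℝ => family ((t, p, l, m), x + s • v) i) 0 0 := fun i =>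
    ((EuclideanSpace.proj i : E3 →L[ℝ] ℝ).hasFDerivAt.comp_hasDerivAt 0 hl).congr_deriv
      (map_zero _)
  have h0 := hl' 0
  have h1 := hl' 1
  have h2 := (hl' 2).const_sub (2 * m)
  have hX : HasDerivAt (fun s : ℝ =>
      image t p l m (x 0 + s * v 0) (x 1 + s * v 1) (x 2 + s * v 2)) 0 0 := by
    refine HasDerivAt.prodMk (f₁' := 0) (f₂' := (0, 0)) ?_
      (HasDerivAt.prodMk (f₁' := 0) (f₂' := 0) ?_ ?_)
    · simpa [family, image] using h0
    · simpa [family, image] using h1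
    · simpa [family, image] using h2
  have hv : x 0 * v 0 + x 1 * v 1 + x 2 * v 2 = 0 := by
    rw [PiLp.inner_apply, Fin.sum_univ_three] at hxv
    simp only [RCLike.inner_apply, conj_trivial] at hxv
    linarith
  obtain ⟨e0, e1, e2⟩ := immersed h (norm_sq_eq hx) hv hX
  ext i
  fin_cases i
  · exact e0
  · exact e1
  · exact e2

lemma family_end {t : ℝ} {x : E3} (ht : t ^ 2 = 1) (hx : ‖x‖ = 1) :
    family ((t, 0, 1, 1), x) = t • x := by
  have hs := norm_sq_eq hx
  have hta : |t| ≤ 1 := by rw [← sq_abs] at ht; nlinarith [abs_nonneg t]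
  have hlog := arg_log_pos hs hta
  have hd : dirSq t 0 1 (x 0) (x 1) (x 2) = 5 - 4 * t * x 2 := by
    unfold dirSq dir₁ dir₂ dir₃
    linear_combination t ^ 2 * hs + ht
  have hF : factor t 0 1 1 (x 0) (x 1) (x 2) = 1 := by
    have : logNorm t 0 1 (x 0) (x 1) (x 2) = Real.log √(5 - 4 * t * x 2) := by
      rw [Real.log_sqrt hlog.le]; unfold logNorm; ring
    rw [factor, this, hd, Real.exp_log (Real.sqrt_pos.2 hlog)]
    exact div_self (Real.sqrt_pos.2 hlog).ne'
  ext i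
  fin_cases i <;> simp [family, image, hF, dir₁, dir₂, dir₃]

lemma path_zero : path 0 = (1, 0, 1, 1) := by
  norm_num [path, ramp]

lemma path_one : path 1 = (-1, 0, 1, 1) := by
  norm_num [path, ramp]

end SphereEversion

/-- **Sphere eversion**: the standard inclusion `f₀ : S² ↪ ℝ³` and its antipode
`f₁ = -f₀` are regularly homotopic. -/
theorem sphere_eversion :
    RegularlyHomotopic (fun x : S2 => (x : E3)) (fun x : S2 => -(x : E3)) := by
  have hnorm : ∀ x : S2, ‖(x : E3)‖ = 1 := fun x => by simp
  have h := regularlyHomotopic_of_contDiffAt SphereEversion.family SphereEversion.path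
    SphereEversion.continuous_path
    (fun s x hx => SphereEversion.contDiffAt_family (SphereEversion.admissible_path s) hx)
    (fun s x v hx hv hf =>
      SphereEversion.family_immersed (SphereEversion.admissible_path s) hx hv hf)
  convert h using 2 with x x
  · rw [SphereEversion.path_zero, SphereEversion.family_end (by norm_num) (hnorm x), one_smul]
  · rw [SphereEversion.path_one, SphereEversion.family_end (by norm_num) (hnorm x), neg_one_smul]

end
end
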